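/- arXiv:0909.1897 — 11 statements merged into one kernel-verified Lean document; each statement's English description precedes it below -/
import Mathlib

section
/- Let g be a finite-dimensional simple real Lie algebra whose Killing form κ_g is negative definite, and let d = dim_ℝ g. On N := g × g × g define the commutative bilinear multiplication x∘y := (½(⁅x₂,y₃⁆+⁅y₂,x₃⁆), ½(⁅x₃,y₁⁆+⁅y₃,x₁⁆), ½(⁅x₁,y₂⁆+⁅y₁,x₂⁆)) (the Nahm algebra of g) and the bilinear form τ(x,y) := −½·Σ_{i=1}^{3} κ_g(x_i, y_i). Then: (i) τ is positive definite and invariant, i.e. τ(x∘y, z) = τ(x, y∘z) for all x,y,z ∈ N; (ii) the left-multiplication operators L(x) : y ↦ x∘y satisfy tr L(x) = 0 and tr(L(x)∘L(y)) = τ(x,y) for all x,y ∈ N, so that (N, ∘, τ) is a 3d-dimensional Riemannian special Einstein commutative Codazzi algebra with Einstein constant 1; and (iii) (N, ∘, τ) is not conformally associative: there exist x, y, z, u ∈ N such that τ((x∘y)∘z − x∘(y∘z), u) ≠ (1/(3d−1))·(τ(y,z)τ(x,u) − τ(x,y)τ(z,u)). -/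
variable {g : Type*} [LieRing g] [LieAlgebra ℝ g]

/-- The Nahm multiplication on `g × g × g`:
`x∘y = (½(⁅x₂,y₃⁆+⁅y₂,x₃⁆), ½(⁅x₃,y₁⁆+⁅y₃,x₁⁆), ½(⁅x₁,y₂⁆+⁅y₁,x₂⁆))`. -/
noncomputable def nahmMul (x y : g × g × g) : g × g × g :=
  ((1 / 2 : ℝ) • (⁅x.2.1, y.2.2⁆ + ⁅y.2.1, x.2.2⁆),
   (1 / 2 : ℝ) • (⁅x.2.2, y.1⁆ + ⁅y.2.2, x.1⁆),
   (1 / 2 : ℝ) • (⁅x.1, y.2.1⁆ + ⁅y.1, x.2.1⁆))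

/-- Left multiplication by `x` in the Nahm algebra, as a linear endomorphism. -/
noncomputable def nahmL (x : g × g × g) : Module.End ℝ (g × g × g) where
  toFun y := nahmMul x y
  map_add' y z := by
    simp only [nahmMul, Prod.fst_add, Prod.snd_add, lie_add, add_lie, Prod.mk_add_mk,
      Prod.mk.injEq, smul_add]
    refine ⟨?_, ?_, ?_⟩ <;> abel
  map_smul' c y := by
    simp only [nahmMul, Prod.smul_fst, Prod.smul_snd, lie_smul, smul_lie, Prod.smul_mk,
      Prod.mk.injEq, RingHom.id_apply]
    refine ⟨?_, ?_, ?_⟩ <;> module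

/-- The bilinear form `τ(x,y) = −½·Σᵢ κ_g(xᵢ,yᵢ)` on `g × g × g`, where `κ_g` is the
Killing form of `g`. -/
noncomputable def nahmTau (x y : g × g × g) : ℝ :=
  -(1 / 2 : ℝ) * (killingForm ℝ g x.1 y.1 + killingForm ℝ g x.2.1 y.2.1 +
    killingForm ℝ g x.2.2 y.2.2)

/-- The trace of an endomorphism of a product is the sum of the traces of its diagonal blocks. -/
theorem LinearMap.trace_prod_eq_add {K M N : Type*} [Field K] [AddCommGroup M] [Module K M]
    [FiniteDimensional K M] [AddCommGroup N] [Module K N] [FiniteDimensional K N]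
    (f : Module.End K (M × N)) :
    LinearMap.trace K (M × N) f =
      LinearMap.trace K M (LinearMap.fst K M N ∘ₗ f ∘ₗ LinearMap.inl K M N) +
        LinearMap.trace K N (LinearMap.snd K M N ∘ₗ f ∘ₗ LinearMap.inr K M N) := by
  have h : f = (f ∘ₗ LinearMap.inl K M N) ∘ₗ LinearMap.fst K M N +
      (f ∘ₗ LinearMap.inr K M N) ∘ₗ LinearMap.snd K M N := by
    refine LinearMap.ext fun p => ?_
    simp [← map_add]
  conv_lhs => rw [h, map_add, LinearMap.trace_comp_comm' (LinearMap.fst K M N),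
    LinearMap.trace_comp_comm' (LinearMap.snd K M N)]

/-- The Nahm multiplication is commutative. -/
theorem nahmMul_comm (x y : g × g × g) : nahmMul x y = nahmMul y x := by
  simp only [nahmMul, add_comm]

/-- The form `nahmTau` is invariant under the Nahm multiplication. -/
theorem nahmTau_nahmMul (x y z : g × g × g) :
    nahmTau (nahmMul x y) z = nahmTau x (nahmMul y z) := by
  have inv (a b c : g) : killingForm ℝ g ⁅a, b⁆ c = killingForm ℝ g a ⁅b, c⁆ :=
    LieModule.traceForm_apply_lie_apply ℝ g g a b c
  have rot (a b c : g) : killingForm ℝ g ⁅a, b⁆ c = killingForm ℝ g b ⁅c, a⁆ := by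
    rw [LieModule.traceForm_comm, ← inv, LieModule.traceForm_comm]
  simp only [nahmMul, nahmTau, map_add, map_smul, LinearMap.add_apply, LinearMap.smul_apply,
    smul_eq_mul]
  rw [inv x.2.1, inv x.2.2, inv x.1, rot y.2.1, rot y.2.2, rot y.1]
  ring

/-- Left multiplications in the Nahm algebra are traceless. -/
theorem trace_nahmL [FiniteDimensional ℝ g] (x : g × g × g) :
    LinearMap.trace ℝ (g × g × g) (nahmL x) = 0 := by
  rw [LinearMap.trace_prod_eq_add, LinearMap.trace_prod_eq_add]
  have h₁ : LinearMap.fst ℝ g (g × g) ∘ₗ nahmL x ∘ₗ LinearMap.inl ℝ g (g × g) = 0 := by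
    ext; simp [nahmL, nahmMul]
  have h₂ : LinearMap.fst ℝ g g ∘ₗ (LinearMap.snd ℝ g (g × g) ∘ₗ nahmL x ∘ₗ
      LinearMap.inr ℝ g (g × g)) ∘ₗ LinearMap.inl ℝ g g = 0 := by
    ext; simp [nahmL, nahmMul]
  have h₃ : LinearMap.snd ℝ g g ∘ₗ (LinearMap.snd ℝ g (g × g) ∘ₗ nahmL x ∘ₗ
      LinearMap.inr ℝ g (g × g)) ∘ₗ LinearMap.inr ℝ g g = 0 := by
    ext; simp [nahmL, nahmMul]
  simp [h₁, h₂, h₃]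

/-- The trace form of the Nahm algebra is `nahmTau`. -/
theorem trace_nahmL_comp_nahmL [FiniteDimensional ℝ g] (x y : g × g × g) :
    LinearMap.trace ℝ (g × g × g) (nahmL x ∘ₗ nahmL y) = nahmTau x y := by
  have block {f : Module.End ℝ g} {a b c d : g}
      (hf : ∀ v, f v = -(1 / 4 : ℝ) • (⁅a, ⁅b, v⁆⁆ + ⁅c, ⁅d, v⁆⁆)) :
      LinearMap.trace ℝ g f = -(1 / 4 : ℝ) * (killingForm ℝ g a b + killingForm ℝ g c d) := by
    have : f = -(1 / 4 : ℝ) • (LieAlgebra.ad ℝ g a ∘ₗ LieAlgebra.ad ℝ g b +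
        LieAlgebra.ad ℝ g c ∘ₗ LieAlgebra.ad ℝ g d) := by
      ext v; simp [hf]
    rw [this, map_smul, map_add, killingForm_apply_apply, killingForm_apply_apply, smul_eq_mul]
  have lie_lie_swap (v a b : g) : ⁅a, ⁅v, b⁆⁆ = -⁅a, ⁅b, v⁆⁆ := by
    rw [← lie_skew v b, lie_neg]
  have lie_swap_lie (v a b : g) : ⁅⁅b, v⁆, a⁆ = -⁅a, ⁅b, v⁆⁆ := (lie_skew _ _).symm
  rw [LinearMap.trace_prod_eq_add, LinearMap.trace_prod_eq_add,
    block (a := x.2.1) (b := y.2.1) (c := x.2.2) (d := y.2.2),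
    block (a := x.1) (b := y.1) (c := x.2.2) (d := y.2.2),
    block (a := x.1) (b := y.1) (c := x.2.1) (d := y.2.1)]
  · simp only [nahmTau]
    ring
  all_goals
    intro v
    simp only [nahmL, nahmMul, LinearMap.comp_apply, LinearMap.coe_mk, AddHom.coe_mk,
      LinearMap.inl_apply, LinearMap.inr_apply, LinearMap.fst_apply, LinearMap.snd_apply,
      Prod.fst_zero, Prod.snd_zero, lie_zero, zero_lie, smul_lie, lie_smul, add_zero,
      zero_add]
    simp only [lie_lie_swap v, lie_swap_lie v]
    module

/-- The Nahm algebra of a compact-type simple real Lie algebra `g` (Killing form negative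
definite), equipped with `τ = −½·Σ κ_g`, is a `3d`-dimensional Riemannian special Einstein
commutative Codazzi algebra with Einstein constant `1` which is not conformally
associative. -/
theorem nahm_algebra_einstein_not_conformally_associative
    [FiniteDimensional ℝ g] [LieAlgebra.IsSimple ℝ g]
    (hneg : ∀ x : g, x ≠ 0 → killingForm ℝ g x x < 0) :
    (∀ x y : g × g × g, nahmMul x y = nahmMul y x) ∧
    Module.finrank ℝ (g × g × g) = 3 * Module.finrank ℝ g ∧
    (∀ x : g × g × g, x ≠ 0 → 0 < nahmTau x x) ∧
    (∀ x y z : g × g × g, nahmTau (nahmMul x y) z = nahmTau x (nahmMul y z)) ∧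
    (∀ x : g × g × g, LinearMap.trace ℝ (g × g × g) (nahmL x) = 0) ∧
    (∀ x y : g × g × g,
      LinearMap.trace ℝ (g × g × g) (nahmL x ∘ₗ nahmL y) = nahmTau x y) ∧
    (∃ x y z u : g × g × g,
      nahmTau (nahmMul (nahmMul x y) z - nahmMul x (nahmMul y z)) u ≠
        (1 / (3 * (Module.finrank ℝ g : ℝ) - 1)) *
          (nahmTau y z * nahmTau x u - nahmTau x y * nahmTau z u)) := by
  refine ⟨nahmMul_comm, ?_, ?_, nahmTau_nahmMul, trace_nahmL, trace_nahmL_comp_nahmL, ?_⟩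
  · simp only [Module.finrank_prod]
    ring
  · intro x hx
    have hle (a : g) : killingForm ℝ g a a ≤ 0 := by
      by_cases ha : a = 0
      · simp [ha]
      · exact (hneg a ha).le
    have h₁ := hle x.1
    have h₂ := hle x.2.1
    have h₃ := hle x.2.2
    simp only [nahmTau]
    by_contra! h
    have eq_zero {a : g} (ha : 0 ≤ killingForm ℝ g a a) : a = 0 :=
      by_contra fun h => (hneg a h).not_ge ha
    exact hx (Prod.ext (eq_zero (by linarith)) (Prod.ext (eq_zero (by linarith))
      (eq_zero (by linarith))))
  · have : Nontrivial g := by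
      by_contra h
      rw [not_nontrivial_iff_subsingleton] at h
      exact LieAlgebra.IsSimple.non_abelian ℝ (L := g) ⟨fun _ _ => Subsingleton.elim _ _⟩
    obtain ⟨a, ha⟩ := exists_ne (0 : g)
    have hd : 3 * (Module.finrank ℝ g : ℝ) - 1 ≠ 0 := by
      rw [sub_ne_zero]
      norm_cast
      omega
    have hk := (hneg a ha).ne
    refine ⟨(a, 0, 0), (a, 0, 0), (0, a, 0), (0, a, 0), ?_⟩
    simp [nahmTau, nahmMul, hk, hd]
end

section
/- Fix n ≥ 2 and κ ∈ ℝ. Let (A, ∘, h) and (A', ∘', h') be two n-dimensional Riemannian special Einstein commutative Codazzi algebras, both with Einstein constant κ and both conformally associative. Then they are isomorphic: there exists a linear bijection Φ : A → A' with Φ(x∘y) = Φ(x)∘'Φ(y) and h'(Φ(x), Φ(y)) = h(x,y) for all x,y ∈ A. -/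
/-- A finite-dimensional real commutative Codazzi algebra: a commutative bilinear
multiplication together with a nondegenerate symmetric invariant bilinear form. -/
structure CommCodazziAlg (A : Type*) [AddCommGroup A] [Module ℝ A] where
  mul : A →ₗ[ℝ] A →ₗ[ℝ] A
  form : A →ₗ[ℝ] A →ₗ[ℝ] ℝ
  mul_comm : ∀ x y, mul x y = mul y x
  form_symm : ∀ x y, form x y = form y x
  form_nondeg : ∀ x, (∀ y, form x y = 0) → x = 0
  invariant : ∀ x y z, form (mul x y) z = form x (mul y z)

namespace CommCodazziAlg

variable {A : Type*} [AddCommGroup A] [Module ℝ A]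

/-- The form is positive definite. -/
def Riemannian (Cz : CommCodazziAlg A) : Prop := ∀ x, x ≠ 0 → 0 < Cz.form x x

/-- All left-multiplication operators are trace free. -/
def Special (Cz : CommCodazziAlg A) : Prop :=
  ∀ x, LinearMap.trace ℝ A (Cz.mul x) = 0

/-- The trace form equals `κ` times the given form. -/
def Einstein (Cz : CommCodazziAlg A) (κ : ℝ) : Prop :=
  ∀ x y, LinearMap.trace ℝ A (Cz.mul x ∘ₗ Cz.mul y) = κ * Cz.form x y

/-- Conformal associativity of an `n`-dimensional Einstein commutative Codazzi algebra with
Einstein constant `κ`. -/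
def ConfAssoc (Cz : CommCodazziAlg A) (n : ℕ) (κ : ℝ) : Prop :=
  ∀ x y z u, Cz.form (Cz.mul (Cz.mul x y) z - Cz.mul x (Cz.mul y z)) u =
    (κ / ((n : ℝ) - 1)) * (Cz.form y z * Cz.form x u - Cz.form x y * Cz.form z u)

end CommCodazziAlg

section SplitAlgebra

variable {B : Type*} [CommRing B] [Algebra ℝ B] [FiniteDimensional ℝ B]

/-- A finite-dimensional commutative real algebra carrying a linear functional that is positive
on squares of nonzero elements is isomorphic to a power of `ℝ`. -/
theorem exists_algEquiv_pi_real_of_pos_mul_self (ℓ : B →ₗ[ℝ] ℝ)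
    (hpos : ∀ b, b ≠ 0 → 0 < ℓ (b * b)) :
    Nonempty (B ≃ₐ[ℝ] (Fin (Module.finrank ℝ B) → ℝ)) := by
  classical
  have hred : IsReduced B := (isReduced_iff_pow_one_lt 2 one_lt_two).2 fun b hb ↦ by
    by_contra hne
    have := hpos b hne
    rw [← sq, hb, map_zero] at this
    exact lt_irrefl _ this
  have : IsArtinianRing B := IsArtinianRing.of_finite ℝ B
  let e : B ≃ₐ[ℝ] ∀ I : MaximalSpectrum B, B ⧸ I.asIdeal :=
    (IsArtinianRing.equivPi B).restrictScalars ℝ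
  have hreal (I : MaximalSpectrum B) : Nonempty ((B ⧸ I.asIdeal) ≃ₐ[ℝ] ℝ) := by
    let : Field (B ⧸ I.asIdeal) := Ideal.Quotient.field I.asIdeal
    refine (Real.nonempty_algEquiv_or (B ⧸ I.asIdeal)).resolve_right ?_
    rintro ⟨f⟩
    set j : B := e.symm (Pi.single I (f.symm Complex.I))
    set u : B := e.symm (Pi.single I 1)
    have hj : j * j = -(u * u) := by
      rw [← map_mul, ← map_mul, ← map_neg, ← Pi.single_mul, ← Pi.single_mul, ← map_mul,
        Complex.I_mul_I, map_neg, map_one, mul_one, Pi.single_neg]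
    have hu0 : u ≠ 0 := by simp [u]
    have hj0 : j ≠ 0 := by simp [j]
    have h₁ := hpos j hj0
    have h₂ := hpos u hu0
    rw [hj, map_neg] at h₁
    linarith
  let e' : B ≃ₐ[ℝ] (MaximalSpectrum B → ℝ) :=
    e.trans (AlgEquiv.piCongrRight fun I ↦ (hreal I).some)
  have : Fintype (MaximalSpectrum B) := Fintype.ofFinite _
  have hcard : Fintype.card (MaximalSpectrum B) = Module.finrank ℝ B := by
    rw [e'.toLinearEquiv.finrank_eq, Module.finrank_fintype_fun_eq_card]
  exact ⟨e'.trans (AlgEquiv.piCongrLeft ℝ (fun _ ↦ ℝ) (Fintype.equivFinOfCardEq hcard))⟩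

end SplitAlgebra

namespace CommCodazziAlg

section Basic

variable {A : Type*} [AddCommGroup A] [Module ℝ A] {Cz : CommCodazziAlg A}

theorem Riemannian.exists_orthonormal_basis [FiniteDimensional ℝ A] (hR : Cz.Riemannian) :
    ∃ b : Module.Basis (Fin (Module.finrank ℝ A)) ℝ A,
      ∀ i j, Cz.form (b i) (b j) = if i = j then 1 else 0 := by
  let core : InnerProductSpace.Core ℝ A :=
    { inner := fun x y ↦ Cz.form x y
      conj_inner_symm := fun x y ↦ Cz.form_symm y x
      re_inner_nonneg := fun x ↦ by
        rcases eq_or_ne x 0 with rfl | hx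
        · simp
        · exact (hR x hx).le
      add_left := fun x y z ↦ by simp
      smul_left := fun x y r ↦ by simp
      definite := fun x hx ↦ by
        by_contra hne
        exact (hR x hne).ne' hx }
  let : NormedAddCommGroup A := core.toNormedAddCommGroup
  let : InnerProductSpace ℝ A := InnerProductSpace.ofCore core.toCore
  refine ⟨(stdOrthonormalBasis ℝ A).toBasis, fun i j ↦ ?_⟩
  simp only [OrthonormalBasis.coe_toBasis]
  exact (orthonormal_iff_ite.1 (stdOrthonormalBasis ℝ A).orthonormal) i j

theorem form_self_nonneg (hR : Cz.Riemannian) (x : A) : 0 ≤ Cz.form x x := by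
  rcases eq_or_ne x 0 with rfl | hx
  · simp
  · exact (hR x hx).le

theorem trace_mul_comp_mul {ι : Type*} [Fintype ι] [DecidableEq ι] (b : Module.Basis ι ℝ A)
    (hb : ∀ i j, Cz.form (b i) (b j) = if i = j then 1 else 0) (x : A) :
    LinearMap.trace ℝ A (Cz.mul x ∘ₗ Cz.mul x) =
      ∑ i, Cz.form (Cz.mul x (b i)) (Cz.mul x (b i)) := by
  have hrepr (y : A) (i : ι) : b.repr y i = Cz.form (b i) y := by
    conv_rhs => rw [← b.sum_repr y]
    simp only [map_sum, map_smul, hb, smul_eq_mul, mul_ite, mul_one, mul_zero, Finset.sum_ite_eq,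
      Finset.mem_univ, if_true]
  rw [LinearMap.trace_eq_matrix_trace ℝ b, Matrix.trace]
  refine Finset.sum_congr rfl fun i _ ↦ ?_
  rw [Matrix.diag_apply, LinearMap.toMatrix_apply, hrepr, LinearMap.comp_apply, ← Cz.invariant,
    Cz.mul_comm]

theorem Einstein.constant_nonneg [FiniteDimensional ℝ A] [Nontrivial A] {κ : ℝ}
    (hE : Cz.Einstein κ) (hR : Cz.Riemannian) : 0 ≤ κ := by
  obtain ⟨b, hb⟩ := hR.exists_orthonormal_basis
  obtain ⟨x, hx⟩ := exists_ne (0 : A)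
  have h := (Cz.trace_mul_comp_mul b hb x).symm.trans (hE x x)
  have : 0 ≤ κ * Cz.form x x := h ▸ Finset.sum_nonneg fun i _ ↦ form_self_nonneg hR _
  exact nonneg_of_mul_nonneg_left this (hR x hx)

theorem Einstein.mul_eq_zero [FiniteDimensional ℝ A] (hE : Cz.Einstein 0) (hR : Cz.Riemannian)
    (x y : A) : Cz.mul x y = 0 := by
  obtain ⟨b, hb⟩ := hR.exists_orthonormal_basis
  have h := (Cz.trace_mul_comp_mul b hb x).symm.trans (hE x x)
  rw [zero_mul, Finset.sum_eq_zero_iff_of_nonneg fun i _ ↦ form_self_nonneg hR _] at h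
  have hx : Cz.mul x = 0 := b.ext fun i ↦ by
    by_contra hne
    exact (hR _ hne).ne' (h i (Finset.mem_univ i))
  rw [hx, LinearMap.zero_apply]

theorem Riemannian.exists_isometry {A' : Type*} [AddCommGroup A'] [Module ℝ A']
    [FiniteDimensional ℝ A] [FiniteDimensional ℝ A'] {Cz' : CommCodazziAlg A'}
    (hR : Cz.Riemannian) (hR' : Cz'.Riemannian)
    (hdim : Module.finrank ℝ A = Module.finrank ℝ A') :
    ∃ Φ : A ≃ₗ[ℝ] A', ∀ x y, Cz'.form (Φ x) (Φ y) = Cz.form x y := by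
  obtain ⟨b, hb⟩ := hR.exists_orthonormal_basis
  obtain ⟨b', hb'⟩ := hR'.exists_orthonormal_basis
  let Φ : A ≃ₗ[ℝ] A' := b.equiv b' (finCongr hdim)
  have h : Cz'.form.compl₁₂ (Φ : A →ₗ[ℝ] A') (Φ : A →ₗ[ℝ] A') = Cz.form :=
    b.ext fun i ↦ b.ext fun j ↦ by simp [Φ, hb, hb']
  exact ⟨Φ, fun x y ↦ LinearMap.congr_fun₂ h x y⟩

end Basic

section Unital

variable {A : Type*} [AddCommGroup A] [Module ℝ A]

/-- The associator is `c` times the curvature-like expression built from the form. -/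
def HasAssociator (Cz : CommCodazziAlg A) (c : ℝ) : Prop :=
  ∀ x y z, Cz.mul (Cz.mul x y) z + (c * Cz.form x y) • z =
    Cz.mul x (Cz.mul y z) + (c * Cz.form y z) • x

theorem ConfAssoc.hasAssociator {Cz : CommCodazziAlg A} {n : ℕ} {κ : ℝ}
    (hCA : Cz.ConfAssoc n κ) : Cz.HasAssociator (κ / ((n : ℝ) - 1)) := fun x y z ↦ by
  refine sub_eq_zero.1 (Cz.form_nondeg _ fun u ↦ ?_)
  have := hCA x y z u
  simp only [map_sub, map_add, map_smul, LinearMap.sub_apply, LinearMap.add_apply,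
    LinearMap.smul_apply, smul_eq_mul] at this ⊢
  linear_combination this

/-- The unital extension `A ⊕ ℝ` with product
`(x, s) (y, t) = (x ∘ y + s y + t x, s t + c h(x, y))`. -/
def UnitalExt (Cz : CommCodazziAlg A) (c : ℝ) (_ : Cz.HasAssociator c) : Type _ := A × ℝ

namespace UnitalExt

variable {Cz : CommCodazziAlg A} {c : ℝ} {h : Cz.HasAssociator c}

instance : AddCommGroup (UnitalExt Cz c h) := inferInstanceAs (AddCommGroup (A × ℝ))

instance : Module ℝ (UnitalExt Cz c h) := inferInstanceAs (Module ℝ (A × ℝ))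

instance [FiniteDimensional ℝ A] : FiniteDimensional ℝ (UnitalExt Cz c h) :=
  inferInstanceAs (FiniteDimensional ℝ (A × ℝ))

instance : Mul (UnitalExt Cz c h) where
  mul a b := (Cz.mul a.1 b.1 + a.2 • b.1 + b.2 • a.1, a.2 * b.2 + c * Cz.form a.1 b.1)

instance : One (UnitalExt Cz c h) where
  one := ((0 : A), (1 : ℝ))

@[ext]
theorem ext {a b : UnitalExt Cz c h} (h₁ : a.1 = b.1) (h₂ : a.2 = b.2) : a = b :=
  Prod.ext h₁ h₂

@[simp] theorem add_fst (a b : UnitalExt Cz c h) : (a + b).1 = a.1 + b.1 := rfl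
@[simp] theorem add_snd (a b : UnitalExt Cz c h) : (a + b).2 = a.2 + b.2 := rfl
@[simp] theorem zero_fst : (0 : UnitalExt Cz c h).1 = 0 := rfl
@[simp] theorem zero_snd : (0 : UnitalExt Cz c h).2 = 0 := rfl
@[simp] theorem one_fst : (1 : UnitalExt Cz c h).1 = 0 := rfl
@[simp] theorem one_snd : (1 : UnitalExt Cz c h).2 = 1 := rfl
@[simp] theorem smul_fst (r : ℝ) (a : UnitalExt Cz c h) : (r • a).1 = r • a.1 := rfl
@[simp] theorem smul_snd (r : ℝ) (a : UnitalExt Cz c h) : (r • a).2 = r * a.2 := rfl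
@[simp] theorem mul_fst (a b : UnitalExt Cz c h) :
    (a * b).1 = Cz.mul a.1 b.1 + a.2 • b.1 + b.2 • a.1 := rfl
@[simp] theorem mul_snd (a b : UnitalExt Cz c h) :
    (a * b).2 = a.2 * b.2 + c * Cz.form a.1 b.1 := rfl

protected theorem mul_comm (a b : UnitalExt Cz c h) : a * b = b * a := by
  ext
  · simp only [mul_fst, Cz.mul_comm a.1 b.1]
    abel
  · simp only [mul_snd, Cz.form_symm a.1 b.1, _root_.mul_comm a.2]

protected theorem mul_assoc (a b d : UnitalExt Cz c h) : a * b * d = a * (b * d) := by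
  ext
  · have := h a.1 b.1 d.1
    simp only [mul_fst, mul_snd, map_add, map_smul, LinearMap.add_apply, LinearMap.smul_apply]
    linear_combination (norm := module) this
  · have := Cz.invariant a.1 b.1 d.1
    simp only [mul_fst, mul_snd, map_add, map_smul, LinearMap.add_apply, LinearMap.smul_apply,
      smul_eq_mul]
    linear_combination c * this

protected theorem left_distrib (a b d : UnitalExt Cz c h) : a * (b + d) = a * b + a * d := by
  ext
  · simp only [mul_fst, add_fst, add_snd, map_add]
    module
  · simp only [mul_snd, add_fst, add_snd, map_add]
    ring

protected theorem one_mul (a : UnitalExt Cz c h) : 1 * a = a := by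
  ext <;> simp

instance : CommRing (UnitalExt Cz c h) where
  __ := (inferInstance : AddCommGroup (UnitalExt Cz c h))
  left_distrib := UnitalExt.left_distrib
  right_distrib a b d := by
    rw [UnitalExt.mul_comm, UnitalExt.left_distrib, UnitalExt.mul_comm d a,
      UnitalExt.mul_comm d b]
  zero_mul a := by ext <;> simp
  mul_zero a := by ext <;> simp
  mul_assoc := UnitalExt.mul_assoc
  one_mul := UnitalExt.one_mul
  mul_one a := by rw [UnitalExt.mul_comm, UnitalExt.one_mul]
  mul_comm := UnitalExt.mul_comm

instance : Algebra ℝ (UnitalExt Cz c h) :=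
  Algebra.ofModule
    (fun r a b ↦ by
      ext
      · simp only [mul_fst, smul_fst, smul_snd, map_smul, LinearMap.smul_apply]
        module
      · simp only [mul_snd, smul_fst, smul_snd, map_smul, LinearMap.smul_apply, smul_eq_mul]
        ring)
    (fun r a b ↦ by
      ext
      · simp only [mul_fst, smul_fst, smul_snd, map_smul]
        module
      · simp only [mul_snd, smul_fst, smul_snd, map_smul, smul_eq_mul]
        ring)

/-- The inclusion of the original algebra. -/
def inl (h : Cz.HasAssociator c) : A →ₗ[ℝ] UnitalExt Cz c h := LinearMap.inl ℝ A ℝ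

/-- The projection to the original algebra. -/
def fst (h : Cz.HasAssociator c) : UnitalExt Cz c h →ₗ[ℝ] A := LinearMap.fst ℝ A ℝ

/-- The projection to the scalars. -/
def snd (h : Cz.HasAssociator c) : UnitalExt Cz c h →ₗ[ℝ] ℝ := LinearMap.snd ℝ A ℝ

@[simp] theorem inl_fst (x : A) : (inl h x).1 = x := rfl
@[simp] theorem inl_snd (x : A) : (inl h x).2 = 0 := rfl
@[simp] theorem fst_apply (a : UnitalExt Cz c h) : fst h a = a.1 := rfl
@[simp] theorem snd_apply (a : UnitalExt Cz c h) : snd h a = a.2 := rfl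

theorem inl_mul_inl (x y : A) :
    inl h x * inl h y = inl h (Cz.mul x y) + (c * Cz.form x y) • (1 : UnitalExt Cz c h) := by
  ext <;> simp

theorem snd_mul_self_pos (hc : 0 < c) (hR : Cz.Riemannian) (a : UnitalExt Cz c h) (ha : a ≠ 0) :
    0 < snd h (a * a) := by
  rw [snd_apply, mul_snd]
  rcases eq_or_ne a.1 0 with h₁ | h₁
  · have h₂ : a.2 ≠ 0 := fun h₂ ↦ ha (UnitalExt.ext h₁ h₂)
    rw [h₁, map_zero, mul_zero, add_zero]
    exact mul_self_pos.2 h₂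
  · exact add_pos_of_nonneg_of_pos (mul_self_nonneg _) (mul_pos hc (hR _ h₁))

theorem finrank_eq [FiniteDimensional ℝ A] :
    Module.finrank ℝ (UnitalExt Cz c h) = Module.finrank ℝ A + 1 :=
  (Module.finrank_prod (R := ℝ) (M := A) (M' := ℝ)).trans (by rw [Module.finrank_self])

theorem trace_eq [FiniteDimensional ℝ A] (hS : Cz.Special) (a : UnitalExt Cz c h) :
    Algebra.trace ℝ (UnitalExt Cz c h) a = (Module.finrank ℝ A + 1) * a.2 := by
  have hdec : Algebra.lmul ℝ (UnitalExt Cz c h) a =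
      (LinearMap.prodMap (Cz.mul a.1 + a.2 • LinearMap.id) (a.2 • LinearMap.id) +
        LinearMap.inl ℝ A ℝ ∘ₗ
          LinearMap.toSpanSingleton ℝ A a.1 ∘ₗ LinearMap.snd ℝ A ℝ +
        LinearMap.inr ℝ A ℝ ∘ₗ (c • Cz.form a.1) ∘ₗ LinearMap.fst ℝ A ℝ :
          A × ℝ →ₗ[ℝ] A × ℝ) := by
    refine LinearMap.ext fun b ↦ UnitalExt.ext ?_ ?_
    · change Cz.mul a.1 b.1 + a.2 • b.1 + b.2 • a.1 =
        (Cz.mul a.1 b.1 + a.2 • b.1) + b.2 • a.1 + 0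
      abel
    · change a.2 * b.2 + c * Cz.form a.1 b.1 = a.2 * b.2 + 0 + c * Cz.form a.1 b.1
      ring
  rw [Algebra.trace_apply, hdec]
  change LinearMap.trace ℝ (A × ℝ) _ = _
  rw [map_add, map_add, LinearMap.trace_prodMap', LinearMap.trace_comp_comm',
    LinearMap.trace_comp_comm' _ (LinearMap.inr ℝ A ℝ), LinearMap.comp_assoc,
    LinearMap.comp_assoc, LinearMap.snd_comp_inl, LinearMap.fst_comp_inr]
  simp only [LinearMap.comp_zero, map_zero, map_add, map_smul, hS a.1, LinearMap.trace_id,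
    Module.finrank_self, smul_eq_mul]
  push_cast
  ring

end UnitalExt

theorem HasAssociator.exists_equiv {A' : Type*} [AddCommGroup A'] [Module ℝ A']
    [FiniteDimensional ℝ A] [FiniteDimensional ℝ A'] {Cz : CommCodazziAlg A}
    {Cz' : CommCodazziAlg A'} {c : ℝ} (h : Cz.HasAssociator c) (h' : Cz'.HasAssociator c)
    (hc : 0 < c) (hR : Cz.Riemannian) (hR' : Cz'.Riemannian) (hS : Cz.Special)
    (hS' : Cz'.Special) (hdim : Module.finrank ℝ A = Module.finrank ℝ A') :
    ∃ Φ : A ≃ₗ[ℝ] A',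
      (∀ x y, Φ (Cz.mul x y) = Cz'.mul (Φ x) (Φ y)) ∧
      (∀ x y, Cz'.form (Φ x) (Φ y) = Cz.form x y) := by
  obtain ⟨e⟩ := exists_algEquiv_pi_real_of_pos_mul_self (UnitalExt.snd h)
    (UnitalExt.snd_mul_self_pos hc hR)
  obtain ⟨e'⟩ := exists_algEquiv_pi_real_of_pos_mul_self (UnitalExt.snd h')
    (UnitalExt.snd_mul_self_pos hc hR')
  rw [UnitalExt.finrank_eq] at e
  rw [UnitalExt.finrank_eq, ← hdim] at e'
  let Ψ : UnitalExt Cz c h ≃ₐ[ℝ] UnitalExt Cz' c h' := e.trans e'.symm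
  have hsnd (a : UnitalExt Cz c h) : (Ψ a).2 = a.2 := by
    have htr := Algebra.trace_eq_of_algEquiv Ψ a
    rw [UnitalExt.trace_eq hS, UnitalExt.trace_eq hS', ← hdim] at htr
    exact mul_left_cancel₀ (by positivity) htr
  have hsnd' (a : UnitalExt Cz' c h') : (Ψ.symm a).2 = a.2 := by
    rw [← hsnd, Ψ.apply_symm_apply]
  have hinl (x : A) : UnitalExt.inl h' (Ψ (UnitalExt.inl h x)).1 = Ψ (UnitalExt.inl h x) :=
    UnitalExt.ext rfl (hsnd (UnitalExt.inl h x)).symm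
  have hinl' (x : A') :
      UnitalExt.inl h (Ψ.symm (UnitalExt.inl h' x)).1 = Ψ.symm (UnitalExt.inl h' x) :=
    UnitalExt.ext rfl (hsnd' (UnitalExt.inl h' x)).symm
  let Φ : A ≃ₗ[ℝ] A' := LinearEquiv.ofLinearMap
    (UnitalExt.fst h' ∘ₗ Ψ.toLinearMap ∘ₗ UnitalExt.inl h)
    (UnitalExt.fst h ∘ₗ Ψ.symm.toLinearMap ∘ₗ UnitalExt.inl h')
    (LinearMap.ext fun x ↦ by simp [hinl'])
    (LinearMap.ext fun x ↦ by simp [hinl])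
  have hΦ (x : A) : UnitalExt.inl h' (Φ x) = Ψ (UnitalExt.inl h x) := hinl x
  have key (x y : A) :
      UnitalExt.inl h' (Cz'.mul (Φ x) (Φ y)) + (c * Cz'.form (Φ x) (Φ y)) • 1 =
        UnitalExt.inl h' (Φ (Cz.mul x y)) + (c * Cz.form x y) • 1 := by
    rw [← UnitalExt.inl_mul_inl, hΦ, hΦ, hΦ, ← map_mul, UnitalExt.inl_mul_inl, map_add, map_smul,
      map_one]
  refine ⟨Φ, fun x y ↦ ?_, fun x y ↦ ?_⟩
  · simpa using (congrArg (UnitalExt.fst h') (key x y)).symm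
  · simpa [hc.ne'] using congrArg (UnitalExt.snd h') (key x y)

end Unital

end CommCodazziAlg

/-- Up to isomorphism there is a unique `n`-dimensional conformally associative Riemannian
special Einstein commutative Codazzi algebra with a given Einstein constant. -/
theorem conformally_associative_unique
    {A A' : Type*} [AddCommGroup A] [Module ℝ A] [FiniteDimensional ℝ A]
    [AddCommGroup A'] [Module ℝ A'] [FiniteDimensional ℝ A']
    (n : ℕ) (hn : 2 ≤ n) (κ : ℝ)
    (Cz : CommCodazziAlg A) (Cz' : CommCodazziAlg A')
    (hdim : Module.finrank ℝ A = n) (hdim' : Module.finrank ℝ A' = n)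
    (hR : Cz.Riemannian) (hR' : Cz'.Riemannian)
    (hS : Cz.Special) (hS' : Cz'.Special)
    (hE : Cz.Einstein κ) (hE' : Cz'.Einstein κ)
    (hCA : Cz.ConfAssoc n κ) (hCA' : Cz'.ConfAssoc n κ) :
    ∃ Φ : A ≃ₗ[ℝ] A',
      (∀ x y, Φ (Cz.mul x y) = Cz'.mul (Φ x) (Φ y)) ∧
      (∀ x y, Cz'.form (Φ x) (Φ y) = Cz.form x y) := by
  have hn1 : (0 : ℝ) < (n : ℝ) - 1 := by
    have : (2 : ℝ) ≤ n := by exact_mod_cast hn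
    linarith
  have : Nontrivial A := Module.nontrivial_of_finrank_pos (R := ℝ) (by omega)
  rcases (hE.constant_nonneg hR).eq_or_lt with rfl | hκ
  · obtain ⟨Φ, hΦ⟩ := hR.exists_isometry hR' (hdim.trans hdim'.symm)
    exact ⟨Φ, fun x y ↦ by rw [hE.mul_eq_zero hR, hE'.mul_eq_zero hR', map_zero], hΦ⟩
  have hc : 0 < κ / ((n : ℝ) - 1) := div_pos hκ hn1
  exact hCA.hasAssociator.exists_equiv hCA'.hasAssociator hc hR hR' hS hS' (hdim.trans hdim'.symm)
end

section
/- Let P be a homogeneous cubic polynomial in three real variables, not identically zero, and let Hess P denote the 3×3 matrix of second partial derivatives (∂ᵢ∂ⱼP). Then: (1) there exists a constant κ > 0 such that det Hess P = κ·P identically if and only if there exist a real 3×3 matrix g with det g = ±1 and a constant c > 0 such that P(x) = c·(gx)₁·(gx)₂·(gx)₃ for all x ∈ ℝ³; and (2) there exists a constant κ < 0 such that det Hess P = κ·P identically if and only if there exist a real 3×3 matrix g with det g = ±1 and a constant c > 0 such that P(x) = c·(gx)₁·((gx)₂² + (gx)₃²) for all x ∈ ℝ³. -/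
open MvPolynomial

/-- The Hessian determinant `det (∂ᵢ∂ⱼ P)` of a polynomial in three variables. -/
noncomputable def hessDet3 (P : MvPolynomial (Fin 3) ℝ) : MvPolynomial (Fin 3) ℝ :=
  (Matrix.of fun i j => pderiv i (pderiv j P)).det

/-- The linear change of variables `P ↦ P ∘ g`. -/
noncomputable def linSubst (g : Matrix (Fin 3) (Fin 3) ℝ) (P : MvPolynomial (Fin 3) ℝ) :
    MvPolynomial (Fin 3) ℝ :=
  bind₁ (fun i => ∑ j, C (g i j) * X j) P

theorem eval_linSubst (g : Matrix (Fin 3) (Fin 3) ℝ) (P : MvPolynomial (Fin 3) ℝ)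
    (x : Fin 3 → ℝ) : eval x (linSubst g P) = eval (g.mulVec x) P := by
  have h : (fun i => eval x (∑ j, C (g i j) * X j : MvPolynomial (Fin 3) ℝ)) = g.mulVec x := by
    ext i
    simp [Matrix.mulVec, dotProduct]
  rw [linSubst, ← h, eval, eval₂Hom_bind₁]
  rfl

theorem isHomogeneous_linSubst (g : Matrix (Fin 3) (Fin 3) ℝ) {P : MvPolynomial (Fin 3) ℝ}
    {n : ℕ} (hP : P.IsHomogeneous n) : (linSubst g P).IsHomogeneous n := by
  have h := hP.aeval (S := ℝ) (τ := Fin 3) (n := 1)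
    (g := fun i => ∑ j, C (g i j) * X j) (fun i => ?_)
  · rwa [one_mul] at h
  · refine IsHomogeneous.sum _ _ _ fun j _ => ?_
    simpa using (isHomogeneous_C (Fin 3) (g i j)).mul (isHomogeneous_X ℝ j)

theorem pderiv_linSubst (g : Matrix (Fin 3) (Fin 3) ℝ) (P : MvPolynomial (Fin 3) ℝ)
    (i : Fin 3) :
    pderiv i (linSubst g P) = ∑ j, C (g j i) * linSubst g (pderiv j P) := by
  unfold linSubst
  induction P using MvPolynomial.induction_on with
  | C a => simp
  | add p q hp hq => simp [hp, hq, mul_add, Finset.sum_add_distrib]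
  | mul_X p k hp =>
    have hX : pderiv i (∑ j, C (g k j) * X j : MvPolynomial (Fin 3) ℝ) = C (g k i) := by
      fin_cases i <;> simp [Fin.sum_univ_three, pderiv_X]
    rw [map_mul, bind₁_X_right, Derivation.leibniz, hX, hp]
    simp only [Derivation.leibniz, smul_eq_mul, map_add, map_mul, bind₁_X_right, pderiv_X]
    fin_cases k <;> simp [Fin.sum_univ_three] <;> ring

theorem hessDet3_linSubst (g : Matrix (Fin 3) (Fin 3) ℝ) (P : MvPolynomial (Fin 3) ℝ) :
    hessDet3 (linSubst g P) = C (g.det ^ 2) * linSubst g (hessDet3 P) := by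
  have h : (Matrix.of fun i j => pderiv i (pderiv j (linSubst g P))) =
      (g.map C).transpose *
        (Matrix.of fun i j => pderiv i (pderiv j P)).map
          (bind₁ fun i => ∑ j, C (g i j) * X j : MvPolynomial (Fin 3) ℝ →ₐ[ℝ] _) *
        g.map C := by
    ext1 i j
    simp only [Matrix.mul_apply, Matrix.of_apply, pderiv_linSubst, map_sum, pderiv_C_mul,
      Matrix.transpose_apply, Matrix.map_apply]
    simp only [linSubst, Fin.sum_univ_three]
    ring
  have hg : (g.map C : Matrix (Fin 3) (Fin 3) (MvPolynomial (Fin 3) ℝ)).det = C g.det :=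
    (RingHom.map_det C g).symm
  unfold hessDet3
  rw [h, Matrix.det_mul, Matrix.det_mul, Matrix.det_transpose, hg, linSubst, AlgHom.map_det,
    map_pow]
  simp only [AlgHom.mapMatrix_apply]
  ring

/-- The ternary cubic form with coefficient vector `k`. -/
noncomputable def ternaryCubic (k : Fin 10 → ℝ) : MvPolynomial (Fin 3) ℝ :=
  C (k 0) * X 0 ^ 3 + C (k 1) * X 1 ^ 3 + C (k 2) * X 2 ^ 3 +
    C (k 3) * (X 0 ^ 2 * X 1) + C (k 4) * (X 0 ^ 2 * X 2) + C (k 5) * (X 0 * X 1 ^ 2) +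
    C (k 6) * (X 1 ^ 2 * X 2) + C (k 7) * (X 0 * X 2 ^ 2) + C (k 8) * (X 1 * X 2 ^ 2) +
    C (k 9) * (X 0 * X 1 * X 2)

theorem exists_eq_ternaryCubic {P : MvPolynomial (Fin 3) ℝ} (hP : P.IsHomogeneous 3) :
    ∃ k, P = ternaryCubic k := by
  rw [P.as_sum]
  refine Finset.sum_induction _ (fun Q => ∃ k, Q = ternaryCubic k) ?_ ?_ ?_
  · rintro _ _ ⟨k, rfl⟩ ⟨l, rfl⟩
    refine ⟨k + l, ?_⟩
    simp only [ternaryCubic, Pi.add_apply, map_add]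
    ring
  · exact ⟨0, by simp [ternaryCubic]⟩
  · intro d hd
    have hdeg : d 0 + d 1 + d 2 = 3 := by
      have := hP (mem_support_iff.mp hd)
      simpa [Finsupp.weight_apply, Finsupp.sum_fintype, Fin.sum_univ_three] using this
    have hmon : monomial d (coeff d P) =
        C (coeff d P) * (X 0 ^ d 0 * X 1 ^ d 1 * X 2 ^ d 2) := by
      rw [monomial_eq, Finsupp.prod_fintype _ _ (by simp), Fin.prod_univ_three]
    rw [hmon]
    generalize coeff d P = c
    generalize d 0 = a, d 1 = b, d 2 = e at hdeg
    refine ⟨![if a = 3 then c else 0, if b = 3 then c else 0, if e = 3 then c else 0,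
      if a = 2 ∧ b = 1 then c else 0, if a = 2 ∧ e = 1 then c else 0,
      if a = 1 ∧ b = 2 then c else 0, if b = 2 ∧ e = 1 then c else 0,
      if a = 1 ∧ e = 2 then c else 0, if b = 1 ∧ e = 2 then c else 0,
      if a = 1 ∧ b = 1 then c else 0], ?_⟩
    have ha : a ≤ 3 := by omega
    have hb : b ≤ 3 := by omega
    obtain rfl : e = 3 - a - b := by omega
    interval_cases a <;> interval_cases b <;> first | omega | simp [ternaryCubic]

theorem isHomogeneous_ternaryCubic (k : Fin 10 → ℝ) : (ternaryCubic k).IsHomogeneous 3 := by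
  have h1 (i : Fin 3) : (X i : MvPolynomial (Fin 3) ℝ).IsHomogeneous 1 := isHomogeneous_X ℝ i
  have h2 (i : Fin 3) : (X i ^ 2 : MvPolynomial (Fin 3) ℝ).IsHomogeneous 2 :=
    isHomogeneous_X_pow i 2
  have h3 (i : Fin 3) : (X i ^ 3 : MvPolynomial (Fin 3) ℝ).IsHomogeneous 3 :=
    isHomogeneous_X_pow i 3
  unfold ternaryCubic
  repeat' apply IsHomogeneous.add
  all_goals apply IsHomogeneous.C_mul
  · exact h3 0
  · exact h3 1
  · exact h3 2
  · exact (h2 0).mul (h1 1)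
  · exact (h2 0).mul (h1 2)
  · exact (h1 0).mul (h2 1)
  · exact (h2 1).mul (h1 2)
  · exact (h1 0).mul (h2 2)
  · exact (h1 1).mul (h2 2)
  · exact ((h1 0).mul (h1 1)).mul (h1 2)

theorem eval_ternaryCubic (k : Fin 10 → ℝ) (x y z : ℝ) :
    eval ![x, y, z] (ternaryCubic k) =
      k 0 * x ^ 3 + k 1 * y ^ 3 + k 2 * z ^ 3 + k 3 * (x ^ 2 * y) + k 4 * (x ^ 2 * z) +
        k 5 * (x * y ^ 2) + k 6 * (y ^ 2 * z) + k 7 * (x * z ^ 2) + k 8 * (y * z ^ 2) +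
        k 9 * (x * y * z) := by
  simp [ternaryCubic]

theorem pderiv_ofNat (i : Fin 3) (n : ℕ) [n.AtLeastTwo] :
    pderiv i (ofNat(n) : MvPolynomial (Fin 3) ℝ) = 0 :=
  Derivation.map_natCast _ n

theorem eval_hessDet3_ternaryCubic (k : Fin 10 → ℝ) (x y z : ℝ) :
    eval ![x, y, z] (hessDet3 (ternaryCubic k)) =
      !![6 * k 0 * x + 2 * k 3 * y + 2 * k 4 * z, 2 * k 3 * x + 2 * k 5 * y + k 9 * z,
          2 * k 4 * x + k 9 * y + 2 * k 7 * z;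
        2 * k 3 * x + 2 * k 5 * y + k 9 * z, 2 * k 5 * x + 6 * k 1 * y + 2 * k 6 * z,
          k 9 * x + 2 * k 6 * y + 2 * k 8 * z;
        2 * k 4 * x + k 9 * y + 2 * k 7 * z, k 9 * x + 2 * k 6 * y + 2 * k 8 * z,
          2 * k 7 * x + 2 * k 8 * y + 6 * k 2 * z].det := by
  rw [hessDet3, RingHom.map_det]
  congr 1
  ext i j
  fin_cases i <;> fin_cases j <;>
    simp [ternaryCubic, pderiv_X, Derivation.leibniz, Derivation.leibniz_pow,
      pderiv_ofNat] <;> ring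

/-- Up to an invertible linear change of variables, `P` is `x₁x₂x₃` if `κ` is positive and
`x₁(x₂² + x₃²)` if `κ` is negative. -/
def HasSignedFactorization (κ : ℝ) (P : MvPolynomial (Fin 3) ℝ) : Prop :=
  (0 < κ → ∃ g : Matrix (Fin 3) (Fin 3) ℝ, g.det ≠ 0 ∧
    ∀ x, eval x P = g.mulVec x 0 * g.mulVec x 1 * g.mulVec x 2) ∧
  (κ < 0 → ∃ g : Matrix (Fin 3) (Fin 3) ℝ, g.det ≠ 0 ∧
    ∀ x, eval x P = g.mulVec x 0 * (g.mulVec x 1 ^ 2 + g.mulVec x 2 ^ 2))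

theorem HasSignedFactorization.of_linSubst {κ : ℝ} {P : MvPolynomial (Fin 3) ℝ}
    {h : Matrix (Fin 3) (Fin 3) ℝ} (hh : h.det ≠ 0)
    (H : HasSignedFactorization (h.det ^ 2 * κ) (linSubst h P)) :
    HasSignedFactorization κ P := by
  have hpos : 0 < h.det ^ 2 := by positivity
  have hinv : h⁻¹.det ≠ 0 := by simpa [Matrix.det_nonsing_inv] using hh
  have hx (x : Fin 3 → ℝ) : eval x P = eval (h⁻¹.mulVec x) (linSubst h P) := by
    rw [eval_linSubst, Matrix.mulVec_mulVec, Matrix.mul_nonsing_inv _ (isUnit_iff_ne_zero.mpr hh),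
      Matrix.one_mulVec]
  constructor
  · intro hκ
    obtain ⟨g, hg, hP⟩ := H.1 (mul_pos hpos hκ)
    refine ⟨g * h⁻¹, by rw [Matrix.det_mul]; exact mul_ne_zero hg hinv, fun x => ?_⟩
    rw [hx, hP, Matrix.mulVec_mulVec]
  · intro hκ
    obtain ⟨g, hg, hP⟩ := H.2 (mul_neg_of_pos_of_neg hpos hκ)
    refine ⟨g * h⁻¹, by rw [Matrix.det_mul]; exact mul_ne_zero hg hinv, fun x => ?_⟩
    rw [hx, hP, Matrix.mulVec_mulVec]

theorem hessDet3_linSubst_of_eq {κ : ℝ} {P : MvPolynomial (Fin 3) ℝ}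
    (g : Matrix (Fin 3) (Fin 3) ℝ) (h : hessDet3 P = C κ * P) :
    hessDet3 (linSubst g P) = C (g.det ^ 2 * κ) * linSubst g P := by
  rw [hessDet3_linSubst, h, linSubst, linSubst, map_mul, bind₁_C_right, map_mul, mul_assoc]

theorem mulVec_fin_three (g : Matrix (Fin 3) (Fin 3) ℝ) (x : Fin 3 → ℝ) :
    g.mulVec x = ![g 0 0 * x 0 + g 0 1 * x 1 + g 0 2 * x 2,
      g 1 0 * x 0 + g 1 1 * x 1 + g 1 2 * x 2, g 2 0 * x 0 + g 2 1 * x 1 + g 2 2 * x 2] := by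
  ext i
  fin_cases i <;> simp [Matrix.mulVec, dotProduct, Fin.sum_univ_three]

theorem hasSignedFactorization_sq_add_sq {κ a b δ : ℝ} (hκ : κ = -8 * a * b)
    {P : MvPolynomial (Fin 3) ℝ}
    (hP : ∀ x, eval x P = x 2 * (a * x 0 ^ 2 + b * (x 1 + δ * x 2) ^ 2)) :
    HasSignedFactorization κ P := by
  have sq (t : ℝ) : √|t| ^ 2 = |t| := Real.sq_sqrt (abs_nonneg t)
  constructor <;> intro h
  · have hab : a * b < 0 := by linarith
    have ha : √|a| ≠ 0 := by simpa [Real.sqrt_eq_zero'] using left_ne_zero_of_mul hab.ne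
    have hb : √|b| ≠ 0 := by simpa [Real.sqrt_eq_zero'] using right_ne_zero_of_mul hab.ne
    obtain ⟨s, hs, hsa, hsb⟩ : ∃ s : ℝ, s ≠ 0 ∧ a = s * |a| ∧ b = -s * |b| := by
      rcases mul_neg_iff.mp hab with ⟨h1, h2⟩ | ⟨h1, h2⟩
      · exact ⟨1, by simp, by simp [abs_of_pos h1], by simp [abs_of_neg h2]⟩
      · exact ⟨-1, by simp, by simp [abs_of_neg h1], by simp [abs_of_pos h2]⟩
    refine ⟨!![0, 0, s; √|a|, √|b|, √|b| * δ; √|a|, -√|b|, -√|b| * δ], ?_, fun x => ?_⟩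
    · have : (!![0, 0, s; √|a|, √|b|, √|b| * δ; √|a|, -√|b|, -√|b| * δ]).det =
          -2 * s * √|a| * √|b| := by
        rw [Matrix.det_fin_three]; simp; ring
      rw [this]; simp [hs, ha, hb]
    · rw [hP, mulVec_fin_three]
      simp
      linear_combination x 2 * x 0 ^ 2 * hsa + x 2 * (x 1 + δ * x 2) ^ 2 * hsb
        - s * x 2 * x 0 ^ 2 * sq a + s * x 2 * (x 1 + δ * x 2) ^ 2 * sq b
  · have hab : 0 < a * b := by linarith
    have ha : √|a| ≠ 0 := by simpa [Real.sqrt_eq_zero'] using left_ne_zero_of_mul hab.ne'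
    have hb : √|b| ≠ 0 := by simpa [Real.sqrt_eq_zero'] using right_ne_zero_of_mul hab.ne'
    obtain ⟨s, hs, hsa, hsb⟩ : ∃ s : ℝ, s ≠ 0 ∧ a = s * |a| ∧ b = s * |b| := by
      rcases mul_pos_iff.mp hab with ⟨h1, h2⟩ | ⟨h1, h2⟩
      · exact ⟨1, by simp, by simp [abs_of_pos h1], by simp [abs_of_pos h2]⟩
      · exact ⟨-1, by simp, by simp [abs_of_neg h1], by simp [abs_of_neg h2]⟩
    refine ⟨!![0, 0, s; √|a|, 0, 0; 0, √|b|, √|b| * δ], ?_, fun x => ?_⟩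
    · have : (!![0, 0, s; √|a|, 0, 0; 0, √|b|, √|b| * δ]).det = s * √|a| * √|b| := by
        rw [Matrix.det_fin_three]; simp
      rw [this]; simp [hs, ha, hb]
    · rw [hP, mulVec_fin_three]
      simp
      linear_combination x 2 * x 0 ^ 2 * hsa + x 2 * (x 1 + δ * x 2) ^ 2 * hsb
        - s * x 2 * x 0 ^ 2 * sq a - s * x 2 * (x 1 + δ * x 2) ^ 2 * sq b

theorem eq_vec_three (x : Fin 3 → ℝ) : x = ![x 0, x 1, x 2] := by
  ext i; fin_cases i <;> rfl

theorem eval_hessDet3_ternaryCubic_of_eq {κ : ℝ} {k : Fin 10 → ℝ}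
    (h : hessDet3 (ternaryCubic k) = C κ * ternaryCubic k) (x y z : ℝ) :
    (6 * k 0 * x + 2 * k 3 * y + 2 * k 4 * z) *
        ((2 * k 5 * x + 6 * k 1 * y + 2 * k 6 * z) * (2 * k 7 * x + 2 * k 8 * y + 6 * k 2 * z) -
          (k 9 * x + 2 * k 6 * y + 2 * k 8 * z) ^ 2) -
      (2 * k 3 * x + 2 * k 5 * y + k 9 * z) *
        ((2 * k 3 * x + 2 * k 5 * y + k 9 * z) * (2 * k 7 * x + 2 * k 8 * y + 6 * k 2 * z) -
          (k 9 * x + 2 * k 6 * y + 2 * k 8 * z) * (2 * k 4 * x + k 9 * y + 2 * k 7 * z)) +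
      (2 * k 4 * x + k 9 * y + 2 * k 7 * z) *
        ((2 * k 3 * x + 2 * k 5 * y + k 9 * z) * (k 9 * x + 2 * k 6 * y + 2 * k 8 * z) -
          (2 * k 5 * x + 6 * k 1 * y + 2 * k 6 * z) * (2 * k 4 * x + k 9 * y + 2 * k 7 * z)) =
      κ * (k 0 * x ^ 3 + k 1 * y ^ 3 + k 2 * z ^ 3 + k 3 * (x ^ 2 * y) + k 4 * (x ^ 2 * z) +
        k 5 * (x * y ^ 2) + k 6 * (y ^ 2 * z) + k 7 * (x * z ^ 2) + k 8 * (y * z ^ 2) +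
        k 9 * (x * y * z)) := by
  have h1 := congrArg (eval ![x, y, z]) h
  rw [eval_hessDet3_ternaryCubic, map_mul, eval_C, eval_ternaryCubic, Matrix.det_fin_three] at h1
  simp at h1
  linear_combination h1

/-- Normal form of a cubic at the flex `(1 : 0 : 0)` with tangent line `z = 0`. -/
theorem hasSignedFactorization_of_flex {κ : ℝ} (hκ : κ ≠ 0) {k : Fin 10 → ℝ}
    (h : hessDet3 (ternaryCubic k) = C κ * ternaryCubic k)
    (h0 : k 0 = 0) (h3 : k 3 = 0) (h4 : k 4 ≠ 0) (h7 : k 7 = 0) (h9 : k 9 = 0) :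
    HasSignedFactorization κ (ternaryCubic k) := by
  have H := eval_hessDet3_ternaryCubic_of_eq h
  simp only [h0, h3, h7, h9] at H
  have h5 : k 5 = 0 := by
    have : k 4 ^ 2 * k 5 = 0 := by linear_combination -H 1 0 0 / 8
    simpa [h4] using this
  simp only [h5] at H
  have h1 : k 1 = 0 := by
    have : k 4 ^ 2 * k 1 = 0 := by
      linear_combination -(H 1 1 0 - H 1 (-1) 0 - 2 * H 0 1 0) / 48
    simpa [h4] using this
  simp only [h1] at H
  have hk : κ = -8 * k 4 * k 6 := by
    rw [← sub_eq_zero]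
    have : k 4 * (κ - -8 * k 4 * k 6) = 0 := by
      linear_combination -(H 1 0 1 - H 1 0 (-1) - 2 * H 0 0 1) / 2
    simpa only [mul_eq_zero, h4, false_or] using this
  have h6 : k 6 ≠ 0 := by rintro h6; simp [h6] at hk; exact hκ hk
  have hd : k 8 ^ 2 = 4 * k 6 * k 2 := by
    have : k 4 * (k 8 ^ 2 - 4 * k 6 * k 2) = 0 := by
      linear_combination -H 0 0 1 / 8 - k 2 / 8 * hk
    simpa [h4, sub_eq_zero] using this
  refine hasSignedFactorization_sq_add_sq (δ := k 8 / (2 * k 6)) hk fun x => ?_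
  rw [eq_vec_three x, eval_ternaryCubic]
  simp [h0, h1, h3, h5, h7, h9]
  field_simp
  linear_combination -x 2 ^ 3 * hd

theorem eval_eq_of_linSubst_eq {g : Matrix (Fin 3) (Fin 3) ℝ} {k l : Fin 10 → ℝ}
    (h : linSubst g (ternaryCubic k) = ternaryCubic l) (x y z : ℝ) :
    eval ![x, y, z] (ternaryCubic l) =
      eval ![g 0 0 * x + g 0 1 * y + g 0 2 * z, g 1 0 * x + g 1 1 * y + g 1 2 * z,
        g 2 0 * x + g 2 1 * y + g 2 2 * z] (ternaryCubic k) := by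
  rw [← h, eval_linSubst, mulVec_fin_three]
  rfl

theorem exists_linSubst_ternaryCubic (g : Matrix (Fin 3) (Fin 3) ℝ) (k : Fin 10 → ℝ) :
    ∃ l, linSubst g (ternaryCubic k) = ternaryCubic l := by
  exact exists_eq_ternaryCubic (isHomogeneous_linSubst g (isHomogeneous_ternaryCubic k))

theorem hasSignedFactorization_of_tangent {κ : ℝ} (hκ : κ ≠ 0) {k : Fin 10 → ℝ}
    (h : hessDet3 (ternaryCubic k) = C κ * ternaryCubic k)
    (h0 : k 0 = 0) (h3 : k 3 = 0) (h4 : k 4 ≠ 0) :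
    HasSignedFactorization κ (ternaryCubic k) := by
  have hdet : (!![1, -k 9 / (2 * k 4), -k 7 / (2 * k 4); 0, 1, 0; 0, 0, 1] :
      Matrix (Fin 3) (Fin 3) ℝ).det = 1 := by
    rw [Matrix.det_fin_three]; simp
  refine .of_linSubst (hdet ▸ one_ne_zero) ?_
  have hh := hessDet3_linSubst_of_eq
    !![1, -k 9 / (2 * k 4), -k 7 / (2 * k 4); 0, 1, 0; 0, 0, 1] h
  obtain ⟨l, hl⟩ := exists_linSubst_ternaryCubic
    !![1, -k 9 / (2 * k 4), -k 7 / (2 * k 4); 0, 1, 0; 0, 0, 1] k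
  have E := eval_eq_of_linSubst_eq hl
  simp only [eval_ternaryCubic] at E
  simp [h0, h3] at E
  rw [hl] at hh ⊢
  have l4 : l 4 = k 4 := by
    linear_combination E 1 0 1 / 2 - E 1 0 (-1) / 2 - E 0 0 1
  refine hasSignedFactorization_of_flex (by simpa [hdet] using hκ) hh ?_ ?_ ?_ ?_ ?_
  · linear_combination E 1 0 0
  · linear_combination E 1 1 0 / 2 - E 1 (-1) 0 / 2 - E 0 1 0
  · rwa [l4]
  · have : l 7 = 2 * k 4 * (-k 7 / (2 * k 4)) + k 7 := by
      linear_combination E 1 0 1 / 2 + E 1 0 (-1) / 2 - E 1 0 0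
    rw [this]; field_simp; ring
  · have : l 9 = 2 * k 4 * (-k 9 / (2 * k 4)) + k 9 := by
      linear_combination E 1 1 1 / 4 - E 1 1 (-1) / 4 - E 1 (-1) 1 / 4 - E (-1) 1 1 / 4
    rw [this]; field_simp; ring

theorem hasSignedFactorization_of_smooth_zero {κ : ℝ} (hκ : κ ≠ 0) {k : Fin 10 → ℝ}
    (h : hessDet3 (ternaryCubic k) = C κ * ternaryCubic k)
    (h0 : k 0 = 0) (h34 : k 3 ^ 2 + k 4 ^ 2 ≠ 0) :
    HasSignedFactorization κ (ternaryCubic k) := by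
  have hdet : (!![1, 0, 0; 0, k 4, k 3; 0, -k 3, k 4] :
      Matrix (Fin 3) (Fin 3) ℝ).det = k 3 ^ 2 + k 4 ^ 2 := by
    rw [Matrix.det_fin_three]; simp; ring
  refine .of_linSubst (hdet ▸ h34) ?_
  have hh := hessDet3_linSubst_of_eq !![1, 0, 0; 0, k 4, k 3; 0, -k 3, k 4] h
  obtain ⟨l, hl⟩ := exists_linSubst_ternaryCubic !![1, 0, 0; 0, k 4, k 3; 0, -k 3, k 4] k
  have E := eval_eq_of_linSubst_eq hl
  simp only [eval_ternaryCubic] at E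
  simp [h0] at E
  rw [hl] at hh ⊢
  have l4 : l 4 = k 3 ^ 2 + k 4 ^ 2 := by
    linear_combination E 1 0 1 / 2 - E 1 0 (-1) / 2 - E 0 0 1
  refine hasSignedFactorization_of_tangent
    (by rw [hdet]; exact mul_ne_zero (pow_ne_zero 2 h34) hκ) hh ?_ ?_ (l4 ▸ h34)
  · linear_combination E 1 0 0
  · linear_combination E 1 1 0 / 2 - E 1 (-1) 0 / 2 - E 0 1 0

theorem exists_det_ne_zero_and_col_zero {v : Fin 3 → ℝ} (hv : v ≠ 0) :
    ∃ g : Matrix (Fin 3) (Fin 3) ℝ, g.det ≠ 0 ∧ ∀ i, g i 0 = v i := by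
  obtain ⟨i, hi⟩ := Function.ne_iff.mp hv
  fin_cases i
  · refine ⟨!![v 0, 0, 0; v 1, 1, 0; v 2, 0, 1], ?_, ?_⟩
    · rw [Matrix.det_fin_three]; simpa using hi
    · intro i; fin_cases i <;> rfl
  · refine ⟨!![v 0, 1, 0; v 1, 0, 0; v 2, 0, 1], ?_, ?_⟩
    · rw [Matrix.det_fin_three]; simpa using hi
    · intro i; fin_cases i <;> rfl
  · refine ⟨!![v 0, 1, 0; v 1, 0, 1; v 2, 0, 0], ?_, ?_⟩
    · rw [Matrix.det_fin_three]; simpa using hi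
    · intro i; fin_cases i <;> rfl

/-- A cubic with a real singular point at `(1 : 0 : 0)` also has a smooth real point, unless it
is a cone, in which case its Hessian determinant vanishes. -/
theorem hasSignedFactorization_of_zero {κ : ℝ} (hκ : κ ≠ 0) {k : Fin 10 → ℝ}
    (h : hessDet3 (ternaryCubic k) = C κ * ternaryCubic k) (hk : ternaryCubic k ≠ 0)
    (h0 : k 0 = 0) : HasSignedFactorization κ (ternaryCubic k) := by
  by_cases h34 : k 3 ^ 2 + k 4 ^ 2 = 0
  swap
  · exact hasSignedFactorization_of_smooth_zero hκ h h0 h34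
  have h3 : k 3 = 0 := by nlinarith [sq_nonneg (k 3), sq_nonneg (k 4)]
  have h4 : k 4 = 0 := by nlinarith [sq_nonneg (k 3), sq_nonneg (k 4)]
  obtain ⟨y, z, hyz⟩ : ∃ y z : ℝ, k 5 * y ^ 2 + k 9 * (y * z) + k 7 * z ^ 2 ≠ 0 := by
    by_contra! hA
    have h5 : k 5 = 0 := by linear_combination hA 1 0
    have h7 : k 7 = 0 := by linear_combination hA 0 1
    have h9 : k 9 = 0 := by linear_combination hA 1 1 - hA 1 0 - hA 0 1
    apply hk
    apply MvPolynomial.funext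
    intro x
    have H := eval_hessDet3_ternaryCubic_of_eq h (x 0) (x 1) (x 2)
    rw [← eval_ternaryCubic, ← eq_vec_three] at H
    simpa [h0, h3, h4, h5, h7, h9, hκ] using H.symm
  set A := k 5 * y ^ 2 + k 9 * (y * z) + k 7 * z ^ 2 with hA
  set B := k 1 * y ^ 3 + k 2 * z ^ 3 + k 6 * (y ^ 2 * z) + k 8 * (y * z ^ 2) with hB
  have hdet : (!![-B / A, 1, 0; y, 0, -z; z, 0, y] : Matrix (Fin 3) (Fin 3) ℝ).det =
      -(y ^ 2 + z ^ 2) := by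
    rw [Matrix.det_fin_three]; simp; ring
  have hdet0 : (!![-B / A, 1, 0; y, 0, -z; z, 0, y] : Matrix (Fin 3) (Fin 3) ℝ).det ≠ 0 := by
    rw [hdet]
    intro hyz0
    have hy : y = 0 := by nlinarith [sq_nonneg y, sq_nonneg z]
    have hz : z = 0 := by nlinarith [sq_nonneg y, sq_nonneg z]
    exact hyz (by simp [hA, hy, hz])
  refine .of_linSubst hdet0 ?_
  have hh := hessDet3_linSubst_of_eq !![-B / A, 1, 0; y, 0, -z; z, 0, y] h
  obtain ⟨l, hl⟩ := exists_linSubst_ternaryCubic !![-B / A, 1, 0; y, 0, -z; z, 0, y] k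
  have E := eval_eq_of_linSubst_eq hl
  simp only [eval_ternaryCubic] at E
  simp [h0, h3, h4] at E
  rw [hl] at hh ⊢
  have l3 : l 3 = A := by
    rw [hA]
    linear_combination E 1 1 0 / 2 - E 1 (-1) 0 / 2 - E 0 1 0
  refine hasSignedFactorization_of_smooth_zero
    (mul_ne_zero (pow_ne_zero 2 hdet0) hκ) hh ?_ ?_
  · have : l 0 = -B / A * A + B := by
      rw [hA, hB]
      linear_combination E 1 0 0
    rw [this]; field_simp; ring
  · rw [l3]; positivity

theorem exists_ne_zero_and_eval_ternaryCubic_eq_zero (k : Fin 10 → ℝ) :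
    ∃ v : Fin 3 → ℝ, v ≠ 0 ∧ eval v (ternaryCubic k) = 0 := by
  let f : ℝ → ℝ := fun t => eval ![Real.cos t, Real.sin t, 0] (ternaryCubic k)
  have hf : Continuous f := by
    simp only [f, eval_ternaryCubic]
    fun_prop
  have hmem : (0 : ℝ) ∈ Set.uIcc (f 0) (f Real.pi) := by
    simp only [f, eval_ternaryCubic, Real.cos_zero, Real.sin_zero, Real.cos_pi, Real.sin_pi]
    rw [Set.mem_uIcc]
    rcases le_total 0 (k 0) with h | h
    · right; constructor <;> linarith
    · left; constructor <;> linarith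
  obtain ⟨t, -, ht⟩ := intermediate_value_uIcc hf.continuousOn hmem
  refine ⟨_, fun hv => ?_, ht⟩
  have hc : Real.cos t = 0 := congrFun hv 0
  have hs : Real.sin t = 0 := congrFun hv 1
  simpa [hc, hs] using Real.sin_sq_add_cos_sq t

theorem hasSignedFactorization_of_hessDet3_eq {κ : ℝ} (hκ : κ ≠ 0) {P : MvPolynomial (Fin 3) ℝ}
    (hhom : P.IsHomogeneous 3) (hP : P ≠ 0) (h : hessDet3 P = C κ * P) :
    HasSignedFactorization κ P := by
  obtain ⟨k, rfl⟩ := exists_eq_ternaryCubic hhom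
  obtain ⟨v, hv, hkv⟩ := exists_ne_zero_and_eval_ternaryCubic_eq_zero k
  obtain ⟨g, hg, hgv⟩ := exists_det_ne_zero_and_col_zero hv
  refine .of_linSubst hg ?_
  have hh := hessDet3_linSubst_of_eq g h
  have hne : linSubst g (ternaryCubic k) ≠ 0 := by
    intro h0
    apply hP
    apply MvPolynomial.funext
    intro x
    have := congrArg (eval (g⁻¹.mulVec x)) h0
    rwa [eval_linSubst, Matrix.mulVec_mulVec,
      Matrix.mul_nonsing_inv _ (isUnit_iff_ne_zero.mpr hg), Matrix.one_mulVec, map_zero,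
      ← map_zero (eval x)] at this
  obtain ⟨l, hl⟩ := exists_linSubst_ternaryCubic g k
  have E := eval_eq_of_linSubst_eq hl 1 0 0
  rw [hl] at hh hne ⊢
  refine hasSignedFactorization_of_zero (mul_ne_zero (pow_ne_zero 2 hg) hκ) hh hne ?_
  simp only [mul_one, mul_zero, add_zero, hgv] at E
  rw [← eq_vec_three, hkv, eval_ternaryCubic] at E
  linear_combination E

/-- Extracting the absolute value of the determinant makes a real matrix unimodular. -/
theorem exists_smul_det_eq_one_or_neg_one {g : Matrix (Fin 3) (Fin 3) ℝ} (hg : g.det ≠ 0) :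
    ∃ (g' : Matrix (Fin 3) (Fin 3) ℝ) (r : ℝ), (g'.det = 1 ∨ g'.det = -1) ∧ 0 < r ∧
      g = r • g' := by
  have hpos : 0 < |g.det| := abs_pos.mpr hg
  obtain ⟨r, hr, hr3⟩ : ∃ r : ℝ, 0 < r ∧ r ^ 3 = |g.det| :=
    ⟨|g.det| ^ ((3 : ℕ) : ℝ)⁻¹, Real.rpow_pos_of_pos hpos _,
      Real.rpow_inv_natCast_pow hpos.le (by norm_num)⟩
  refine ⟨r⁻¹ • g, r, ?_, hr, by rw [smul_smul, mul_inv_cancel₀ hr.ne', one_smul]⟩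
  rw [Matrix.det_smul, Fintype.card_fin, inv_pow, hr3]
  rcases lt_or_gt_of_ne hg with h | h
  · right
    rw [abs_of_neg h]
    field_simp
  · left
    rw [abs_of_pos h]
    field_simp

theorem hessDet3_linSubst_of_eval_eq {κ : ℝ} {g : Matrix (Fin 3) (Fin 3) ℝ}
    {P Q : MvPolynomial (Fin 3) ℝ} (hg : g.det = 1 ∨ g.det = -1)
    (hP : ∀ x, eval x P = eval (g.mulVec x) Q) (hQ : hessDet3 Q = C κ * Q) :
    hessDet3 P = C κ * P := by
  obtain rfl : P = linSubst g Q := MvPolynomial.funext fun x => by rw [hP, eval_linSubst]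
  have hg2 : g.det ^ 2 = 1 := by rcases hg with h | h <;> simp [h]
  simpa [hg2] using hessDet3_linSubst_of_eq g hQ

theorem hessDet3_mul_X_mul_X_mul_X (c : ℝ) :
    hessDet3 (C c * (X 0 * X 1 * X 2)) = C (2 * c ^ 2) * (C c * (X 0 * X 1 * X 2)) := by
  simp [hessDet3, Matrix.det_fin_three, pderiv_X, Derivation.leibniz, map_ofNat C]
  ring

theorem hessDet3_mul_X_mul_sq_add_sq (c : ℝ) :
    hessDet3 (C c * (X 0 * (X 1 ^ 2 + X 2 ^ 2))) =
      C (-8 * c ^ 2) * (C c * (X 0 * (X 1 ^ 2 + X 2 ^ 2))) := by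
  simp [hessDet3, Matrix.det_fin_three, pderiv_X, Derivation.leibniz, Derivation.leibniz_pow,
    pderiv_ofNat, map_ofNat C]
  ring

/-- Classification of nonzero homogeneous ternary cubics `P` with `det Hess P = κ·P`:
for `κ > 0` these are exactly the unimodular images of positive multiples of `x₁x₂x₃`, and
for `κ < 0` exactly the unimodular images of positive multiples of `x₁(x₂² + x₃²)`. -/
theorem cubic_hessian_classification (P : MvPolynomial (Fin 3) ℝ)
    (hhom : P.IsHomogeneous 3) (hP : P ≠ 0) :
    ((∃ κ : ℝ, 0 < κ ∧ hessDet3 P = C κ * P) ↔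
      ∃ (g : Matrix (Fin 3) (Fin 3) ℝ) (c : ℝ), (g.det = 1 ∨ g.det = -1) ∧ 0 < c ∧
        ∀ x : Fin 3 → ℝ,
          eval x P = c * g.mulVec x 0 * g.mulVec x 1 * g.mulVec x 2) ∧
    ((∃ κ : ℝ, κ < 0 ∧ hessDet3 P = C κ * P) ↔
      ∃ (g : Matrix (Fin 3) (Fin 3) ℝ) (c : ℝ), (g.det = 1 ∨ g.det = -1) ∧ 0 < c ∧
        ∀ x : Fin 3 → ℝ,
          eval x P = c * g.mulVec x 0 * ((g.mulVec x 1) ^ 2 + (g.mulVec x 2) ^ 2)) := by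
  refine ⟨⟨?_, ?_⟩, ⟨?_, ?_⟩⟩
  · rintro ⟨κ, hκ, h⟩
    obtain ⟨g, hg, hx⟩ := (hasSignedFactorization_of_hessDet3_eq hκ.ne' hhom hP h).1 hκ
    obtain ⟨g', r, hg', hr, rfl⟩ := exists_smul_det_eq_one_or_neg_one hg
    refine ⟨g', r ^ 3, hg', by positivity, fun x => ?_⟩
    rw [hx, Matrix.smul_mulVec]
    simp only [Pi.smul_apply, smul_eq_mul]
    ring
  · rintro ⟨g, c, hg, hc, hx⟩
    refine ⟨2 * c ^ 2, by positivity,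
      hessDet3_linSubst_of_eval_eq hg (fun x => ?_) (hessDet3_mul_X_mul_X_mul_X c)⟩
    simp [hx]
    ring
  · rintro ⟨κ, hκ, h⟩
    obtain ⟨g, hg, hx⟩ := (hasSignedFactorization_of_hessDet3_eq hκ.ne hhom hP h).2 hκ
    obtain ⟨g', r, hg', hr, rfl⟩ := exists_smul_det_eq_one_or_neg_one hg
    refine ⟨g', r ^ 3, hg', by positivity, fun x => ?_⟩
    rw [hx, Matrix.smul_mulVec]
    simp only [Pi.smul_apply, smul_eq_mul]
    ring
  · rintro ⟨g, c, hg, hc, hx⟩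
    refine ⟨-8 * c ^ 2, by nlinarith [pow_pos hc 2],
      hessDet3_linSubst_of_eval_eq hg (fun x => ?_) (hessDet3_mul_X_mul_sq_add_sq c)⟩
    simp [hx]
    ring
end

section
/- Let P be a homogeneous cubic polynomial in three real variables, not identically zero, which is harmonic: ΔP := Σ_{i=1}^{3} ∂ᵢ∂ᵢP = 0. Then there exists a constant κ > 0 with det Hess P = κ·P identically if and only if there exist an orthogonal 3×3 matrix A and a constant c > 0 such that P(x) = c·(Ax)₁·(Ax)₂·(Ax)₃ for all x ∈ ℝ³. Moreover, for such a harmonic P the following are equivalent: (a) there exists κ > 0 with Σ_{i,j}(∂ᵢ∂ⱼP)² = κ·(x₁² + x₂² + x₃²) identically; (b) there exists κ' > 0 with det Hess P = κ'·P identically. -/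
open MvPolynomial

namespace HarmonicCubic

/-- The substitution `P ↦ P(Ax)`. -/
noncomputable def linSubst (A : Matrix (Fin 3) (Fin 3) ℝ) :
    MvPolynomial (Fin 3) ℝ →ₐ[ℝ] MvPolynomial (Fin 3) ℝ :=
  aeval fun i => ∑ j, C (A i j) * X j

theorem linSubst_X (A : Matrix (Fin 3) (Fin 3) ℝ) (i : Fin 3) :
    linSubst A (X i) = ∑ j, C (A i j) * X j := by
  simp [linSubst]

theorem linSubst_C (A : Matrix (Fin 3) (Fin 3) ℝ) (r : ℝ) : linSubst A (C r) = C r := by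
  simp [linSubst]

theorem eval_linSubst (A : Matrix (Fin 3) (Fin 3) ℝ) (P : MvPolynomial (Fin 3) ℝ)
    (x : Fin 3 → ℝ) : eval x (linSubst A P) = eval (A.mulVec x) P := by
  induction P using MvPolynomial.induction_on with
  | C r => simp
  | add p q hp hq => simp [hp, hq]
  | mul_X p i hp => simp [hp, linSubst_X, Matrix.mulVec, dotProduct]

theorem linSubst_linSubst_of_mul_eq_one {A B : Matrix (Fin 3) (Fin 3) ℝ} (h : A * B = 1)
    (P : MvPolynomial (Fin 3) ℝ) : linSubst B (linSubst A P) = P := by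
  refine MvPolynomial.funext fun x => ?_
  rw [eval_linSubst, eval_linSubst, Matrix.mulVec_mulVec, h, Matrix.one_mulVec]

theorem isHomogeneous_linSubst (A : Matrix (Fin 3) (Fin 3) ℝ) {P : MvPolynomial (Fin 3) ℝ} {n : ℕ}
    (hP : P.IsHomogeneous n) : (linSubst A P).IsHomogeneous n := by
  have h := hP.aeval (n := 1) (fun i => ∑ j, C (A i j) * X j : Fin 3 → MvPolynomial (Fin 3) ℝ)
    fun i => IsHomogeneous.sum _ _ _ fun j _ => isHomogeneous_C_mul_X (A i j) j
  simpa [linSubst] using h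

/-- The chain rule for a linear substitution. -/
theorem pderiv_linSubst (A : Matrix (Fin 3) (Fin 3) ℝ) (j : Fin 3) (P : MvPolynomial (Fin 3) ℝ) :
    pderiv j (linSubst A P) = ∑ i, C (A i j) * linSubst A (pderiv i P) := by
  induction P using MvPolynomial.induction_on with
  | C r => simp
  | add p q hp hq => simp [hp, hq, mul_add, Finset.sum_add_distrib]
  | mul_X p k hp =>
    have hX : pderiv j (linSubst A (X k)) = C (A k j) := by
      simp [linSubst_X, pderiv_X, Pi.single_apply]
    simp only [map_mul, pderiv_mul, hX, hp, map_add, pderiv_X, mul_add, Finset.sum_add_distrib]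
    congr 1
    · rw [Finset.sum_mul]
      exact Finset.sum_congr rfl fun i _ => by ring
    · rw [Finset.sum_eq_single k]
      · simp; ring
      · intro i _ hi; simp [hi.symm]
      · simp

/-- The Hessian matrix of a polynomial in three variables. -/
noncomputable def hessian (P : MvPolynomial (Fin 3) ℝ) :
    Matrix (Fin 3) (Fin 3) (MvPolynomial (Fin 3) ℝ) :=
  Matrix.of fun i j => pderiv i (pderiv j P)

theorem hessian_linSubst (A : Matrix (Fin 3) (Fin 3) ℝ) (P : MvPolynomial (Fin 3) ℝ) :
    hessian (linSubst A P) =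
      (A.map C).transpose * (hessian P).map (linSubst A) * A.map C := by
  ext1 i j
  simp only [hessian, Matrix.of_apply, pderiv_linSubst, map_sum, pderiv_C_mul, Matrix.mul_apply,
    Matrix.transpose_apply, Matrix.map_apply, Finset.sum_mul, Finset.mul_sum]
  exact Finset.sum_congr rfl fun _ _ => Finset.sum_congr rfl fun _ _ => by ring

theorem trace_hessian (P : MvPolynomial (Fin 3) ℝ) :
    (hessian P).trace = ∑ i, pderiv i (pderiv i P) := rfl

theorem pderiv_pderiv_comm (i j : Fin 3) (P : MvPolynomial (Fin 3) ℝ) :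
    pderiv i (pderiv j P) = pderiv j (pderiv i P) := by
  ext m
  by_cases hij : i = j
  · rw [hij]
  · simp only [coeff_pderiv, Finsupp.add_apply, Finsupp.single_eq_of_ne hij,
      Finsupp.single_eq_of_ne (Ne.symm hij), add_right_comm m, add_zero]
    ring

theorem trace_hessian_mul_self (P : MvPolynomial (Fin 3) ℝ) :
    (hessian P * hessian P).trace = ∑ i, ∑ j, (pderiv i (pderiv j P)) ^ 2 := by
  simp only [Matrix.trace, Matrix.diag, Matrix.mul_apply, hessian, Matrix.of_apply]
  refine Finset.sum_congr rfl fun i _ => Finset.sum_congr rfl fun j _ => ?_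
  rw [pderiv_pderiv_comm j i, sq]

theorem map_C_mul_transpose {A : Matrix (Fin 3) (Fin 3) ℝ} (hA : A.transpose * A = 1) :
    A.map (C : ℝ → MvPolynomial (Fin 3) ℝ) * (A.map C).transpose = 1 := by
  rw [← Matrix.transpose_map, ← Matrix.map_mul, mul_eq_one_comm.mp hA]
  exact Matrix.map_one _ C_0 C_1

theorem laplacian_linSubst {A : Matrix (Fin 3) (Fin 3) ℝ} (hA : A.transpose * A = 1)
    (P : MvPolynomial (Fin 3) ℝ) :
    ∑ i, pderiv i (pderiv i (linSubst A P)) = linSubst A (∑ i, pderiv i (pderiv i P)) := by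
  rw [← trace_hessian, ← trace_hessian, hessian_linSubst, Matrix.trace_mul_comm, ← mul_assoc,
    map_C_mul_transpose hA, one_mul]
  simp [Matrix.trace]

theorem sum_sq_hessian_linSubst {A : Matrix (Fin 3) (Fin 3) ℝ} (hA : A.transpose * A = 1)
    (P : MvPolynomial (Fin 3) ℝ) :
    ∑ i, ∑ j, (pderiv i (pderiv j (linSubst A P))) ^ 2 =
      linSubst A (∑ i, ∑ j, (pderiv i (pderiv j P)) ^ 2) := by
  have hC := map_C_mul_transpose hA
  rw [← trace_hessian_mul_self, ← trace_hessian_mul_self, hessian_linSubst]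
  generalize A.map (C : ℝ → MvPolynomial (Fin 3) ℝ) = U at hC
  rw [show U.transpose * (hessian P).map (linSubst A) * U *
      (U.transpose * (hessian P).map (linSubst A) * U) =
      U.transpose * (hessian P).map (linSubst A) * (U * U.transpose) *
      (hessian P).map (linSubst A) * U by simp only [mul_assoc],
    hC, mul_one, Matrix.trace_mul_comm, ← mul_assoc, ← mul_assoc, hC, one_mul]
  simp [Matrix.trace, Matrix.mul_apply]

theorem hessDet3_linSubst {A : Matrix (Fin 3) (Fin 3) ℝ} (hA : A.transpose * A = 1)
    (P : MvPolynomial (Fin 3) ℝ) : hessDet3 (linSubst A P) = linSubst A (hessDet3 P) := by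
  have hC := congrArg Matrix.det (map_C_mul_transpose hA)
  rw [Matrix.det_mul, Matrix.det_one] at hC
  change (hessian _).det = linSubst A (hessian P).det
  rw [hessian_linSubst, Matrix.det_mul, Matrix.det_mul, mul_right_comm, mul_comm (Matrix.det _), hC,
    one_mul, AlgHom.map_det]
  rfl

theorem linSubst_sum_X_sq {A : Matrix (Fin 3) (Fin 3) ℝ} (hA : A.transpose * A = 1) :
    linSubst A (∑ i, X i ^ 2) = ∑ i, X i ^ 2 := by
  refine MvPolynomial.funext fun x => ?_
  have h : A.mulVec x ⬝ᵥ A.mulVec x = x ⬝ᵥ x := by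
    rw [Matrix.dotProduct_mulVec, Matrix.vecMul_mulVec, hA, Matrix.vecMul_one]
  simpa [eval_linSubst, dotProduct, sq] using h

/-- The general harmonic ternary cubic form; the coefficients `g` and `h` vanish exactly when
`(0, 0, 1)` is a critical point of its restriction to the unit sphere. -/
noncomputable def cubicForm (a b c d e g h : ℝ) : MvPolynomial (Fin 3) ℝ :=
  C a * (X 2 ^ 3 - C (3 / 2) * X 2 * (X 0 ^ 2 + X 1 ^ 2)) + C b * X 2 * (X 0 ^ 2 - X 1 ^ 2) +
    C (2 * c) * X 0 * X 1 * X 2 + C d * (X 0 ^ 3 - 3 * X 0 * X 1 ^ 2) +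
    C e * (3 * X 0 ^ 2 * X 1 - X 1 ^ 3) + C g * X 0 * (4 * X 2 ^ 2 - X 0 ^ 2 - X 1 ^ 2) +
    C h * X 1 * (4 * X 2 ^ 2 - X 0 ^ 2 - X 1 ^ 2)

theorem eval_cubicForm (a b c d e g h : ℝ) (x : Fin 3 → ℝ) :
    eval x (cubicForm a b c d e g h) =
      a * (x 2 ^ 3 - 3 / 2 * x 2 * (x 0 ^ 2 + x 1 ^ 2)) + b * x 2 * (x 0 ^ 2 - x 1 ^ 2) +
      2 * c * x 0 * x 1 * x 2 + d * (x 0 ^ 3 - 3 * x 0 * x 1 ^ 2) +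
      e * (3 * x 0 ^ 2 * x 1 - x 1 ^ 3) + g * x 0 * (4 * x 2 ^ 2 - x 0 ^ 2 - x 1 ^ 2) +
      h * x 1 * (4 * x 2 ^ 2 - x 0 ^ 2 - x 1 ^ 2) := by
  simp [cubicForm]

theorem exists_eq_cubicForm {P : MvPolynomial (Fin 3) ℝ} (hP : P.IsHomogeneous 3)
    (hharm : ∑ i, pderiv i (pderiv i P) = 0) :
    ∃ a b c d e g h, P = cubicForm a b c d e g h := by
  have ht (i j k : Fin 3) : ∃ t : ℝ, pderiv k (pderiv j (pderiv i P)) = C t := by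
    have h0 : (pderiv k (pderiv j (pderiv i P))).IsHomogeneous 0 := hP.pderiv.pderiv.pderiv
    exact ⟨_, totalDegree_eq_zero_iff_eq_C.mp ((totalDegree_zero_iff_isHomogeneous _).mpr h0)⟩
  choose t ht using ht
  have hsymm₁ (i j k : Fin 3) : t i j k = t j i k := by
    apply C_injective (Fin 3) ℝ
    rw [← ht, ← ht, pderiv_pderiv_comm j i]
  have hsymm₂ (i j k : Fin 3) : t i j k = t i k j := by
    apply C_injective (Fin 3) ℝ
    rw [← ht, ← ht, pderiv_pderiv_comm k j]
  have htrace (k : Fin 3) : t 0 0 k + t 1 1 k + t 2 2 k = 0 := by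
    apply C_injective (Fin 3) ℝ
    have h := congrArg (pderiv k) hharm
    simpa [Fin.sum_univ_three, ht] using h
  have h₁ := hP.sum_X_mul_pderiv
  have h₂ (i : Fin 3) := (hP.pderiv (i := i)).sum_X_mul_pderiv
  have h₃ (i j : Fin 3) := (hP.pderiv.pderiv (φ := pderiv i P) (i := j)).sum_X_mul_pderiv
  refine ⟨t 2 2 2 / 6, (t 0 0 2 - t 1 1 2) / 4, t 0 1 2 / 2,
    (t 0 0 0 - 3 * t 0 1 1) / 24, (3 * t 0 0 1 - t 1 1 1) / 24,
    t 0 2 2 / 8, t 1 2 2 / 8, MvPolynomial.funext fun x => ?_⟩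
  replace h₁ := congrArg (eval x) h₁
  replace h₂ (i : Fin 3) := congrArg (eval x) (h₂ i)
  replace h₃ (i j : Fin 3) := congrArg (eval x) (h₃ i j)
  simp only [Fin.sum_univ_three, ht, map_add, map_mul, eval_X, eval_C,
    nsmul_eq_mul] at h₁ h₂ h₃
  norm_num at h₁ h₂ h₃
  have hx : 6 * eval x P =
      x 0 * (x 0 * (x 0 * t 0 0 0 + x 1 * t 0 0 1 + x 2 * t 0 0 2) +
        x 1 * (x 0 * t 0 1 0 + x 1 * t 0 1 1 + x 2 * t 0 1 2) +
        x 2 * (x 0 * t 0 2 0 + x 1 * t 0 2 1 + x 2 * t 0 2 2)) +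
      x 1 * (x 0 * (x 0 * t 1 0 0 + x 1 * t 1 0 1 + x 2 * t 1 0 2) +
        x 1 * (x 0 * t 1 1 0 + x 1 * t 1 1 1 + x 2 * t 1 1 2) +
        x 2 * (x 0 * t 1 2 0 + x 1 * t 1 2 1 + x 2 * t 1 2 2)) +
      x 2 * (x 0 * (x 0 * t 2 0 0 + x 1 * t 2 0 1 + x 2 * t 2 0 2) +
        x 1 * (x 0 * t 2 1 0 + x 1 * t 2 1 1 + x 2 * t 2 1 2) +
        x 2 * (x 0 * t 2 2 0 + x 1 * t 2 2 1 + x 2 * t 2 2 2)) := by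
    simp only [h₃]
    linear_combination -2 * h₁ - x 0 * h₂ 0 - x 1 * h₂ 1 - x 2 * h₂ 2
  have e₁ : t 2 2 2 = - t 0 0 2 - t 1 1 2 := by linarith [htrace 2]
  have e₂ : t 0 2 2 = - t 0 0 0 - t 0 1 1 := by
    linarith [htrace 0, hsymm₁ 0 1 1, hsymm₂ 1 0 1, hsymm₂ 2 0 2, hsymm₁ 0 2 2]
  have e₃ : t 1 2 2 = - t 0 0 1 - t 1 1 1 := by
    linarith [htrace 1, hsymm₂ 2 1 2, hsymm₁ 1 2 2]
  rw [hsymm₂ 0 1 0, hsymm₂ 0 2 0, hsymm₂ 0 2 1, hsymm₁ 1 0 0, hsymm₂ 0 1 0, hsymm₁ 1 0 1,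
    hsymm₁ 1 0 2, hsymm₂ 1 1 0, hsymm₁ 1 0 1, hsymm₂ 1 2 0, hsymm₁ 1 0 2, hsymm₂ 1 2 1,
    hsymm₁ 2 0 0, hsymm₂ 0 2 0, hsymm₁ 2 0 1, hsymm₂ 0 2 1, hsymm₁ 2 0 2, hsymm₁ 2 1 0,
    hsymm₂ 1 2 0, hsymm₁ 1 0 2, hsymm₁ 2 1 1, hsymm₂ 1 2 1, hsymm₁ 2 1 2, hsymm₂ 2 2 0,
    hsymm₁ 2 0 2, hsymm₂ 2 2 1, hsymm₁ 2 1 2, e₁, e₂, e₃] at hx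
  rw [eval_cubicForm, e₁, e₂, e₃]
  linear_combination hx / 6

/-- A nonzero harmonic cubic attains a positive maximum on the unit sphere. -/
theorem exists_isMax_sphere {P : MvPolynomial (Fin 3) ℝ} (hP : P.IsHomogeneous 3) (h0 : P ≠ 0)
    (hharm : ∑ i, pderiv i (pderiv i P) = 0) :
    ∃ v : Fin 3 → ℝ, v 0 ^ 2 + v 1 ^ 2 + v 2 ^ 2 = 1 ∧ 0 < eval v P ∧
      ∀ w : Fin 3 → ℝ, w 0 ^ 2 + w 1 ^ 2 + w 2 ^ 2 = 1 → eval w P ≤ eval v P := by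
  obtain ⟨a, b, c, d, e, g, h, hform⟩ := exists_eq_cubicForm hP hharm
  have hsmul (r : ℝ) (x : Fin 3 → ℝ) : eval (r • x) P = r ^ 3 * eval x P := by
    simp only [hform, eval_cubicForm, Pi.smul_apply, smul_eq_mul]
    ring
  have hcompact : IsCompact {v : Fin 3 → ℝ | v 0 ^ 2 + v 1 ^ 2 + v 2 ^ 2 = 1} := by
    refine (isCompact_univ_pi fun _ => isCompact_Icc (a := (-1 : ℝ)) (b := 1)).of_isClosed_subset
      (isClosed_eq (by fun_prop) continuous_const) fun v (hv : _ = _) i _ => ?_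
    fin_cases i <;> constructor <;> simp only [Fin.zero_eta, Fin.mk_one, Fin.reduceFinMk] <;>
      nlinarith [sq_nonneg (v 0), sq_nonneg (v 1), sq_nonneg (v 2)]
  obtain ⟨v, hv, hmax⟩ := hcompact.exists_isMaxOn ⟨![1, 0, 0], by simp⟩
    (MvPolynomial.continuous_eval P).continuousOn
  refine ⟨v, hv, ?_, fun w hw => hmax hw⟩
  by_contra! hneg
  have hnonpos (x : Fin 3 → ℝ) : eval x P ≤ 0 := by
    by_cases hx : x 0 ^ 2 + x 1 ^ 2 + x 2 ^ 2 = 0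
    · have h₀ : x 0 = 0 := by nlinarith [sq_nonneg (x 0), sq_nonneg (x 1), sq_nonneg (x 2)]
      have h₁ : x 1 = 0 := by nlinarith [sq_nonneg (x 0), sq_nonneg (x 1), sq_nonneg (x 2)]
      have h₂ : x 2 = 0 := by nlinarith [sq_nonneg (x 0), sq_nonneg (x 1), sq_nonneg (x 2)]
      simp [hform, eval_cubicForm, h₀, h₁, h₂]
    · have hpos : 0 < x 0 ^ 2 + x 1 ^ 2 + x 2 ^ 2 := by positivity
      set r := √(x 0 ^ 2 + x 1 ^ 2 + x 2 ^ 2)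
      have hr : 0 < r := Real.sqrt_pos.mpr hpos
      have hr2 : r ^ 2 = x 0 ^ 2 + x 1 ^ 2 + x 2 ^ 2 := Real.sq_sqrt hpos.le
      have hle : eval (r⁻¹ • x) P ≤ 0 := by
        refine le_trans (hmax ?_) hneg
        simp only [Set.mem_ofPred, Pi.smul_apply, smul_eq_mul]
        field_simp
        linarith
      rw [hsmul] at hle
      have : 0 < r⁻¹ ^ 3 := by positivity
      exact nonpos_of_mul_nonpos_right hle this
  refine h0 (MvPolynomial.funext fun x => ?_)
  have hodd := hsmul (-1) x
  have := hnonpos ((-1 : ℝ) • x)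
  have := hnonpos x
  simp only [map_zero]
  linarith

theorem exists_orthogonal_col_two {v : Fin 3 → ℝ} (hv : v 0 ^ 2 + v 1 ^ 2 + v 2 ^ 2 = 1) :
    ∃ A : Matrix (Fin 3) (Fin 3) ℝ, A.transpose * A = 1 ∧ A.mulVec ![0, 0, 1] = v := by
  by_cases h : v 2 = 1
  · refine ⟨1, by simp, ?_⟩
    have h₀ : v 0 = 0 := by nlinarith [sq_nonneg (v 0), sq_nonneg (v 1)]
    have h₁ : v 1 = 0 := by nlinarith [sq_nonneg (v 0), sq_nonneg (v 1)]
    ext i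
    fin_cases i <;> simp [h, h₀, h₁]
  · have hne : 1 - v 2 ≠ 0 := sub_ne_zero.mpr (Ne.symm h)
    refine ⟨!![1 - v 0 ^ 2 / (1 - v 2), -(v 0 * v 1) / (1 - v 2), v 0;
      -(v 0 * v 1) / (1 - v 2), 1 - v 1 ^ 2 / (1 - v 2), v 1; v 0, v 1, v 2], ?_, ?_⟩
    · have h2 : v 0 ^ 2 = 1 - v 1 ^ 2 - v 2 ^ 2 := by linarith
      ext i j
      fin_cases i <;> fin_cases j <;>
        simp [Matrix.mul_apply, Fin.sum_univ_three] <;> field_simp <;> grind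
    · ext i
      fin_cases i <;> simp [Matrix.mulVec, dotProduct, Fin.sum_univ_three]

/-- An orthogonal change of variables taking `(0, 0, 1)` to a maximum point on the sphere kills two of
the seven coefficients. -/
theorem exists_linSubst_eq_cubicForm {P : MvPolynomial (Fin 3) ℝ} (hP : P.IsHomogeneous 3)
    (h0 : P ≠ 0) (hharm : ∑ i, pderiv i (pderiv i P) = 0) :
    ∃ A : Matrix (Fin 3) (Fin 3) ℝ, A.transpose * A = 1 ∧
      ∃ a b c d e : ℝ, 0 < a ∧ linSubst A P = cubicForm a b c d e 0 0 := by
  obtain ⟨v, hv, hpos, hmax⟩ := exists_isMax_sphere hP h0 hharm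
  obtain ⟨A, hA, hAv⟩ := exists_orthogonal_col_two hv
  obtain ⟨a, b, c, d, e, g, h, hform⟩ := exists_eq_cubicForm (isHomogeneous_linSubst A hP)
    (by rw [laplacian_linSubst hA, hharm, map_zero])
  have ha : eval v P = a := by
    rw [← hAv, ← eval_linSubst, hform, eval_cubicForm]
    simp
  have hle (w : Fin 3 → ℝ) (hw : w 0 ^ 2 + w 1 ^ 2 + w 2 ^ 2 = 1) :
      eval w (cubicForm a b c d e g h) ≤ a := by
    rw [← hform, eval_linSubst, ← ha]
    apply hmax
    have hdot : A.mulVec w ⬝ᵥ A.mulVec w = w ⬝ᵥ w := by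
      rw [Matrix.dotProduct_mulVec, Matrix.vecMul_mulVec, hA, Matrix.vecMul_one]
    simp only [dotProduct, Fin.sum_univ_three, ← sq] at hdot
    rw [hdot, hw]
  have hfermat (f : ℝ → Fin 3 → ℝ) (k : ℝ) (hf : ∀ θ, f θ 0 ^ 2 + f θ 1 ^ 2 + f θ 2 ^ 2 = 1)
      (hf0 : f 0 = ![0, 0, 1])
      (hd : HasDerivAt (fun θ => eval (f θ) (cubicForm a b c d e g h)) k 0) : k = 0 := by
    refine IsLocalMax.hasDerivAt_eq_zero (Filter.Eventually.of_forall fun θ => ?_) hd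
    refine (hle _ (hf θ)).trans_eq ?_
    simp [hf0, eval_cubicForm]
  have hs := Real.hasDerivAt_sin 0
  have hc := Real.hasDerivAt_cos 0
  have hg : 4 * g = 0 := by
    refine hfermat (fun θ => ![Real.sin θ, 0, Real.cos θ]) _ (fun θ => by simp) (by simp) ?_
    have hd := (((((hc.pow 3).sub ((hc.const_mul (3 / 2)).mul (hs.pow 2))).const_mul a).add
      ((hc.const_mul b).mul (hs.pow 2))).add ((hs.pow 3).const_mul d)).add
      ((hs.const_mul g).mul (((hc.pow 2).const_mul 4).sub (hs.pow 2)))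
    refine (hd.congr_deriv ?_).congr_of_eventuallyEq (.of_forall fun θ => ?_)
    · simp; ring
    · simp [eval_cubicForm]
  have hh : 4 * h = 0 := by
    refine hfermat (fun θ => ![0, Real.sin θ, Real.cos θ]) _ (fun θ => by simp) (by simp) ?_
    have hd := (((((hc.pow 3).sub ((hc.const_mul (3 / 2)).mul (hs.pow 2))).const_mul a).sub
      ((hc.const_mul b).mul (hs.pow 2))).sub ((hs.pow 3).const_mul e)).add
      ((hs.const_mul h).mul (((hc.pow 2).const_mul 4).sub (hs.pow 2)))
    refine (hd.congr_deriv ?_).congr_of_eventuallyEq (.of_forall fun θ => ?_)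
    · simp; ring
    · simp [eval_cubicForm]; ring
  refine ⟨A, hA, a, b, c, d, e, ha ▸ hpos, ?_⟩
  rw [hform, (by linarith : g = 0), (by linarith : h = 0)]

theorem eval_hessian_cubicForm (a b c d e : ℝ) (x : Fin 3 → ℝ) (i j : Fin 3) :
    eval x (pderiv i (pderiv j (cubicForm a b c d e 0 0))) =
      !![(2 * b - 3 * a) * x 2 + 6 * d * x 0 + 6 * e * x 1,
          2 * c * x 2 + 6 * e * x 0 - 6 * d * x 1, (2 * b - 3 * a) * x 0 + 2 * c * x 1;
        2 * c * x 2 + 6 * e * x 0 - 6 * d * x 1,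
          (-2 * b - 3 * a) * x 2 - 6 * d * x 0 - 6 * e * x 1, (-2 * b - 3 * a) * x 1 + 2 * c * x 0;
        (2 * b - 3 * a) * x 0 + 2 * c * x 1, (-2 * b - 3 * a) * x 1 + 2 * c * x 0,
          6 * a * x 2] i j := by
  have h3 (k : Fin 3) : pderiv k (3 : MvPolynomial (Fin 3) ℝ) = 0 := pderiv_C (a := 3)
  have h2 (k : Fin 3) : pderiv k (2 : MvPolynomial (Fin 3) ℝ) = 0 := pderiv_C (a := 2)
  fin_cases i <;> fin_cases j <;>
    simp [cubicForm, pderiv_X, h2, h3] <;> ring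

theorem coeffs_of_sum_sq_hessian {a b c d e κ : ℝ} (ha : 0 < a)
    (h : ∑ i : Fin 3, ∑ j : Fin 3, (pderiv i (pderiv j (cubicForm a b c d e 0 0))) ^ 2 =
      C κ * ∑ i : Fin 3, X i ^ 2) :
    b = 0 ∧ c = 0 ∧ 2 * (d ^ 2 + e ^ 2) = a ^ 2 := by
  simp only [Fin.sum_univ_three] at h
  have hx (x : Fin 3 → ℝ) := congrArg (eval x) h
  simp only [map_add, map_pow, eval_hessian_cubicForm, map_mul, eval_C, eval_X] at hx
  have h₀ := hx ![1, 0, 0]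
  have h₁ := hx ![0, 1, 0]
  have h₂ := hx ![0, 0, 1]
  have h₃ := hx ![1, 1, 0]
  simp at h₀ h₁ h₂ h₃
  have hb : a * b = 0 := by linarith
  have hb : b = 0 := (mul_eq_zero.mp hb).resolve_left ha.ne'
  have hc : a * c = 0 := by linarith
  have hc : c = 0 := (mul_eq_zero.mp hc).resolve_left ha.ne'
  subst hb hc
  exact ⟨rfl, rfl, by linarith⟩

theorem coeffs_of_hessDet3 {a b c d e κ : ℝ} (ha : 0 < a) (hκ : 0 < κ)
    (h : hessDet3 (cubicForm a b c d e 0 0) = C κ * cubicForm a b c d e 0 0) :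
    b = 0 ∧ c = 0 ∧ 2 * (d ^ 2 + e ^ 2) = a ^ 2 := by
  have hx (x : Fin 3 → ℝ) := congrArg (eval x) h
  simp only [hessDet3, Matrix.det_fin_three, Matrix.of_apply, map_add, map_sub, map_mul,
    eval_hessian_cubicForm, eval_C, eval_cubicForm] at hx
  have h₀ := hx ![1, 0, 1]
  have h₁ := hx ![-1, 0, 1]
  have h₂ := hx ![0, 1, 1]
  have h₃ := hx ![0, -1, 1]
  have h₄ := hx ![0, 0, 1]
  have h₅ := hx ![1, 0, 0]
  have h₆ := hx ![0, 1, 0]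
  have h₇ := hx ![1, 1, 1]
  have h₈ := hx ![-1, -1, 1]
  simp at h₀ h₁ h₂ h₃ h₄ h₅ h₆ h₇ h₈
  have hδ : κ = 6 * (9 * a ^ 2 - 4 * b ^ 2 - 4 * c ^ 2) := by
    apply mul_left_cancel₀ ha.ne'
    linarith
  have hzxx : -216 * a * (d ^ 2 + e ^ 2) =
      4 * (9 * a ^ 2 - 4 * b ^ 2 - 4 * c ^ 2) * (2 * b - 3 * a) := by
    rw [hδ] at h₀ h₁ h₄
    linarith
  have hzyy : -216 * a * (d ^ 2 + e ^ 2) =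
      4 * (9 * a ^ 2 - 4 * b ^ 2 - 4 * c ^ 2) * (-2 * b - 3 * a) := by
    rw [hδ] at h₂ h₃ h₄
    linarith
  have hzxy : κ * c = 0 := by
    rw [hδ] at h₇ h₈ h₄ ⊢
    linarith
  have hzb : κ * b = 0 := by
    rw [hδ]
    linarith
  have hb : b = 0 := (mul_eq_zero.mp hzb).resolve_left hκ.ne'
  have hc : c = 0 := (mul_eq_zero.mp hzxy).resolve_left hκ.ne'
  subst hb hc
  refine ⟨rfl, rfl, mul_left_cancel₀ ha.ne' ?_⟩
  linarith

/-- A rotation about the third axis through a third of the argument of `d + e i` exhibits the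
cubic as a product of three orthogonal linear forms. -/
theorem exists_eval_cubicForm_eq_mul {a d e : ℝ} (ha : 0 < a) (h : 2 * (d ^ 2 + e ^ 2) = a ^ 2) :
    ∃ (A : Matrix (Fin 3) (Fin 3) ℝ) (c : ℝ), A.transpose * A = 1 ∧ 0 < c ∧
      ∀ x, eval x (cubicForm a 0 0 d e 0 0) =
        c * A.mulVec x 0 * A.mulVec x 1 * A.mulVec x 2 := by
  obtain ⟨u, v, huv, hd, he⟩ : ∃ u v : ℝ, u ^ 2 + v ^ 2 = 1 ∧
      2 * d = √2 * a * (u ^ 3 - 3 * u * v ^ 2) ∧ 2 * e = √2 * a * (3 * u ^ 2 * v - v ^ 3) := by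
    have hnorm : 2 * ‖(⟨d, e⟩ : ℂ)‖ = √2 * a := by
      rw [Complex.norm_def, Complex.normSq_mk, ← sq, ← sq,
        show d ^ 2 + e ^ 2 = (√2 * a / 2) ^ 2 by
          rw [div_pow, mul_pow, Real.sq_sqrt zero_le_two]; linarith,
        Real.sqrt_sq (by positivity)]
      ring
    set θ := Complex.arg ⟨d, e⟩ / 3 with hθ
    have hcos : _ = d := Complex.norm_mul_cos_arg ⟨d, e⟩
    have hsin : _ = e := Complex.norm_mul_sin_arg ⟨d, e⟩
    rw [show Complex.arg ⟨d, e⟩ = 3 * θ by rw [hθ]; ring] at hcos hsin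
    rw [Real.cos_three_mul] at hcos
    rw [Real.sin_three_mul] at hsin
    have hcs := Real.sin_sq_add_cos_sq θ
    refine ⟨Real.cos θ, Real.sin θ, by linarith, ?_, ?_⟩
    · rw [← hnorm]
      linear_combination (6 * ‖(⟨d, e⟩ : ℂ)‖ * Real.cos θ) * hcs - 2 * hcos
    · rw [← hnorm]
      linear_combination (-6 * ‖(⟨d, e⟩ : ℂ)‖ * Real.sin θ) * hcs - 2 * hsin
  have hs2 : √2 ^ 2 = (2 : ℝ) := Real.sq_sqrt zero_le_two
  have hs3 : √3 ^ 2 = (3 : ℝ) := Real.sq_sqrt (by norm_num)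
  have hs3' : √3 ≠ 0 := by positivity
  refine ⟨(√3)⁻¹ • !![√2 * u, √2 * v, 1;
      √2 * (-u / 2 - √3 / 2 * v), √2 * (-v / 2 + √3 / 2 * u), 1;
      √2 * (-u / 2 + √3 / 2 * v), √2 * (-v / 2 - √3 / 2 * u), 1], 3 * √3 * a, ?_,
    by positivity, fun x => ?_⟩
  · ext i j
    fin_cases i <;> fin_cases j <;> simp [Matrix.mul_apply, Fin.sum_univ_three] <;> field_simp <;>
      grind
  · rw [eval_cubicForm]
    simp [Matrix.mulVec, dotProduct, Fin.sum_univ_three]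
    field_simp
    have hd' : d = √2 * a * (u ^ 3 - 3 * u * v ^ 2) / 2 := by linarith
    have he' : e = √2 * a * (3 * u ^ 2 * v - v ^ 3) / 2 := by linarith
    rw [hd', he']
    set L := x 0 * u + x 1 * v with hL
    set M := x 0 * v - x 1 * u with hM
    linear_combination
      (2 * (a * x 2 * (x 2 ^ 2 * 2 - 3 * (x 0 ^ 2 + x 1 ^ 2)) +
        √2 * a * (x 0 * (u ^ 3 - 3 * u * v ^ 2) * (x 0 ^ 2 - 3 * x 1 ^ 2) +
          x 1 * (3 * u ^ 2 * v - v ^ 3) * (3 * x 0 ^ 2 - x 1 ^ 2))) +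
        3 * a * (√2 * L + x 2) * √2 ^ 2 * M ^ 2) * hs3 -
      3 * a * (-4 * x 2 * L ^ 2 + x 2 * (L ^ 2 - 3 * M ^ 2) +
        √2 * L * (L ^ 2 - 3 * M ^ 2)) * hs2 -
      18 * a * x 2 * (x 0 ^ 2 + x 1 ^ 2) * (-huv)

theorem exists_eval_eq_mul {P : MvPolynomial (Fin 3) ℝ} {B : Matrix (Fin 3) (Fin 3) ℝ}
    (hB : B.transpose * B = 1) {a b c d e : ℝ} (ha : 0 < a)
    (hform : linSubst B P = cubicForm a b c d e 0 0)
    (h : b = 0 ∧ c = 0 ∧ 2 * (d ^ 2 + e ^ 2) = a ^ 2) :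
    ∃ (A : Matrix (Fin 3) (Fin 3) ℝ) (c : ℝ), A.transpose * A = 1 ∧ 0 < c ∧
      ∀ x, eval x P = c * A.mulVec x 0 * A.mulVec x 1 * A.mulVec x 2 := by
  obtain ⟨rfl, rfl, hde⟩ := h
  obtain ⟨A, c, hA, hc, heval⟩ := exists_eval_cubicForm_eq_mul ha hde
  have hB' := mul_eq_one_comm.mp hB
  refine ⟨A * B.transpose, c, ?_, hc, fun x => ?_⟩
  · rw [Matrix.transpose_mul, Matrix.transpose_transpose, mul_assoc, ← mul_assoc A.transpose, hA,
      one_mul, hB']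
  · rw [← linSubst_linSubst_of_mul_eq_one hB' P, eval_linSubst, hform, heval,
      Matrix.mulVec_mulVec]

theorem hessian_monomial (c : ℝ) :
    hessian (C c * X 0 * X 1 * X 2) =
      !![0, C c * X 2, C c * X 1; C c * X 2, 0, C c * X 0; C c * X 1, C c * X 0, 0] := by
  ext1 i j
  fin_cases i <;> fin_cases j <;> simp [hessian, pderiv_X] <;> ring

theorem eq_linSubst_monomial {P : MvPolynomial (Fin 3) ℝ} {A : Matrix (Fin 3) (Fin 3) ℝ} {c : ℝ}
    (h : ∀ x, eval x P = c * A.mulVec x 0 * A.mulVec x 1 * A.mulVec x 2) :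
    P = linSubst A (C c * X 0 * X 1 * X 2) := by
  refine MvPolynomial.funext fun x => ?_
  simp [h, eval_linSubst]

theorem hessDet3_of_eval_eq_mul {P : MvPolynomial (Fin 3) ℝ} {A : Matrix (Fin 3) (Fin 3) ℝ} {c : ℝ}
    (hA : A.transpose * A = 1)
    (h : ∀ x, eval x P = c * A.mulVec x 0 * A.mulVec x 1 * A.mulVec x 2) :
    hessDet3 P = C (2 * c ^ 2) * P := by
  have hQ : hessDet3 (C c * X 0 * X 1 * X 2) = C (2 * c ^ 2) * (C c * X 0 * X 1 * X 2) := by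
    change (hessian _).det = _
    rw [hessian_monomial, Matrix.det_fin_three]
    simp [map_ofNat C 2]
    ring
  rw [eq_linSubst_monomial h, hessDet3_linSubst hA, hQ, map_mul, linSubst_C]

theorem sum_sq_hessian_of_eval_eq_mul {P : MvPolynomial (Fin 3) ℝ} {A : Matrix (Fin 3) (Fin 3) ℝ}
    {c : ℝ} (hA : A.transpose * A = 1)
    (h : ∀ x, eval x P = c * A.mulVec x 0 * A.mulVec x 1 * A.mulVec x 2) :
    ∑ i : Fin 3, ∑ j : Fin 3, (pderiv i (pderiv j P)) ^ 2 =
      C (2 * c ^ 2) * ∑ i : Fin 3, X i ^ 2 := by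
  have hQ : ∑ i : Fin 3, ∑ j : Fin 3, (pderiv i (pderiv j (C c * X 0 * X 1 * X 2))) ^ 2 =
      C (2 * c ^ 2) * ∑ i : Fin 3, X i ^ 2 := by
    rw [← trace_hessian_mul_self, hessian_monomial]
    simp [Matrix.trace, Fin.sum_univ_three, map_ofNat C 2]
    ring
  rw [eq_linSubst_monomial h, sum_sq_hessian_linSubst hA, hQ, map_mul, linSubst_C,
    linSubst_sum_X_sq hA]

end HarmonicCubic

/-- A nonzero harmonic homogeneous ternary cubic `P` satisfies `det Hess P = κ·P` for some
`κ > 0` iff it is an orthogonal image of a positive multiple of `x₁x₂x₃`; moreover for such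
harmonic `P` the conditions `|Hess P|² = κ·|x|²` (some `κ > 0`) and `det Hess P = κ'·P`
(some `κ' > 0`) are equivalent. -/
theorem harmonic_cubic_hessian_classification (P : MvPolynomial (Fin 3) ℝ)
    (hhom : P.IsHomogeneous 3) (hP : P ≠ 0)
    (hharm : ∑ i : Fin 3, pderiv i (pderiv i P) = 0) :
    ((∃ κ : ℝ, 0 < κ ∧ hessDet3 P = C κ * P) ↔
      ∃ (A : Matrix (Fin 3) (Fin 3) ℝ) (c : ℝ), A.transpose * A = 1 ∧ 0 < c ∧
        ∀ x : Fin 3 → ℝ,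
          eval x P = c * A.mulVec x 0 * A.mulVec x 1 * A.mulVec x 2) ∧
    ((∃ κ : ℝ, 0 < κ ∧
        (∑ i : Fin 3, ∑ j : Fin 3, (pderiv i (pderiv j P)) ^ 2) =
          C κ * ∑ i : Fin 3, X i ^ 2) ↔
      (∃ κ' : ℝ, 0 < κ' ∧ hessDet3 P = C κ' * P)) := by
  obtain ⟨B, hB, a, b, c, d, e, ha, hform⟩ :=
    HarmonicCubic.exists_linSubst_eq_cubicForm hhom hP hharm
  have hdet : (∃ κ : ℝ, 0 < κ ∧ hessDet3 P = C κ * P) ↔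
      ∃ (A : Matrix (Fin 3) (Fin 3) ℝ) (c : ℝ), A.transpose * A = 1 ∧ 0 < c ∧
        ∀ x : Fin 3 → ℝ,
          eval x P = c * A.mulVec x 0 * A.mulVec x 1 * A.mulVec x 2 := by
    constructor
    · rintro ⟨κ, hκ, h⟩
      refine HarmonicCubic.exists_eval_eq_mul hB ha hform
        (HarmonicCubic.coeffs_of_hessDet3 ha hκ ?_)
      rw [← hform, HarmonicCubic.hessDet3_linSubst hB, h, map_mul, HarmonicCubic.linSubst_C]
    · rintro ⟨A, c, hA, hc, h⟩
      exact ⟨2 * c ^ 2, by positivity, HarmonicCubic.hessDet3_of_eval_eq_mul hA h⟩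
  refine ⟨hdet, ?_⟩
  rw [hdet]
  constructor
  · rintro ⟨κ, -, h⟩
    refine HarmonicCubic.exists_eval_eq_mul hB ha hform
      (HarmonicCubic.coeffs_of_sum_sq_hessian (κ := κ) ha ?_)
    rw [← hform, HarmonicCubic.sum_sq_hessian_linSubst hB, h, map_mul, HarmonicCubic.linSubst_C,
      HarmonicCubic.linSubst_sum_X_sq hB]
  · rintro ⟨A, c, hA, hc, h⟩
    exact ⟨2 * c ^ 2, by positivity, HarmonicCubic.sum_sq_hessian_of_eval_eq_mul hA h⟩
end

section
/- Let κ > 0 and let P be a homogeneous cubic polynomial in three real variables, not identically zero, satisfying ΔP = 0 and Σ_{i,j=1}^{3}(∂ᵢ∂ⱼP)² = κ·(x₁² + x₂² + x₃²) identically. Then there exists an orthogonal 3×3 matrix A such that P(x) = √(κ/2)·(Ax)₁·(Ax)₂·(Ax)₃ for all x ∈ ℝ³. In particular, any two such nonzero solutions P and Q for the same constant κ lie on the same O(3)-orbit: there exists an orthogonal matrix B with Q(x) = P(Bx) for all x ∈ ℝ³. -/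
open MvPolynomial

/-- A totally symmetric, trace-free cubic tensor with slices `N k`, whose slices are orthogonal of
squared Frobenius norm `κ`. -/
structure IsEinsteinTensor (κ : ℝ) (N : Fin 3 → Matrix (Fin 3) (Fin 3) ℝ) : Prop where
  symm : ∀ k i j, N k i j = N k j i
  swap : ∀ k i j, N k i j = N i k j
  trace : ∀ k, (N k).trace = 0
  gram : ∀ k l, (N k * N l).trace = κ * (1 : Matrix (Fin 3) (Fin 3) ℝ) k l

/-- The pullback of a cubic tensor along the linear map with matrix `R`. -/
noncomputable def rotTensor (N : Fin 3 → Matrix (Fin 3) (Fin 3) ℝ) (R : Matrix (Fin 3) (Fin 3) ℝ)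
    (k : Fin 3) : Matrix (Fin 3) (Fin 3) ℝ :=
  ∑ c, R c k • (R.transpose * N c * R)

/-- The cubic form of a cubic tensor. -/
noncomputable def tensorCubic (N : Fin 3 → Matrix (Fin 3) (Fin 3) ℝ) (x : Fin 3 → ℝ) : ℝ :=
  ∑ k, x k * (x ⬝ᵥ (N k).mulVec x)

theorem rotTensor_rotTensor (N : Fin 3 → Matrix (Fin 3) (Fin 3) ℝ)
    (R G : Matrix (Fin 3) (Fin 3) ℝ) :
    rotTensor (rotTensor N R) G = rotTensor N (R * G) := by
  funext k
  simp only [rotTensor, Matrix.mul_sum, Matrix.sum_mul, Finset.smul_sum, Matrix.mul_apply (M := R),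
    Finset.sum_smul, Matrix.transpose_mul]
  rw [Finset.sum_comm]
  refine Finset.sum_congr rfl fun c _ => Finset.sum_congr rfl fun d _ => ?_
  simp only [Matrix.mul_smul, Matrix.smul_mul, smul_smul, Matrix.mul_assoc, mul_comm]

theorem tensorCubic_rotTensor (N : Fin 3 → Matrix (Fin 3) (Fin 3) ℝ)
    (R : Matrix (Fin 3) (Fin 3) ℝ) (x : Fin 3 → ℝ) :
    tensorCubic (rotTensor N R) x = tensorCubic N (R.mulVec x) := by
  have h : ∀ c, x ⬝ᵥ (R.transpose * N c * R).mulVec x =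
      R.mulVec x ⬝ᵥ (N c).mulVec (R.mulVec x) := by
    intro c
    rw [← Matrix.mulVec_mulVec, ← Matrix.mulVec_mulVec, Matrix.dotProduct_mulVec,
      Matrix.vecMul_transpose]
  simp only [tensorCubic, rotTensor, Matrix.sum_mulVec, dotProduct_sum, Matrix.smul_mulVec,
    dotProduct_smul, h, smul_eq_mul, Finset.mul_sum]
  rw [Finset.sum_comm]
  refine Finset.sum_congr rfl fun c _ => ?_
  have hc : R.mulVec x c = ∑ d, R c d * x d := rfl
  rw [hc, Finset.sum_mul]
  refine Finset.sum_congr rfl fun d _ => ?_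
  ring

theorem IsEinsteinTensor.rotTensor {κ : ℝ} {N : Fin 3 → Matrix (Fin 3) (Fin 3) ℝ}
    (h : IsEinsteinTensor κ N) {R : Matrix (Fin 3) (Fin 3) ℝ} (hR : R.transpose * R = 1) :
    IsEinsteinTensor κ (rotTensor N R) where
  symm k i j := by
    have e : ∀ c, (R.transpose * N c * R).transpose = R.transpose * N c * R := by
      intro c
      have : (N c).transpose = N c := by ext a b; exact h.symm c b a
      simp [Matrix.transpose_mul, this, Matrix.mul_assoc]
    simp only [_root_.rotTensor, Matrix.sum_apply, Matrix.smul_apply]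
    exact Finset.sum_congr rfl fun c _ => by rw [← e c, Matrix.transpose_apply, e c]
  swap k i j := by
    have h01 := h.swap 0 1
    have h02 := h.swap 0 2
    have h12 := h.swap 1 2
    simp only [_root_.rotTensor, Matrix.sum_apply, Matrix.smul_apply, Matrix.mul_apply,
      Fin.sum_univ_three, Matrix.transpose_apply, h01, h02, h12, smul_eq_mul]
    ring
  trace k := by
    have hR' := mul_eq_one_comm.mp hR
    simp only [_root_.rotTensor, Matrix.trace_sum, Matrix.trace_smul]
    refine Finset.sum_eq_zero fun c _ => ?_
    rw [Matrix.trace_mul_comm, ← Matrix.mul_assoc, hR', Matrix.one_mul, h.trace, smul_zero]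
  gram k l := by
    have hR' := mul_eq_one_comm.mp hR
    have e : ∀ c d, (R.transpose * N c * R * (R.transpose * N d * R)).trace
        = κ * (1 : Matrix (Fin 3) (Fin 3) ℝ) c d := by
      intro c d
      rw [← h.gram]
      have : R.transpose * N c * R * (R.transpose * N d * R)
        = R.transpose * (N c * (R * R.transpose) * N d * R) := by simp only [Matrix.mul_assoc]
      rw [this, hR', Matrix.mul_one, Matrix.trace_mul_comm, Matrix.mul_assoc, hR', Matrix.mul_one]
    have hkl : (1 : Matrix (Fin 3) (Fin 3) ℝ) k l = ∑ c, R c k * R c l := by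
      rw [← hR, Matrix.mul_apply]
      rfl
    rw [hkl, Finset.mul_sum]
    simp only [_root_.rotTensor, Matrix.sum_mul, Matrix.mul_sum, Matrix.trace_sum, Matrix.smul_mul,
      Matrix.mul_smul, Matrix.trace_smul, e, Matrix.one_apply, smul_eq_mul, mul_ite, mul_one,
      mul_zero, Finset.sum_ite_eq', Finset.mem_univ, if_true]
    exact Finset.sum_congr rfl fun d _ => by ring

theorem pderiv_pderiv_comm {σ R : Type*} [CommRing R] (i j : σ) (P : MvPolynomial σ R) :
    pderiv i (pderiv j P) = pderiv j (pderiv i P) := by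
  classical
  have h : ⁅(pderiv i : Derivation R (MvPolynomial σ R) (MvPolynomial σ R)),
      (pderiv j : Derivation R (MvPolynomial σ R) (MvPolynomial σ R))⁆ = 0 := by
    refine derivation_ext fun k => ?_
    simp only [Derivation.commutator_apply, pderiv_X, Derivation.zero_apply]
    simp [Pi.single_apply, apply_ite]
  have := congrArg (fun D => D P) h
  simpa [Derivation.commutator_apply, sub_eq_zero] using this

/-- The third partial derivatives of a polynomial at the origin. -/
noncomputable def hessianTensor (P : MvPolynomial (Fin 3) ℝ) (k : Fin 3) :
    Matrix (Fin 3) (Fin 3) ℝ :=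
  Matrix.of fun i j => coeff 0 (pderiv k (pderiv i (pderiv j P)))

theorem pderiv_pderiv_eq_sum {P : MvPolynomial (Fin 3) ℝ} (hhom : P.IsHomogeneous 3) (i j : Fin 3) :
    pderiv i (pderiv j P) = ∑ k, X k * C (hessianTensor P k i j) := by
  have h1 : (pderiv i (pderiv j P)).IsHomogeneous 1 := (hhom.pderiv (i := j)).pderiv
  have h2 := h1.sum_X_mul_pderiv
  rw [one_smul] at h2
  conv_lhs => rw [← h2]
  refine Finset.sum_congr rfl fun k _ => ?_
  congr 1
  have h0 : (pderiv k (pderiv i (pderiv j P))).IsHomogeneous 0 := h1.pderiv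
  rwa [← totalDegree_zero_iff_isHomogeneous, totalDegree_eq_zero_iff_eq_C] at h0

theorem eval_eq_tensorCubic {P : MvPolynomial (Fin 3) ℝ} (hhom : P.IsHomogeneous 3)
    (x : Fin 3 → ℝ) :
    6 * eval x P = tensorCubic (hessianTensor P) x := by
  have h3 := congrArg (eval x) hhom.sum_X_mul_pderiv
  have h2 : ∀ j, _ := fun j => congrArg (eval x) (hhom.pderiv (i := j)).sum_X_mul_pderiv
  simp only [pderiv_pderiv_eq_sum hhom, map_sum, map_mul, eval_X, eval_C, nsmul_eq_mul,
    map_natCast] at h2 h3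
  have h2' : ∀ j, eval x (pderiv j P) = (1 / 2) * ∑ i, x i * ∑ k, x k * hessianTensor P k i j := by
    intro j
    have := h2 j
    push_cast at this
    linarith
  simp only [h2'] at h3
  simp only [tensorCubic, dotProduct, Matrix.mulVec, Fin.sum_univ_three] at h3 ⊢
  push_cast at h3
  linarith

theorem isEinsteinTensor_hessianTensor {κ : ℝ} {P : MvPolynomial (Fin 3) ℝ}
    (hhom : P.IsHomogeneous 3)
    (hharm : ∑ i : Fin 3, pderiv i (pderiv i P) = 0)
    (hhess : (∑ i : Fin 3, ∑ j : Fin 3, (pderiv i (pderiv j P)) ^ 2) =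
      C κ * ∑ i : Fin 3, X i ^ 2) :
    IsEinsteinTensor κ (hessianTensor P) := by
  have symm : ∀ k i j, hessianTensor P k i j = hessianTensor P k j i := fun k i j => by
    simp only [hessianTensor, Matrix.of_apply, pderiv_pderiv_comm i j]
  have gram : ∀ x : Fin 3 → ℝ,
      ∑ i, ∑ j, (∑ k, x k * hessianTensor P k i j) ^ 2 = κ * ∑ i, x i ^ 2 := by
    intro x
    have := congrArg (eval x) hhess
    simpa only [pderiv_pderiv_eq_sum hhom, map_sum, map_mul, map_pow, eval_X, eval_C] using this
  refine ⟨symm, fun k i j => ?_, fun k => ?_, fun k l => ?_⟩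
  · simp only [hessianTensor, Matrix.of_apply, pderiv_pderiv_comm k i]
  · have := congrArg (fun p => coeff 0 (pderiv k p)) hharm
    simpa only [map_sum, coeff_sum, map_zero, coeff_zero, Matrix.trace, Matrix.diag, hessianTensor,
      Matrix.of_apply] using this
  · have h := gram (Pi.single k 1 + Pi.single l 1)
    have h' := gram (Pi.single k 1 - Pi.single l 1)
    simp only [Matrix.trace, Matrix.diag, Matrix.mul_apply, symm l]
    fin_cases k <;> fin_cases l <;>
      simp [Fin.sum_univ_three, Pi.single_apply] at h h' ⊢ <;> linarith

theorem rotTensor_apply_diag (N : Fin 3 → Matrix (Fin 3) (Fin 3) ℝ)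
    (R : Matrix (Fin 3) (Fin 3) ℝ) (k : Fin 3) :
    rotTensor N R k k k = tensorCubic N (fun i => R i k) := by
  have h := tensorCubic_rotTensor N R (Pi.single k 1)
  have h' : tensorCubic (rotTensor N R) (Pi.single k 1) = rotTensor N R k k k := by
    simp [tensorCubic, Pi.single_apply]
  rw [← h', h, Matrix.mulVec_single_one]
  rfl

theorem isCompact_setOf_transpose_mul_self :
    IsCompact {R : Matrix (Fin 3) (Fin 3) ℝ | R.transpose * R = 1} := by
  have hK : IsCompact
      (Set.univ.pi fun _ : Fin 3 => Set.univ.pi fun _ : Fin 3 => Set.Icc (-1 : ℝ) 1) :=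
    isCompact_univ_pi fun _ => isCompact_univ_pi fun _ => isCompact_Icc
  refine IsCompact.of_isClosed_subset hK ?_ fun R hR => ?_
  · exact isClosed_eq (by fun_prop) continuous_const
  · have hU : R ∈ Matrix.unitaryGroup (Fin 3) ℝ := by
      rw [Matrix.mem_unitaryGroup_iff']
      exact hR
    exact fun i _ j _ => abs_le.mp (entry_norm_bound_of_unitary hU i j)

/-- There is an orthonormal frame whose first vector maximizes the cubic form on the unit sphere,
and whose second vector maximizes it subject to that. -/
theorem exists_maximal_frame (N : Fin 3 → Matrix (Fin 3) (Fin 3) ℝ) :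
    ∃ R : Matrix (Fin 3) (Fin 3) ℝ, R.transpose * R = 1 ∧
      ∀ G : Matrix (Fin 3) (Fin 3) ℝ, G.transpose * G = 1 →
        rotTensor (rotTensor N R) G 0 0 0 ≤ rotTensor N R 0 0 0 ∧
        (rotTensor (rotTensor N R) G 0 0 0 = rotTensor N R 0 0 0 →
          rotTensor (rotTensor N R) G 1 1 1 ≤ rotTensor N R 1 1 1) := by
  have hc : ∀ k : Fin 3, Continuous fun R : Matrix (Fin 3) (Fin 3) ℝ => rotTensor N R k k k := by
    intro k
    simp only [rotTensor_apply_diag, tensorCubic, dotProduct, Matrix.mulVec]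
    fun_prop
  obtain ⟨S, hS, hSmax⟩ := isCompact_setOf_transpose_mul_self.exists_isMaxOn
    ⟨1, by simp⟩ (hc 0).continuousOn
  obtain ⟨R, ⟨hR, hRS⟩, hRmax⟩ := (isCompact_setOf_transpose_mul_self.inter_right
    (isClosed_eq (hc 0) (continuous_const (y := rotTensor N S 0 0 0)))).exists_isMaxOn
    ⟨S, hS, rfl⟩ (hc 1).continuousOn
  refine ⟨R, hR, fun G hG => ?_⟩
  have hRG : (R * G).transpose * (R * G) = 1 := by
    rw [Matrix.transpose_mul, Matrix.mul_assoc, ← Matrix.mul_assoc _ R G, hR, Matrix.one_mul, hG]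
  rw [rotTensor_rotTensor]
  simp only [Set.mem_ofPred_eq] at hRS
  refine ⟨?_, fun h => ?_⟩
  · rw [hRS]
    exact hSmax hRG
  · exact hRmax ⟨hRG, h.trans hRS⟩

theorem eq_zero_of_forall_cubic_cos_sin_le {a b c d : ℝ}
    (h : ∀ θ : ℝ, a * Real.cos θ ^ 3 + 3 * b * (Real.cos θ ^ 2 * Real.sin θ)
      + 3 * c * (Real.cos θ * Real.sin θ ^ 2) + d * Real.sin θ ^ 3 ≤ a) : b = 0 := by
  have hC := Real.hasDerivAt_cos 0
  have hS := Real.hasDerivAt_sin 0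
  have hd := ((((hC.pow 3).const_mul a).add (((hC.pow 2).mul hS).const_mul (3 * b))).add
    ((hC.mul (hS.pow 2)).const_mul (3 * c))).add ((hS.pow 3).const_mul d)
  have hm : IsLocalMax (fun θ : ℝ => a * Real.cos θ ^ 3 + 3 * b * (Real.cos θ ^ 2 * Real.sin θ)
      + 3 * c * (Real.cos θ * Real.sin θ ^ 2) + d * Real.sin θ ^ 3) 0 :=
    Filter.Eventually.of_forall fun θ => by simpa using h θ
  have := hm.hasDerivAt_eq_zero hd
  simpa using this

theorem IsEinsteinTensor.tensorCubic_eq {κ : ℝ} {N : Fin 3 → Matrix (Fin 3) (Fin 3) ℝ}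
    (h : IsEinsteinTensor κ N) (x : Fin 3 → ℝ) :
    tensorCubic N x = N 0 0 0 * x 0 ^ 3 + N 1 1 1 * x 1 ^ 3 + N 2 2 2 * x 2 ^ 3
      + 3 * (N 0 0 1 * x 0 ^ 2 * x 1 + N 0 0 2 * x 0 ^ 2 * x 2 + N 0 1 1 * x 0 * x 1 ^ 2
        + N 1 1 2 * x 1 ^ 2 * x 2 + N 0 2 2 * x 0 * x 2 ^ 2 + N 1 2 2 * x 1 * x 2 ^ 2)
      + 6 * N 0 1 2 * x 0 * x 1 * x 2 := by
  simp only [tensorCubic, Fin.sum_univ_three, dotProduct, Matrix.mulVec, h.symm 0 1 0, h.symm 0 2 0,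
    h.symm 0 2 1, h.symm 1 2 1, h.symm 1 1 0, h.symm 1 2 0, h.symm 2 1 0, h.symm 2 2 0,
    h.symm 2 2 1, h.swap 1 0, h.swap 2 0, h.swap 2 1]
  ring

theorem IsEinsteinTensor.offDiag_eq_zero_of_maximal {κ : ℝ}
    {N : Fin 3 → Matrix (Fin 3) (Fin 3) ℝ} (h : IsEinsteinTensor κ N)
    (hmax : ∀ G : Matrix (Fin 3) (Fin 3) ℝ, G.transpose * G = 1 →
      _root_.rotTensor N G 0 0 0 ≤ N 0 0 0 ∧
      (_root_.rotTensor N G 0 0 0 = N 0 0 0 → _root_.rotTensor N G 1 1 1 ≤ N 1 1 1)) :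
    N 0 0 1 = 0 ∧ N 0 0 2 = 0 ∧ N 1 1 2 = 0 := by
  refine ⟨?_, ?_, ?_⟩
  · refine eq_zero_of_forall_cubic_cos_sin_le (a := N 0 0 0) (c := N 0 1 1)
      (d := N 1 1 1) fun θ => ?_
    have hcs := Real.sin_sq_add_cos_sq θ
    have := (hmax !![Real.cos θ, -Real.sin θ, 0; Real.sin θ, Real.cos θ, 0; 0, 0, 1] (by
      ext i j
      fin_cases i <;> fin_cases j <;> simp [Matrix.mul_apply, Fin.sum_univ_three] <;>
        linarith)).1
    simp [rotTensor_apply_diag, h.tensorCubic_eq] at this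
    linarith
  · refine eq_zero_of_forall_cubic_cos_sin_le (a := N 0 0 0) (c := N 0 2 2)
      (d := N 2 2 2) fun θ => ?_
    have hcs := Real.sin_sq_add_cos_sq θ
    have := (hmax !![Real.cos θ, 0, -Real.sin θ; 0, 1, 0; Real.sin θ, 0, Real.cos θ] (by
      ext i j
      fin_cases i <;> fin_cases j <;> simp [Matrix.mul_apply, Fin.sum_univ_three] <;>
        linarith)).1
    simp [rotTensor_apply_diag, h.tensorCubic_eq] at this
    linarith
  · refine eq_zero_of_forall_cubic_cos_sin_le (a := N 1 1 1) (c := N 1 2 2)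
      (d := N 2 2 2) fun θ => ?_
    have hcs := Real.sin_sq_add_cos_sq θ
    have := (hmax !![1, 0, 0; 0, Real.cos θ, -Real.sin θ; 0, Real.sin θ, Real.cos θ] (by
      ext i j
      fin_cases i <;> fin_cases j <;> simp [Matrix.mul_apply, Fin.sum_univ_three] <;>
        linarith)).2
    simp [rotTensor_apply_diag, h.tensorCubic_eq] at this
    linarith

theorem harmonic_cubic_coeff_relations {κ a b c d f : ℝ} (hκ : 0 < κ) (ha : 0 ≤ a)
    (htr : a + b + c = 0) (h00 : a ^ 2 + b ^ 2 + c ^ 2 + 2 * f ^ 2 = κ)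
    (h11 : 2 * b ^ 2 + 2 * f ^ 2 + 2 * d ^ 2 = κ) (h22 : 2 * c ^ 2 + 2 * f ^ 2 + 2 * d ^ 2 = κ)
    (h01 : d * (b - c) = 0) (h02 : f * d = 0) (h12 : f * a = 0)
    (hab : a = 0 → d = 0 → b = 0) (haf : a = 0 → d = 0 → f = 0) :
    0 < a ∧ f = 0 ∧ b = -a / 2 ∧ c = -a / 2 ∧ 2 * d ^ 2 = a ^ 2 ∧ 3 * a ^ 2 = 2 * κ := by
  have hd : d ≠ 0 := by
    rintro rfl
    have hbc : a * (b - c) = 0 := by linear_combination (b - c) * htr + (h22 - h11) / 2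
    rcases eq_or_ne a 0 with rfl | ha0
    · have hb := hab rfl rfl
      have hf := haf rfl rfl
      subst hb hf
      linarith
    · have hf : f = 0 := (mul_eq_zero.mp h12).resolve_right ha0
      have hc : b = c := sub_eq_zero.mp ((mul_eq_zero.mp hbc).resolve_left ha0)
      subst hf hc
      have := pow_pos (ha.lt_of_ne' ha0) 2
      linarith
  have hf : f = 0 := (mul_eq_zero.mp h02).resolve_right hd
  have hc : b = c := sub_eq_zero.mp ((mul_eq_zero.mp h01).resolve_left hd)
  have hb : b = -a / 2 := by linarith
  subst hc hf hb
  refine ⟨ha.lt_of_ne ?_, rfl, rfl, rfl, by linarith, by linarith⟩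
  rintro rfl
  linarith

theorem exists_orthogonal_factorization_threefold {κ a d : ℝ} (ha : 0 < a)
    (hd : 2 * d ^ 2 = a ^ 2) (hκ : 3 * a ^ 2 = 2 * κ) :
    ∃ A : Matrix (Fin 3) (Fin 3) ℝ, A.transpose * A = 1 ∧ ∀ x : Fin 3 → ℝ,
      a * (x 0 ^ 3 - 3 / 2 * x 0 * (x 1 ^ 2 + x 2 ^ 2)) + d * (x 1 ^ 3 - 3 * x 1 * x 2 ^ 2) =
        6 * (Real.sqrt (κ / 2) * A.mulVec x 0 * A.mulVec x 1 * A.mulVec x 2) := by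
  have h2 : Real.sqrt 2 ^ 2 = 2 := Real.sq_sqrt (by norm_num)
  have h3 : Real.sqrt 3 ^ 2 = 3 := Real.sq_sqrt (by norm_num)
  generalize Real.sqrt 2 = p at h2
  have hq : 0 ≤ Real.sqrt 3 := Real.sqrt_nonneg 3
  generalize Real.sqrt 3 = q at h3 hq
  have hκ' : Real.sqrt (κ / 2) = a * q / 2 := by
    rw [show κ / 2 = (a * q / 2) ^ 2 by rw [div_pow, mul_pow, h3]; linarith]
    exact Real.sqrt_sq (by positivity)
  obtain ⟨s, hs, hds⟩ : ∃ s : ℝ, s ^ 2 = 1 ∧ d = s * a * p / 2 := by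
    refine ⟨d * p / a, ?_, ?_⟩
    · rw [div_pow, mul_pow, h2, mul_comm, hd, div_self (by positivity)]
    · field_simp
      linear_combination -d * h2
  refine ⟨!![q / 3, s * p * q / 3, 0; q / 3, -(s * p * q / 6), p / 2;
    q / 3, -(s * p * q / 6), -(p / 2)], ?_, fun x => ?_⟩
  · have hspq : (s * p * q) ^ 2 = 6 := by rw [mul_pow, mul_pow, hs, h2, h3]; norm_num
    ext i j
    fin_cases i <;> fin_cases j <;> simp [Matrix.mul_apply, Fin.sum_univ_three] <;> linarith
  · rw [hκ', hds]
    simp [Matrix.mulVec, dotProduct, Fin.sum_univ_three]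
    have hsp : (s * p) ^ 2 = 2 := by rw [mul_pow, hs, h2, one_mul]
    trans a * q ^ 2 * ((x 0 + s * p * x 1) *
      (q ^ 2 / 9 * (x 0 - s * p * x 1 / 2) ^ 2 - p ^ 2 * x 2 ^ 2 / 4))
    · rw [h2, h3]
      linear_combination a * (3 / 4 * x 0 * x 1 ^ 2 - s * p / 4 * x 1 ^ 3) * hsp
    · ring

theorem IsEinsteinTensor.exists_factorization_of_maximal {κ : ℝ} (hκ : 0 < κ)
    {N : Fin 3 → Matrix (Fin 3) (Fin 3) ℝ} (h : IsEinsteinTensor κ N)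
    (hmax : ∀ G : Matrix (Fin 3) (Fin 3) ℝ, G.transpose * G = 1 →
      _root_.rotTensor N G 0 0 0 ≤ N 0 0 0 ∧
      (_root_.rotTensor N G 0 0 0 = N 0 0 0 → _root_.rotTensor N G 1 1 1 ≤ N 1 1 1)) :
    ∃ A : Matrix (Fin 3) (Fin 3) ℝ, A.transpose * A = 1 ∧ ∀ x : Fin 3 → ℝ,
      tensorCubic N x =
        6 * (Real.sqrt (κ / 2) * A.mulVec x 0 * A.mulVec x 1 * A.mulVec x 2) := by
  obtain ⟨h1, h2, h3⟩ := h.offDiag_eq_zero_of_maximal hmax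
  have hcub := h.tensorCubic_eq
  have hp1 := (hmax !![3/5, -4/5, 0; 4/5, 3/5, 0; 0, 0, 1] (by
    ext i j
    fin_cases i <;> fin_cases j <;> simp [Matrix.mul_apply, Fin.sum_univ_three] <;> norm_num)).1
  have hp2 := (hmax !![-3/5, -4/5, 0; 4/5, -3/5, 0; 0, 0, 1] (by
    ext i j
    fin_cases i <;> fin_cases j <;> simp [Matrix.mul_apply, Fin.sum_univ_three] <;> norm_num)).1
  have hp3 := (hmax !![1/3, 2/3, 2/3; 2/3, 1/3, -2/3; 2/3, -2/3, 1/3] (by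
    ext i j
    fin_cases i <;> fin_cases j <;> simp [Matrix.mul_apply, Fin.sum_univ_three] <;> norm_num)).1
  have hp4 := (hmax !![-1/3, 2/3, 2/3; 2/3, -1/3, 2/3; 2/3, 2/3, -1/3] (by
    ext i j
    fin_cases i <;> fin_cases j <;> simp [Matrix.mul_apply, Fin.sum_univ_three] <;> norm_num)).1
  have hp5 := (hmax (-1) (by simp)).1
  simp [rotTensor_apply_diag, hcub, Matrix.one_apply, h1, h2, h3] at hp1 hp2 hp3 hp4 hp5
  have t0 := h.trace 0
  have t1 := h.trace 1
  have t2 := h.trace 2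
  have g00 := h.gram 0 0
  have g11 := h.gram 1 1
  have g22 := h.gram 2 2
  have g01 := h.gram 0 1
  have g02 := h.gram 0 2
  have g12 := h.gram 1 2
  simp [Matrix.trace, Matrix.mul_apply, Fin.sum_univ_three, h.symm 0 1 0, h.symm 0 2 0,
    h.symm 0 2 1, h.symm 1 2 1, h.symm 1 1 0, h.symm 1 2 0, h.symm 2 1 0, h.symm 2 2 0,
    h.symm 2 2 1, h.swap 1 0, h.swap 2 0, h.swap 2 1, h1, h2, h3]
    at t0 t1 t2 g00 g11 g22 g01 g02 g12
  have e : N 1 2 2 = -N 1 1 1 := by linarith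
  rw [e, t2] at g22 g02 g12 hp3 hp4
  rw [e] at g11 g01
  obtain ⟨ha, hf, hb, hc, hd, hκa⟩ := harmonic_cubic_coeff_relations (a := N 0 0 0)
    (b := N 0 1 1) (c := N 0 2 2) (d := N 1 1 1) (f := N 0 1 2) hκ (by linarith) (by linarith)
    (by linarith) (by linarith) (by linarith) (by linarith) (by linarith)
    (by linear_combination N 0 1 2 * t0 - g12 / 2)
    (fun ha hd => by rw [ha, hd] at hp1 hp2; linarith)
    (fun ha hd => by rw [ha, hd] at hp3 hp4; rw [ha] at t0; linarith)
  obtain ⟨A, hA, hfac⟩ := exists_orthogonal_factorization_threefold ha hd hκa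
  refine ⟨A, hA, fun x => ?_⟩
  rw [← hfac, hcub, h1, h2, h3, t2, e, hf, hb, hc]
  ring

/-- A harmonic homogeneous ternary cubic with `|Hess P|² = κ·|x|²` factors orthogonally. -/
theorem exists_orthogonal_factorization {κ : ℝ} (hκ : 0 < κ) {P : MvPolynomial (Fin 3) ℝ}
    (hhom : P.IsHomogeneous 3) (hharm : ∑ i : Fin 3, pderiv i (pderiv i P) = 0)
    (hhess : (∑ i : Fin 3, ∑ j : Fin 3, (pderiv i (pderiv j P)) ^ 2) =
      C κ * ∑ i : Fin 3, X i ^ 2) :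
    ∃ A : Matrix (Fin 3) (Fin 3) ℝ, A.transpose * A = 1 ∧ ∀ x : Fin 3 → ℝ,
      eval x P = Real.sqrt (κ / 2) * A.mulVec x 0 * A.mulVec x 1 * A.mulVec x 2 := by
  have hN := isEinsteinTensor_hessianTensor hhom hharm hhess
  obtain ⟨R, hR, hmax⟩ := exists_maximal_frame (hessianTensor P)
  obtain ⟨A, hA, hfac⟩ := (hN.rotTensor hR).exists_factorization_of_maximal hκ hmax
  have hR' := mul_eq_one_comm.mp hR
  refine ⟨A * R.transpose, ?_, fun x => ?_⟩
  · rw [Matrix.transpose_mul, Matrix.mul_assoc, ← Matrix.mul_assoc _ A, hA, Matrix.one_mul,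
      Matrix.transpose_transpose, hR']
  · have h := hfac (R.transpose.mulVec x)
    rw [tensorCubic_rotTensor, Matrix.mulVec_mulVec, Matrix.mulVec_mulVec, hR', Matrix.one_mulVec,
      ← eval_eq_tensorCubic hhom] at h
    linarith

/-- Any nonzero harmonic homogeneous ternary cubic `P` with `|Hess P|² = κ·|x|²` (`κ > 0`) is
an orthogonal image of `√(κ/2)·x₁x₂x₃`; in particular any two such solutions for the same `κ`
lie on the same `O(3)`-orbit. -/
theorem cubic_einstein_polynomial_unique (κ : ℝ) (hκ : 0 < κ)
    (P : MvPolynomial (Fin 3) ℝ) (hhom : P.IsHomogeneous 3) (hP : P ≠ 0)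
    (hharm : ∑ i : Fin 3, pderiv i (pderiv i P) = 0)
    (hhess : (∑ i : Fin 3, ∑ j : Fin 3, (pderiv i (pderiv j P)) ^ 2) =
      C κ * ∑ i : Fin 3, X i ^ 2) :
    (∃ A : Matrix (Fin 3) (Fin 3) ℝ, A.transpose * A = 1 ∧
      ∀ x : Fin 3 → ℝ,
        eval x P = Real.sqrt (κ / 2) * A.mulVec x 0 * A.mulVec x 1 * A.mulVec x 2) ∧
    ∀ Q : MvPolynomial (Fin 3) ℝ, Q.IsHomogeneous 3 → Q ≠ 0 →
      (∑ i : Fin 3, pderiv i (pderiv i Q) = 0) →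
      ((∑ i : Fin 3, ∑ j : Fin 3, (pderiv i (pderiv j Q)) ^ 2) =
        C κ * ∑ i : Fin 3, X i ^ 2) →
      ∃ B : Matrix (Fin 3) (Fin 3) ℝ, B.transpose * B = 1 ∧
        ∀ x : Fin 3 → ℝ, eval x Q = eval (B.mulVec x) P := by
  obtain ⟨A, hA, hPA⟩ := exists_orthogonal_factorization hκ hhom hharm hhess
  refine ⟨⟨A, hA, hPA⟩, fun Q hQhom _ hQharm hQhess => ?_⟩
  obtain ⟨A', hA', hQA⟩ := exists_orthogonal_factorization hκ hQhom hQharm hQhess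
  have hAT := mul_eq_one_comm.mp hA
  refine ⟨A.transpose * A', ?_, fun x => ?_⟩
  · rw [Matrix.transpose_mul, Matrix.mul_assoc, ← Matrix.mul_assoc _ A.transpose,
      Matrix.transpose_transpose, hAT, Matrix.one_mul, hA']
  · rw [hPA, hQA, Matrix.mulVec_mulVec, ← Matrix.mul_assoc, hAT, Matrix.one_mul]
end

section
/- Let K be a field of characteristic zero and let g be a finite-dimensional semisimple Lie algebra over K. If e ∈ g is nonzero and nilpotent (i.e., the adjoint endomorphism ad(e) is nilpotent), then there exist h, f ∈ g such that ⁅h,e⁆ = 2e, ⁅h,f⁆ = −2f, and ⁅e,f⁆ = h; that is, e is the nilpositive element of an sl₂-triple in g. -/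
/-- If `c = a * b - b * a` commutes with `a`, then commuting `b` past a power of `a` behaves like
differentiation. -/
lemma pow_succ_mul_sub_mul_pow_succ {K R : Type*} [Field K] [Ring R] [Algebra K R] {a b c : R}
    (hc : a * b - b * a = c) (hac : Commute a c) (k : ℕ) :
    a ^ (k + 1) * b - b * a ^ (k + 1) = (k + 1 : K) • (a ^ k * c) := by
  induction k with
  | zero => simp [hc]
  | succ k ih =>
    have h1 : a ^ (k + 1 + 1) * b - b * a ^ (k + 1 + 1)
        = a * (a ^ (k + 1) * b - b * a ^ (k + 1)) + (a * b - b * a) * a ^ (k + 1) := by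
      rw [pow_succ' a (k + 1)]; noncomm_ring
    rw [h1, ih, hc, ← (hac.pow_left (k + 1)).eq, mul_smul_comm, ← mul_assoc, ← pow_succ']
    push_cast
    module

/-- If `a` is nilpotent and commutes with the commutator `c` of `a` and `b`, then `c` is
nilpotent. -/
lemma IsNilpotent.commutator_of_commute (K : Type*) {R : Type*} [Field K] [CharZero K] [Ring R]
    [Algebra K R] {a b c : R} (ha : IsNilpotent a)
    (hc : a * b - b * a = c) (hac : Commute a c) : IsNilpotent c := by
  obtain ⟨n, hn⟩ := ha
  suffices H : ∀ k m : ℕ, a ^ k * c ^ m = 0 → IsNilpotent c from H n 0 (by simp [hn])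
  intro k
  induction k with
  | zero => intro m hm; exact ⟨m, by simpa using hm⟩
  | succ k ih =>
    intro m hm
    refine ih (m + 1 + m) ?_
    have hm' : c ^ m * a ^ (k + 1) = 0 := by rw [← (hac.pow_pow (k + 1) m).eq, hm]
    have key : c ^ m * (a ^ (k + 1) * b - b * a ^ (k + 1)) * c ^ m = 0 := by
      have : c ^ m * (a ^ (k + 1) * b - b * a ^ (k + 1)) * c ^ m
          = c ^ m * a ^ (k + 1) * b * c ^ m - c ^ m * b * (a ^ (k + 1) * c ^ m) := by
        noncomm_ring
      rw [this, hm, hm']; simp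
    rw [pow_succ_mul_sub_mul_pow_succ (K := K) hc hac, mul_smul_comm, smul_mul_assoc,
      smul_eq_zero] at key
    have hk : (k + 1 : K) ≠ 0 := by exact_mod_cast k.succ_ne_zero
    rw [pow_add, _root_.pow_succ, ← mul_assoc, ← mul_assoc, (hac.pow_pow k m).eq]
    simpa [hk, mul_assoc] using key

/-- If `a` is nilpotent and commutes with the commutator of `a` and `b`, then `a * b` is
nilpotent. -/
lemma IsNilpotent.mul_of_commute_commutator (K : Type*) {R : Type*} [Field K] [CharZero K] [Ring R]
    [Algebra K R] {a b : R} (ha : IsNilpotent a)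
    (hac : Commute a (a * b - b * a)) : IsNilpotent (a * b) := by
  obtain ⟨m, hm⟩ := ha.commutator_of_commute K rfl hac
  obtain ⟨n, hn⟩ := ha
  set c := a * b - b * a with hc
  suffices H : ∀ (k : ℕ) (v : R), a ^ k * v = 0 → ∃ l : ℕ, (a * b) ^ l * v = 0 by
    obtain ⟨l, hl⟩ := H n 1 (by simp [hn])
    exact ⟨l, by simpa using hl⟩
  intro k
  induction k with
  | zero => intro v hv; exact ⟨0, by simpa using hv⟩
  | succ k ih =>
    intro v hv
    have step (j : ℕ) : a ^ (k + 1) * ((a * b) ^ j * v) = 0 ∧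
        a ^ k * ((a * b) ^ j * v) = ((k + 1 : K) ^ j) • (c ^ j * (a ^ k * v)) := by
      induction j with
      | zero => simpa using hv
      | succ j hj =>
        set w := (a * b) ^ j * v with hw
        have h2 : a ^ k * ((a * b) ^ (j + 1) * v) = (k + 1 : K) • (c * (a ^ k * w)) := by
          have h3 := congrArg (· * w)
            (pow_succ_mul_sub_mul_pow_succ (K := K) hc.symm hac k)
          simp only [sub_mul, mul_assoc, hj.1, mul_zero, sub_zero, smul_mul_assoc] at h3
          rw [pow_succ' (a * b), mul_assoc, ← hw, ← mul_assoc c, ← (hac.pow_left k).eq,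
            mul_assoc (a ^ k) c, ← h3, _root_.pow_succ a k]
          simp only [mul_assoc]
        refine ⟨?_, ?_⟩
        · rw [pow_succ', mul_assoc, h2, mul_smul_comm, ← mul_assoc, hac.eq, mul_assoc,
            ← mul_assoc a, ← pow_succ', hj.1]
          simp
        · rw [h2, hj.2, mul_smul_comm, smul_smul, ← mul_assoc c, ← pow_succ', ← pow_succ']
    obtain ⟨l, hl⟩ := ih ((a * b) ^ m * v) (by rw [(step m).2, hm]; simp)
    exact ⟨l + m, by rw [pow_add, mul_assoc, hl]⟩

section Sl2

variable {K R : Type*} [Field K] [Ring R] [Algebra K R]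

/-- The commutator of a power of `e` with `f`, when `⁅e, f⁆ = h` and `⁅h, e⁆ = 2e`. -/
lemma pow_succ_mul_sub_mul_pow_succ_of_sl2 {e f h : R} (hef : e * f - f * e = h)
    (hhe : h * e - e * h = (2 : K) • e) (n : ℕ) :
    e ^ (n + 1) * f - f * e ^ (n + 1) = (n + 1 : K) • (h * e ^ n - (n : K) • e ^ n) := by
  have hhe' : e * h = h * e - (2 : K) • e := by rw [← hhe]; abel
  induction n with
  | zero => simp [hef]
  | succ n ih =>
    have h1 : e ^ (n + 1 + 1) * f - f * e ^ (n + 1 + 1)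
        = e * (e ^ (n + 1) * f - f * e ^ (n + 1)) + (e * f - f * e) * e ^ (n + 1) := by
      rw [pow_succ' e (n + 1)]; noncomm_ring
    rw [h1, ih, hef, mul_smul_comm, mul_sub, mul_smul_comm, ← mul_assoc, hhe', sub_mul,
      smul_mul_assoc, mul_assoc, ← pow_succ']
    push_cast
    module

/-- If `E` is nilpotent, `⁅E, F⁆ = H` and `⁅H, E⁆ = 2E`, then `-2` is not an eigenvalue of `H` on
the kernel of `E`. -/
lemma eq_zero_of_mem_ker_of_apply_eq_neg_two_smul [CharZero K] {V : Type*} [AddCommGroup V]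
    [Module K V] {E F H : Module.End K V} (hE : IsNilpotent E) (hEF : E * F - F * E = H)
    (hHE : H * E - E * H = (2 : K) • E) {y : V} (hy : E y = 0) (hHy : H y = (-2 : K) • y) :
    y = 0 := by
  have mem (n : ℕ) : ∃ z, (E ^ n) z = y := by
    induction n with
    | zero => exact ⟨y, rfl⟩
    | succ n ih =>
      obtain ⟨z, hz⟩ := ih
      have h1 := LinearMap.congr_fun (pow_succ_mul_sub_mul_pow_succ_of_sl2 hEF hHE n) z
      have h2 : (E ^ (n + 1)) z = 0 := by rw [pow_succ', Module.End.mul_apply, hz, hy]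
      simp only [LinearMap.sub_apply, LinearMap.smul_apply, Module.End.mul_apply, h2, hz, hHy,
        map_zero, sub_zero] at h1
      have h3 : (n + 1 : K) ≠ 0 := by exact_mod_cast n.succ_ne_zero
      have h4 : (n + 2 : K) ≠ 0 := by exact_mod_cast (n + 1).succ_ne_zero
      refine ⟨(-((n + 1 : K) * (n + 2)))⁻¹ • F z, ?_⟩
      rw [map_smul, h1, inv_smul_eq_iff₀ (neg_ne_zero.mpr (mul_ne_zero h3 h4))]
      module
  obtain ⟨n, hn⟩ := hE
  obtain ⟨z, hz⟩ := mem n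
  rw [← hz, hn, LinearMap.zero_apply]

end Sl2

section LieAlgebra

open LieAlgebra

variable {K g : Type*} [Field K] [LieRing g] [LieAlgebra K g]

lemma LieAlgebra.ad_mul_ad_sub (x y : g) :
    ad K g x * ad K g y - ad K g y * ad K g x = ad K g ⁅x, y⁆ := by
  ext z
  simp

variable [CharZero K]

/-- An ad-nilpotent element is Killing-orthogonal to the kernel of the square of its adjoint
endomorphism. -/
lemma LieAlgebra.killingForm_eq_zero_of_lie_lie_eq_zero {e x : g}
    (he : IsNilpotent (ad K g e)) (hx : ⁅e, ⁅e, x⁆⁆ = 0) : killingForm K g e x = 0 := by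
  rw [killingForm_apply_apply]
  refine (LinearMap.isNilpotent_trace_of_isNilpotent (R := K) ?_).eq_zero
  refine he.mul_of_commute_commutator K ?_
  rw [ad_mul_ad_sub]
  exact sub_eq_zero.mp (by rw [ad_mul_ad_sub, hx, map_zero])

/-- An ad-nilpotent element of a Killing Lie algebra lies in the range of the square of its adjoint
endomorphism. -/
lemma LieAlgebra.exists_lie_lie_eq_of_isNilpotent_ad [FiniteDimensional K g] [IsKilling K g]
    {e : g} (he : IsNilpotent (ad K g e)) : ∃ z : g, ⁅e, ⁅e, z⁆⁆ = e := by
  suffices e ∈ LinearMap.range (ad K g e * ad K g e) by simpa using this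
  have hsymm := LieModule.traceForm_isSymm K g g
  have hnd := IsKilling.killingForm_nondegenerate K g
  rw [← LinearMap.BilinForm.orthogonal_orthogonal hnd hsymm.isRefl (LinearMap.range _)]
  intro x hx
  change killingForm K g x e = 0
  rw [LieModule.traceForm_comm]
  refine killingForm_eq_zero_of_lie_lie_eq_zero he (hnd.1 _ fun z ↦ ?_)
  have hz : killingForm K g ⁅e, ⁅e, z⁆⁆ x = 0 := hx _ ⟨z, rfl⟩
  rw [LieModule.traceForm_comm, ← hz, LieModule.traceForm_apply_lie_apply',
    LieModule.traceForm_apply_lie_apply', neg_neg]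

end LieAlgebra

/-- **Jacobson–Morozov.** In a finite-dimensional semisimple Lie algebra over a field of
characteristic zero, every nonzero nilpotent element is the nilpositive element of an
`sl₂`-triple. -/
theorem jacobson_morozov {K : Type*} [Field K] [CharZero K]
    {g : Type*} [LieRing g] [LieAlgebra K g] [FiniteDimensional K g]
    [LieAlgebra.IsSemisimple K g]
    (e : g) (he : e ≠ 0) (hnil : IsNilpotent (LieAlgebra.ad K g e)) :
    ∃ h f : g, ⁅h, e⁆ = (2 : K) • e ∧ ⁅h, f⁆ = (-2 : K) • f ∧ ⁅e, f⁆ = h := by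
  obtain ⟨z, hz⟩ := LieAlgebra.exists_lie_lie_eq_of_isNilpotent_ad hnil
  obtain ⟨f, hf⟩ : ∃ f : g, f = (-2 : K) • z := ⟨_, rfl⟩
  obtain ⟨h, hef⟩ : ∃ h : g, ⁅e, f⁆ = h := ⟨_, rfl⟩
  have hhe : ⁅h, e⁆ = (2 : K) • e := by
    rw [← hef, hf, lie_smul, smul_lie, ← lie_skew, hz]
    module
  have heh : ⁅e, h⁆ = (-2 : K) • e := by rw [← lie_skew, hhe]; module
  let N := LinearMap.ker (LieAlgebra.ad K g e)
  let T : Module.End K g := LieAlgebra.ad K g h + (2 : K) • 1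
  have hT (y : g) : T y = ⁅h, y⁆ + (2 : K) • y := rfl
  have hmem {y : g} : y ∈ N ↔ ⁅e, y⁆ = 0 := Iff.rfl
  have hTN : ∀ y ∈ N, T y ∈ N := by
    intro y hy
    rw [hmem] at hy ⊢
    rw [hT, lie_add, leibniz_lie, heh, lie_smul, smul_lie, hy]
    simp
  have hinj : Function.Injective (T.restrict hTN) := by
    rw [injective_iff_map_eq_zero]
    rintro ⟨y, hy⟩ hTy
    have hTy' : ⁅h, y⁆ + (2 : K) • y = 0 := congrArg Subtype.val hTy
    refine Subtype.ext (eq_zero_of_mem_ker_of_apply_eq_neg_two_smul (K := K) hnil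
      (LieAlgebra.ad_mul_ad_sub e f) ?_ hy ?_)
    · rw [LieAlgebra.ad_mul_ad_sub, hef, hhe, map_smul]
    · rw [hef, LieAlgebra.ad_apply, eq_neg_of_add_eq_zero_left hTy']
      module
  have hTf : T f ∈ N := by
    rw [hmem, hT, lie_add, leibniz_lie, heh, lie_smul, smul_lie, hef, lie_self]
    module
  obtain ⟨⟨y, hy⟩, hyf⟩ := LinearMap.surjective_of_injective hinj ⟨T f, hTf⟩
  have hyf' : ⁅h, y⁆ + (2 : K) • y = ⁅h, f⁆ + (2 : K) • f := congrArg Subtype.val hyf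
  refine ⟨h, f - y, hhe, ?_, ?_⟩
  · rw [lie_sub, eq_sub_of_add_eq hyf']
    module
  · rw [lie_sub, hmem.mp hy, sub_zero, hef]
end

section
/- Let (A, ∘, h) and (A', ∘', h') be finite-dimensional real Frobenius algebras (finite-dimensional real vector spaces with bilinear multiplications and nondegenerate left-invariant bilinear forms). Then (A,∘,h) and (A',∘',h') are isomorphic if and only if their unitalizations (Â_h, ∘̂, ĥ) and (Â'_{h'}, ∘̂', ĥ') are isomorphic, where an isomorphism means a linear bijection Φ satisfying Φ(x∘y) = Φ(x)∘Φ(y) and with the target form pulling back to the source form, h'(Φ(x),Φ(y)) = h(x,y). -/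
/-- A finite-dimensional real vector space with a bilinear multiplication and a bilinear
form (no associativity, commutativity, or unit assumed). -/
structure BilinAlg (A : Type*) [AddCommGroup A] [Module ℝ A] where
  mul : A →ₗ[ℝ] A →ₗ[ℝ] A
  form : A →ₗ[ℝ] A →ₗ[ℝ] ℝ

namespace BilinAlg

variable {A A' : Type*} [AddCommGroup A] [Module ℝ A] [AddCommGroup A'] [Module ℝ A']

/-- Left invariance of the bilinear form: `h(x∘y, z) = h(x, y∘z)`. -/
def LeftInvariant (F : BilinAlg A) : Prop :=
  ∀ x y z, F.form (F.mul x y) z = F.form x (F.mul y z)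

/-- Nondegeneracy of the bilinear form in both slots. -/
def Nondeg (F : BilinAlg A) : Prop :=
  (∀ x, (∀ y, F.form x y = 0) → x = 0) ∧ (∀ y, (∀ x, F.form x y = 0) → y = 0)

/-- A Frobenius algebra: the form is nondegenerate and left invariant. -/
def IsFrobenius (F : BilinAlg A) : Prop := F.Nondeg ∧ F.LeftInvariant

/-- The unitalization `Â_h = A ⊕ ℝ` with multiplication
`(x,λ)∘̂(y,μ) = (x∘y + λy + μx, h(x,y) + λμ)` and form `ĥ((x,λ),(y,μ)) = h(x,y) + λμ`. -/
noncomputable def hat (F : BilinAlg A) : BilinAlg (A × ℝ) where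
  mul := LinearMap.mk₂ ℝ
    (fun u v => (F.mul u.1 v.1 + u.2 • v.1 + v.2 • u.1, F.form u.1 v.1 + u.2 * v.2))
    (fun u u' v => by
      simp only [Prod.fst_add, Prod.snd_add, map_add, LinearMap.add_apply, add_smul,
        smul_add, add_mul, Prod.mk_add_mk, Prod.mk.injEq]
      exact ⟨by abel, by ring⟩)
    (fun c u v => by
      simp only [Prod.smul_fst, Prod.smul_snd, map_smul, LinearMap.smul_apply,
        smul_eq_mul, Prod.smul_mk, Prod.mk.injEq]
      exact ⟨by module, by ring⟩)
    (fun u v v' => by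
      simp only [Prod.fst_add, Prod.snd_add, map_add, LinearMap.add_apply, smul_add,
        add_smul, mul_add, Prod.mk_add_mk, Prod.mk.injEq]
      exact ⟨by abel, by ring⟩)
    (fun c u v => by
      simp only [Prod.smul_fst, Prod.smul_snd, map_smul, LinearMap.smul_apply,
        smul_eq_mul, Prod.smul_mk, Prod.mk.injEq]
      exact ⟨by module, by ring⟩)
  form := LinearMap.mk₂ ℝ
    (fun u v => F.form u.1 v.1 + u.2 * v.2)
    (fun u u' v => by
      simp only [Prod.fst_add, Prod.snd_add, map_add, LinearMap.add_apply, add_mul]; ring)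
    (fun c u v => by
      simp only [Prod.smul_fst, Prod.smul_snd, map_smul, LinearMap.smul_apply,
        smul_eq_mul]; ring)
    (fun u v v' => by
      simp only [Prod.fst_add, Prod.snd_add, map_add, LinearMap.add_apply, mul_add]; ring)
    (fun c u v => by
      simp only [Prod.smul_fst, Prod.smul_snd, map_smul, LinearMap.smul_apply,
        smul_eq_mul]; ring)

/-- Isomorphism of algebras-with-forms: a linear bijection intertwining the
multiplications and pulling the target form back to the source form. -/
def Iso (F : BilinAlg A) (F' : BilinAlg A') : Prop :=
  ∃ Φ : A ≃ₗ[ℝ] A',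
    (∀ x y, Φ (F.mul x y) = F'.mul (Φ x) (Φ y)) ∧
    (∀ x y, F'.form (Φ x) (Φ y) = F.form x y)

end BilinAlg

namespace BilinAlg

variable {A A' : Type*} [AddCommGroup A] [Module ℝ A] [AddCommGroup A'] [Module ℝ A']

@[simp]
theorem hat_mul_apply (F : BilinAlg A) (u v : A × ℝ) :
    F.hat.mul u v =
      (F.mul u.1 v.1 + u.2 • v.1 + v.2 • u.1, F.form u.1 v.1 + u.2 * v.2) := rfl

@[simp]
theorem hat_form_apply (F : BilinAlg A) (u v : A × ℝ) :
    F.hat.form u v = F.form u.1 v.1 + u.2 * v.2 := rfl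

theorem hat_mul_one (F : BilinAlg A) (u : A × ℝ) : F.hat.mul u (0, 1) = u := by simp

theorem hat_one_mul (F : BilinAlg A) (u : A × ℝ) : F.hat.mul (0, 1) u = u := by simp

/-- A multiplicative linear bijection between unitalizations preserves the unit. -/
theorem map_hat_one {F : BilinAlg A} {F' : BilinAlg A'} (Φ : (A × ℝ) ≃ₗ[ℝ] A' × ℝ)
    (hmul : ∀ x y, Φ (F.hat.mul x y) = F'.hat.mul (Φ x) (Φ y)) : Φ (0, 1) = (0, 1) := by
  have h := hmul (Φ.symm (0, 1)) (0, 1)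
  rwa [hat_mul_one, Φ.apply_symm_apply, hat_one_mul, eq_comm] at h

/-- An isomorphism of unitalizations preserves the scalar component. -/
theorem snd_map_hat {F : BilinAlg A} {F' : BilinAlg A'} (Φ : (A × ℝ) ≃ₗ[ℝ] A' × ℝ)
    (hmul : ∀ x y, Φ (F.hat.mul x y) = F'.hat.mul (Φ x) (Φ y))
    (hform : ∀ x y, F'.hat.form (Φ x) (Φ y) = F.hat.form x y) (u : A × ℝ) :
    (Φ u).2 = u.2 := by
  have h := hform u (0, 1)
  rw [map_hat_one Φ hmul] at h
  simpa using h

theorem Iso.hat {F : BilinAlg A} {F' : BilinAlg A'} (h : F.Iso F') : F.hat.Iso F'.hat := by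
  obtain ⟨Φ, hmul, hform⟩ := h
  refine ⟨Φ.prodCongr (LinearEquiv.refl ℝ ℝ), fun u v => ?_, fun u v => ?_⟩
  · ext <;> simp [hmul, hform]
  · simp [hform]

theorem Iso.of_hat {F : BilinAlg A} {F' : BilinAlg A'} (h : F.hat.Iso F'.hat) :
    F.Iso F' := by
  obtain ⟨Φ, hmul, hform⟩ := h
  have hsnd := snd_map_hat Φ hmul hform
  let φ : A →ₗ[ℝ] A' := LinearMap.fst ℝ A' ℝ ∘ₗ Φ.toLinearMap ∘ₗ LinearMap.inl ℝ A ℝ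
  have hφ (x : A) : Φ (x, 0) = (φ x, 0) := Prod.ext rfl (hsnd (x, 0))
  have hinj : Function.Injective φ := fun x y hxy => by
    have hΦ : Φ (x, 0) = Φ (y, 0) := by rw [hφ, hφ, hxy]
    exact congrArg Prod.fst (Φ.injective hΦ)
  have hsurj : Function.Surjective φ := fun y => by
    obtain ⟨⟨x, c⟩, hx⟩ := Φ.surjective (y, 0)
    have hc : c = 0 := by simpa [hx] using (hsnd (x, c)).symm
    subst hc
    exact ⟨x, congrArg Prod.fst ((hφ x).symm.trans hx)⟩
  refine ⟨LinearEquiv.ofBijective φ ⟨hinj, hsurj⟩, fun x y => ?_, fun x y => ?_⟩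
  · have hsplit : F.hat.mul (x, 0) (y, 0) = (F.mul x y, 0) + F.form x y • ((0, 1) : A × ℝ) := by
      simp
    have h := hmul (x, 0) (y, 0)
    rw [hsplit, map_add, map_smul, map_hat_one Φ hmul, hφ, hφ, hφ] at h
    change φ (F.mul x y) = F'.mul (φ x) (φ y)
    simpa using congrArg Prod.fst h
  · change F'.form (φ x) (φ y) = F.form x y
    simpa [hφ] using hform (x, 0) (y, 0)

end BilinAlg

/-- Two finite-dimensional real Frobenius algebras are isomorphic if and only if their
unitalizations are isomorphic. -/
theorem frobenius_iso_iff_unitalization_iso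
    {A A' : Type*} [AddCommGroup A] [Module ℝ A] [FiniteDimensional ℝ A]
    [AddCommGroup A'] [Module ℝ A'] [FiniteDimensional ℝ A']
    (F : BilinAlg A) (F' : BilinAlg A')
    (hF : F.IsFrobenius) (hF' : F'.IsFrobenius) :
    F.Iso F' ↔ F.hat.Iso F'.hat :=
  ⟨BilinAlg.Iso.hat, BilinAlg.Iso.of_hat⟩
end

section
/- Let n ≥ 2 and let (A, ∘, h) be an n-dimensional real special Einstein commutative Codazzi algebra with Einstein constant n−1, i.e. tr(L(x)∘L(y)) = (n−1)·h(x,y) for all x,y ∈ A. Let (Â_h, ∘̂, ĥ) be its unitalization. Then the trace form of Â_h equals (n+1)·ĥ, i.e. tr(L̂(u)∘L̂(v)) = (n+1)·ĥ(u,v) for all u,v ∈ Â_h (so Â_h is an Einstein commutative Codazzi algebra with Einstein constant n+1); and Â_h is associative if and only if (A,∘,h) is conformally associative, equivalently if and only if (x∘y)∘z − x∘(y∘z) = h(y,z)·x − h(x,y)·z for all x,y,z ∈ A. -/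
namespace CommCodazziAlg

variable {A : Type*} [AddCommGroup A] [Module ℝ A]

/-- The multiplication `(x,λ)∘̂(y,μ) = (x∘y + λy + μx, h(x,y) + λμ)` of the unitalization
`Â_h = A ⊕ ℝ`. -/
noncomputable def hatMul (Cz : CommCodazziAlg A) :
    (A × ℝ) →ₗ[ℝ] (A × ℝ) →ₗ[ℝ] (A × ℝ) :=
  LinearMap.mk₂ ℝ
    (fun u v => (Cz.mul u.1 v.1 + u.2 • v.1 + v.2 • u.1, Cz.form u.1 v.1 + u.2 * v.2))
    (fun u u' v => by
      simp only [Prod.fst_add, Prod.snd_add, map_add, LinearMap.add_apply, add_smul,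
        smul_add, add_mul, Prod.mk_add_mk, Prod.mk.injEq]
      exact ⟨by abel, by ring⟩)
    (fun c u v => by
      simp only [Prod.smul_fst, Prod.smul_snd, map_smul, LinearMap.smul_apply,
        smul_eq_mul, Prod.smul_mk, Prod.mk.injEq]
      exact ⟨by module, by ring⟩)
    (fun u v v' => by
      simp only [Prod.fst_add, Prod.snd_add, map_add, LinearMap.add_apply, smul_add,
        add_smul, mul_add, Prod.mk_add_mk, Prod.mk.injEq]
      exact ⟨by abel, by ring⟩)
    (fun c u v => by
      simp only [Prod.smul_fst, Prod.smul_snd, map_smul, LinearMap.smul_apply,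
        smul_eq_mul, Prod.smul_mk, Prod.mk.injEq]
      exact ⟨by module, by ring⟩)

/-- The bilinear form `ĥ((x,λ),(y,μ)) = h(x,y) + λμ` of the unitalization `Â_h = A ⊕ ℝ`. -/
noncomputable def hatForm (Cz : CommCodazziAlg A) :
    (A × ℝ) →ₗ[ℝ] (A × ℝ) →ₗ[ℝ] ℝ :=
  LinearMap.mk₂ ℝ
    (fun u v => Cz.form u.1 v.1 + u.2 * v.2)
    (fun u u' v => by
      simp only [Prod.fst_add, Prod.snd_add, map_add, LinearMap.add_apply, add_mul]; ring)
    (fun c u v => by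
      simp only [Prod.smul_fst, Prod.smul_snd, map_smul, LinearMap.smul_apply,
        smul_eq_mul]; ring)
    (fun u v v' => by
      simp only [Prod.fst_add, Prod.snd_add, map_add, LinearMap.add_apply, mul_add]; ring)
    (fun c u v => by
      simp only [Prod.smul_fst, Prod.smul_snd, map_smul, LinearMap.smul_apply,
        smul_eq_mul]; ring)

end CommCodazziAlg

namespace LinearMap

/-- The trace of an endomorphism of `M × R` is the sum of the traces of its diagonal blocks. -/
theorem trace_prod_self_eq {R M : Type*} [CommRing R] [AddCommGroup M] [Module R M]
    [Module.Free R M] [Module.Finite R M] (f : (M × R) →ₗ[R] (M × R)) :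
    trace R (M × R) f = trace R M (fst R M R ∘ₗ f ∘ₗ inl R M R) + (f (0, 1)).2 := by
  have hf : f = (f ∘ₗ inl R M R) ∘ₗ fst R M R + (f ∘ₗ inr R M R) ∘ₗ snd R M R := by
    have hzero : f (0, 0) = 0 := map_zero f
    ext <;> simp [hzero]
  have hscalar : snd R M R ∘ₗ f ∘ₗ inr R M R = LinearMap.id.smulRight (f (0, 1)).2 := by
    ext; simp
  conv_lhs => rw [hf]
  rw [map_add, trace_comp_comm' (fst R M R) (f ∘ₗ inl R M R),
    trace_comp_comm' (snd R M R) (f ∘ₗ inr R M R), hscalar, trace_smulRight]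
  rfl

end LinearMap

namespace CommCodazziAlg

variable {A : Type*} [AddCommGroup A] [Module ℝ A]

theorem hatMul_apply (Cz : CommCodazziAlg A) (u v : A × ℝ) :
    Cz.hatMul u v =
      (Cz.mul u.1 v.1 + u.2 • v.1 + v.2 • u.1, Cz.form u.1 v.1 + u.2 * v.2) := rfl

theorem hatForm_apply (Cz : CommCodazziAlg A) (u v : A × ℝ) :
    Cz.hatForm u v = Cz.form u.1 v.1 + u.2 * v.2 := rfl

/-- The trace form of the unitalization, in terms of traces on the original algebra. -/
theorem trace_hatMul_comp_hatMul [FiniteDimensional ℝ A] (Cz : CommCodazziAlg A)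
    (u v : A × ℝ) :
    LinearMap.trace ℝ (A × ℝ) (Cz.hatMul u ∘ₗ Cz.hatMul v) =
      LinearMap.trace ℝ A (Cz.mul u.1 ∘ₗ Cz.mul v.1) +
        v.2 * LinearMap.trace ℝ A (Cz.mul u.1) + u.2 * LinearMap.trace ℝ A (Cz.mul v.1) +
        u.2 * v.2 * Module.finrank ℝ A + 2 * Cz.form u.1 v.1 + u.2 * v.2 := by
  have hblock : LinearMap.fst ℝ A ℝ ∘ₗ (Cz.hatMul u ∘ₗ Cz.hatMul v) ∘ₗ LinearMap.inl ℝ A ℝ =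
      Cz.mul u.1 ∘ₗ Cz.mul v.1 + v.2 • Cz.mul u.1 + u.2 • Cz.mul v.1 +
        (u.2 * v.2) • LinearMap.id + (Cz.form v.1).smulRight u.1 := by
    ext a
    simp only [LinearMap.comp_apply, LinearMap.inl_apply, LinearMap.fst_apply, hatMul_apply,
      LinearMap.add_apply, LinearMap.smul_apply, LinearMap.id_apply,
      LinearMap.smulRight_apply, map_add, map_smul, zero_smul, mul_zero, add_zero]
    module
  rw [LinearMap.trace_prod_self_eq, hblock]
  simp only [map_add, map_smul, LinearMap.trace_id, LinearMap.trace_smulRight,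
    LinearMap.comp_apply, hatMul_apply, smul_eq_mul, map_zero, smul_zero, mul_one, one_smul,
    zero_add, Cz.form_symm v.1 u.1]
  ring

/-- The unitalization is associative iff the associator of the original algebra is that of a
space of constant curvature. -/
theorem hatMul_assoc_iff (Cz : CommCodazziAlg A) :
    (∀ u v w : A × ℝ, Cz.hatMul (Cz.hatMul u v) w = Cz.hatMul u (Cz.hatMul v w)) ↔
      ∀ x y z : A, Cz.mul (Cz.mul x y) z - Cz.mul x (Cz.mul y z) =
        Cz.form y z • x - Cz.form x y • z := by
  constructor
  · intro h x y z
    have key := congrArg Prod.fst (h (x, 0) (y, 0) (z, 0))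
    simp only [hatMul_apply, zero_smul, add_zero, mul_zero] at key
    rw [sub_eq_sub_iff_add_eq_add, key, add_comm]
  · rintro h ⟨x, a⟩ ⟨y, b⟩ ⟨z, c⟩
    simp only [hatMul_apply, map_add, map_smul, LinearMap.add_apply, LinearMap.smul_apply,
      smul_eq_mul, Prod.mk.injEq]
    constructor
    · rw [sub_eq_iff_eq_add.mp (h x y z)]
      module
    · rw [Cz.invariant]
      ring

/-- With Einstein constant `n - 1`, conformal associativity is an identity for the associator. -/
theorem confAssoc_sub_one_iff (Cz : CommCodazziAlg A) {n : ℕ} (hn : 2 ≤ n) :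
    Cz.ConfAssoc n ((n : ℝ) - 1) ↔
      ∀ x y z : A, Cz.mul (Cz.mul x y) z - Cz.mul x (Cz.mul y z) =
        Cz.form y z • x - Cz.form x y • z := by
  have hn' : (n : ℝ) - 1 ≠ 0 := by
    have : (2 : ℝ) ≤ n := by exact_mod_cast hn
    linarith
  simp only [ConfAssoc, div_self hn', one_mul]
  constructor
  · intro h x y z
    rw [← sub_eq_zero]
    refine Cz.form_nondeg _ fun u => ?_
    rw [map_sub, LinearMap.sub_apply, h]
    simp
  · intro h x y z u
    rw [h]
    simp

end CommCodazziAlg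

/-- The unitalization of an `n`-dimensional special Einstein commutative Codazzi algebra with
Einstein constant `n−1` is Einstein with constant `n+1`, and it is associative iff the
original algebra is conformally associative, equivalently iff
`(x∘y)∘z − x∘(y∘z) = h(y,z)·x − h(x,y)·z` for all `x, y, z`. -/
theorem unitalization_einstein_and_associativity
    {A : Type*} [AddCommGroup A] [Module ℝ A] [FiniteDimensional ℝ A]
    (n : ℕ) (hn : 2 ≤ n) (Cz : CommCodazziAlg A)
    (hdim : Module.finrank ℝ A = n)
    (hspecial : ∀ x, LinearMap.trace ℝ A (Cz.mul x) = 0)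
    (heinstein : ∀ x y, LinearMap.trace ℝ A (Cz.mul x ∘ₗ Cz.mul y) =
      ((n : ℝ) - 1) * Cz.form x y) :
    (∀ u v : A × ℝ, LinearMap.trace ℝ (A × ℝ) (Cz.hatMul u ∘ₗ Cz.hatMul v) =
      ((n : ℝ) + 1) * Cz.hatForm u v) ∧
    ((∀ u v w : A × ℝ, Cz.hatMul (Cz.hatMul u v) w = Cz.hatMul u (Cz.hatMul v w)) ↔
      Cz.ConfAssoc n ((n : ℝ) - 1)) ∧
    ((∀ u v w : A × ℝ, Cz.hatMul (Cz.hatMul u v) w = Cz.hatMul u (Cz.hatMul v w)) ↔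
      (∀ x y z : A, Cz.mul (Cz.mul x y) z - Cz.mul x (Cz.mul y z) =
        Cz.form y z • x - Cz.form x y • z)) := by
  refine ⟨fun u v => ?_, ?_, Cz.hatMul_assoc_iff⟩
  · rw [Cz.trace_hatMul_comp_hatMul, hspecial, hspecial, heinstein, hdim, Cz.hatForm_apply]
    ring
  · rw [Cz.confAssoc_sub_one_iff hn, Cz.hatMul_assoc_iff]
end

section
/- Let n ≥ 2 and let (A, ∘, h) be an n-dimensional real special Einstein commutative Codazzi algebra with Einstein constant n(n−1). On Â := A ⊕ ℝ define the commutative multiplication (x,r)∘'(y,s) := (√((n+2)/n)·(x∘y) − s·x − r·y, n·r·s − h(x,y)) and the bilinear form h'((x,r),(y,s)) := h(x,y) + r·s. Then (Â, ∘', h') is an (n+1)-dimensional real special Einstein commutative Codazzi algebra with Einstein constant n(n+1) (i.e. h' is nondegenerate symmetric and invariant, tr L'((x,r)) = 0, and tr(L'(u)∘L'(v)) = n(n+1)·h'(u,v) for all u,v ∈ Â); and (Â, ∘', h') is conformally associative if and only if (A, ∘, h) is conformally associative. -/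
/-- Conformal associativity for a multiplication and a bilinear form in dimension `n` with
Einstein constant `κ`. -/
def ConfAssocPred {M : Type*} [AddCommGroup M] [Module ℝ M]
    (mul : M →ₗ[ℝ] M →ₗ[ℝ] M) (form : M →ₗ[ℝ] M →ₗ[ℝ] ℝ) (n : ℕ) (κ : ℝ) : Prop :=
  ∀ x y z u, form (mul (mul x y) z - mul x (mul y z)) u =
    (κ / ((n : ℝ) - 1)) * (form y z * form x u - form x y * form z u)

namespace CommCodazziAlg

variable {A : Type*} [AddCommGroup A] [Module ℝ A]

/-- The extended multiplication
`(x,r)∘'(y,s) := (√((n+2)/n)·(x∘y) − s·x − r·y, n·r·s − h(x,y))` on `A ⊕ ℝ`. -/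
noncomputable def extMul (Cz : CommCodazziAlg A) (n : ℕ) :
    (A × ℝ) →ₗ[ℝ] (A × ℝ) →ₗ[ℝ] (A × ℝ) :=
  LinearMap.mk₂ ℝ
    (fun u v => (Real.sqrt (((n : ℝ) + 2) / (n : ℝ)) • Cz.mul u.1 v.1
        - v.2 • u.1 - u.2 • v.1,
      (n : ℝ) * u.2 * v.2 - Cz.form u.1 v.1))
    (fun u u' v => by
      simp only [Prod.fst_add, Prod.snd_add, map_add, LinearMap.add_apply, add_smul,
        smul_add, add_mul, mul_add, Prod.mk_add_mk, Prod.mk.injEq]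
      exact ⟨by abel, by ring⟩)
    (fun c u v => by
      simp only [Prod.smul_fst, Prod.smul_snd, map_smul, LinearMap.smul_apply,
        smul_eq_mul, Prod.smul_mk, Prod.mk.injEq]
      exact ⟨by module, by ring⟩)
    (fun u v v' => by
      simp only [Prod.fst_add, Prod.snd_add, map_add, LinearMap.add_apply, smul_add,
        add_smul, mul_add, Prod.mk_add_mk, Prod.mk.injEq]
      exact ⟨by abel, by ring⟩)
    (fun c u v => by
      simp only [Prod.smul_fst, Prod.smul_snd, map_smul, LinearMap.smul_apply,
        smul_eq_mul, Prod.smul_mk, Prod.mk.injEq]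
      exact ⟨by module, by ring⟩)

/-- The extended bilinear form `h'((x,r),(y,s)) := h(x,y) + r·s` on `A ⊕ ℝ`. -/
noncomputable def extForm (Cz : CommCodazziAlg A) :
    (A × ℝ) →ₗ[ℝ] (A × ℝ) →ₗ[ℝ] ℝ :=
  LinearMap.mk₂ ℝ
    (fun u v => Cz.form u.1 v.1 + u.2 * v.2)
    (fun u u' v => by
      simp only [Prod.fst_add, Prod.snd_add, map_add, LinearMap.add_apply, add_mul]; ring)
    (fun c u v => by
      simp only [Prod.smul_fst, Prod.smul_snd, map_smul, LinearMap.smul_apply,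
        smul_eq_mul]; ring)
    (fun u v v' => by
      simp only [Prod.fst_add, Prod.snd_add, map_add, LinearMap.add_apply, mul_add]; ring)
    (fun c u v => by
      simp only [Prod.smul_fst, Prod.smul_snd, map_smul, LinearMap.smul_apply,
        smul_eq_mul]; ring)

end CommCodazziAlg

/-- The trace of an endomorphism of `A × ℝ` is the sum of the traces of its diagonal blocks. -/
theorem LinearMap.trace_prod_real {A : Type*} [AddCommGroup A] [Module ℝ A]
    [FiniteDimensional ℝ A] (f : (A × ℝ) →ₗ[ℝ] (A × ℝ)) :
    LinearMap.trace ℝ (A × ℝ) f =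
      LinearMap.trace ℝ A (LinearMap.fst ℝ A ℝ ∘ₗ f ∘ₗ LinearMap.inl ℝ A ℝ) + (f (0, 1)).2 := by
  have hf : f = (f ∘ₗ LinearMap.inl ℝ A ℝ) ∘ₗ LinearMap.fst ℝ A ℝ +
      (LinearMap.snd ℝ A ℝ).smulRight (f (0, 1)) := by
    refine LinearMap.ext fun u => ?_
    simp only [LinearMap.add_apply, LinearMap.comp_apply, LinearMap.smulRight_apply,
      LinearMap.inl_apply, LinearMap.fst_apply, LinearMap.snd_apply]
    rw [← map_smul, ← map_add]
    simp
  conv_lhs => rw [hf]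
  rw [map_add, LinearMap.trace_smulRight, LinearMap.trace_comp_comm']
  rfl

namespace CommCodazziAlg

variable {A : Type*} [AddCommGroup A] [Module ℝ A]

theorem extMul_apply (Cz : CommCodazziAlg A) (n : ℕ) (u v : A × ℝ) :
    Cz.extMul n u v = (Real.sqrt (((n : ℝ) + 2) / (n : ℝ)) • Cz.mul u.1 v.1
      - v.2 • u.1 - u.2 • v.1, (n : ℝ) * u.2 * v.2 - Cz.form u.1 v.1) := rfl

theorem extForm_apply (Cz : CommCodazziAlg A) (u v : A × ℝ) :
    Cz.extForm u v = Cz.form u.1 v.1 + u.2 * v.2 := rfl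

theorem extMul_comm (Cz : CommCodazziAlg A) (n : ℕ) (u v : A × ℝ) :
    Cz.extMul n u v = Cz.extMul n v u := by
  simp only [extMul_apply, Prod.mk.injEq]
  rw [Cz.mul_comm u.1 v.1, Cz.form_symm u.1 v.1]
  exact ⟨by module, by ring⟩

theorem extForm_symm (Cz : CommCodazziAlg A) (u v : A × ℝ) :
    Cz.extForm u v = Cz.extForm v u := by
  rw [extForm_apply, extForm_apply, Cz.form_symm, _root_.mul_comm u.2]

theorem extForm_nondeg (Cz : CommCodazziAlg A) (u : A × ℝ) (h : ∀ v, Cz.extForm u v = 0) :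
    u = 0 := by
  refine Prod.ext (Cz.form_nondeg _ fun y => ?_) ?_
  · simpa [extForm_apply] using h (y, 0)
  · simpa [extForm_apply] using h (0, 1)

theorem extForm_invariant (Cz : CommCodazziAlg A) (n : ℕ) (u v w : A × ℝ) :
    Cz.extForm (Cz.extMul n u v) w = Cz.extForm u (Cz.extMul n v w) := by
  simp only [extMul_apply, extForm_apply, map_sub, map_smul, LinearMap.sub_apply,
    LinearMap.smul_apply, smul_eq_mul, Cz.invariant]
  ring

theorem trace_extMul [FiniteDimensional ℝ A] (Cz : CommCodazziAlg A)
    (hspecial : ∀ x, LinearMap.trace ℝ A (Cz.mul x) = 0) (u : A × ℝ) :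
    LinearMap.trace ℝ (A × ℝ) (Cz.extMul (Module.finrank ℝ A) u) = 0 := by
  set n := Module.finrank ℝ A with hn
  have hblock : LinearMap.fst ℝ A ℝ ∘ₗ Cz.extMul n u ∘ₗ LinearMap.inl ℝ A ℝ =
      Real.sqrt (((n : ℝ) + 2) / (n : ℝ)) • Cz.mul u.1 - u.2 • LinearMap.id := by
    ext a
    simp [extMul_apply]
  rw [LinearMap.trace_prod_real, hblock]
  simp [extMul_apply, hspecial, LinearMap.trace_id, ← hn]
  ring

theorem trace_extMul_comp [FiniteDimensional ℝ A] (Cz : CommCodazziAlg A)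
    (hpos : 0 < Module.finrank ℝ A)
    (hspecial : ∀ x, LinearMap.trace ℝ A (Cz.mul x) = 0)
    (heinstein : ∀ x y, LinearMap.trace ℝ A (Cz.mul x ∘ₗ Cz.mul y) =
      ((Module.finrank ℝ A : ℝ) * ((Module.finrank ℝ A : ℝ) - 1)) * Cz.form x y)
    (u v : A × ℝ) :
    LinearMap.trace ℝ (A × ℝ)
        (Cz.extMul (Module.finrank ℝ A) u ∘ₗ Cz.extMul (Module.finrank ℝ A) v) =
      ((Module.finrank ℝ A : ℝ) * ((Module.finrank ℝ A : ℝ) + 1)) * Cz.extForm u v := by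
  set n := Module.finrank ℝ A with hn
  have hn0 : (0 : ℝ) < n := by exact_mod_cast hpos
  have hsq : Real.sqrt (((n : ℝ) + 2) / n) * Real.sqrt (((n : ℝ) + 2) / n) * n = n + 2 := by
    rw [Real.mul_self_sqrt (by positivity)]
    field_simp
  set c := Real.sqrt (((n : ℝ) + 2) / (n : ℝ)) with hc
  have hblock : LinearMap.fst ℝ A ℝ ∘ₗ (Cz.extMul n u ∘ₗ Cz.extMul n v) ∘ₗ
        LinearMap.inl ℝ A ℝ =
      (c * c) • (Cz.mul u.1 ∘ₗ Cz.mul v.1) - (c * v.2) • Cz.mul u.1 - (u.2 * c) • Cz.mul v.1 +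
        (u.2 * v.2) • LinearMap.id + (Cz.form v.1).smulRight u.1 := by
    ext a
    simp only [LinearMap.comp_apply, LinearMap.inl_apply, LinearMap.fst_apply, extMul_apply,
      ← hc, LinearMap.add_apply, LinearMap.sub_apply, LinearMap.smul_apply,
      LinearMap.smulRight_apply, LinearMap.id_apply, map_sub, map_smul, zero_smul, sub_zero,
      mul_zero]
    module
  rw [LinearMap.trace_prod_real, hblock]
  simp only [map_add, map_sub, map_smul, heinstein, hspecial, LinearMap.trace_smulRight,
    LinearMap.trace_id, ← hn, smul_eq_mul, LinearMap.comp_apply, extMul_apply, extForm_apply,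
    Cz.form_symm v.1 u.1, map_neg, map_zero, smul_zero, one_smul, zero_sub, sub_zero, mul_one]
  linear_combination ((n : ℝ) - 1) * Cz.form u.1 v.1 * hsq

theorem confAssocPred_ext_iff (Cz : CommCodazziAlg A) {n : ℕ} (hn : 2 ≤ n) :
    ConfAssocPred (Cz.extMul n) Cz.extForm (n + 1) ((n : ℝ) * ((n : ℝ) + 1)) ↔
      ConfAssocPred Cz.mul Cz.form n ((n : ℝ) * ((n : ℝ) - 1)) := by
  have hn2 : (2 : ℝ) ≤ n := by exact_mod_cast hn
  have hn0 : (n : ℝ) ≠ 0 := by linarith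
  have hn1 : (n : ℝ) - 1 ≠ 0 := by linarith
  have hκ : (n : ℝ) * ((n : ℝ) - 1) / ((n : ℝ) - 1) = n := by field_simp
  have hκ' : (n : ℝ) * ((n : ℝ) + 1) / (((n + 1 : ℕ) : ℝ) - 1) = n + 1 := by
    push_cast
    rw [add_sub_cancel_right]
    field_simp
  have hsq : Real.sqrt (((n : ℝ) + 2) / n) * Real.sqrt (((n : ℝ) + 2) / n) * n = n + 2 := by
    rw [Real.mul_self_sqrt (by positivity)]
    field_simp
  unfold ConfAssocPred
  rw [hκ, hκ']
  simp only [extMul_apply, extForm_apply, Prod.fst_sub, Prod.snd_sub]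
  set c := Real.sqrt (((n : ℝ) + 2) / (n : ℝ)) with hc
  constructor
  · intro h x y z u
    have := h (x, 0) (y, 0) (z, 0) (u, 0)
    simp only [map_sub, map_smul, LinearMap.sub_apply, LinearMap.smul_apply, smul_eq_mul,
      zero_smul, sub_zero, mul_zero, zero_mul, add_zero, zero_sub] at this ⊢
    have hne : (n : ℝ) + 2 ≠ 0 := by linarith
    apply mul_left_cancel₀ hne
    linear_combination (n : ℝ) * this - (Cz.form (Cz.mul (Cz.mul x y) z) u -
      Cz.form (Cz.mul x (Cz.mul y z)) u) * hsq
  · rintro h ⟨x, r⟩ ⟨y, s⟩ ⟨z, t⟩ ⟨u, q⟩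
    have := h x y z u
    simp only [map_sub, map_smul, LinearMap.sub_apply, LinearMap.smul_apply, smul_eq_mul] at this ⊢
    linear_combination c * c * this +
      (Cz.form y z * Cz.form x u - Cz.form x y * Cz.form z u) * hsq - c * q * Cz.invariant x y z

end CommCodazziAlg

/-- The extension `(Â, ∘', h')` of an `n`-dimensional special Einstein commutative Codazzi
algebra with Einstein constant `n(n−1)` is an `(n+1)`-dimensional special Einstein
commutative Codazzi algebra with Einstein constant `n(n+1)`, and it is conformally
associative iff the original algebra is. -/
theorem extension_einstein_codazzi
    {A : Type*} [AddCommGroup A] [Module ℝ A] [FiniteDimensional ℝ A]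
    (n : ℕ) (hn : 2 ≤ n) (Cz : CommCodazziAlg A)
    (hdim : Module.finrank ℝ A = n)
    (hspecial : ∀ x, LinearMap.trace ℝ A (Cz.mul x) = 0)
    (heinstein : ∀ x y, LinearMap.trace ℝ A (Cz.mul x ∘ₗ Cz.mul y) =
      ((n : ℝ) * ((n : ℝ) - 1)) * Cz.form x y) :
    (∀ u v : A × ℝ, Cz.extMul n u v = Cz.extMul n v u) ∧
    (∀ u v : A × ℝ, Cz.extForm u v = Cz.extForm v u) ∧
    (∀ u : A × ℝ, (∀ v, Cz.extForm u v = 0) → u = 0) ∧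
    (∀ u v w : A × ℝ, Cz.extForm (Cz.extMul n u v) w = Cz.extForm u (Cz.extMul n v w)) ∧
    Module.finrank ℝ (A × ℝ) = n + 1 ∧
    (∀ u : A × ℝ, LinearMap.trace ℝ (A × ℝ) (Cz.extMul n u) = 0) ∧
    (∀ u v : A × ℝ, LinearMap.trace ℝ (A × ℝ) (Cz.extMul n u ∘ₗ Cz.extMul n v) =
      ((n : ℝ) * ((n : ℝ) + 1)) * Cz.extForm u v) ∧
    (ConfAssocPred (Cz.extMul n) Cz.extForm (n + 1) ((n : ℝ) * ((n : ℝ) + 1)) ↔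
      ConfAssocPred Cz.mul Cz.form n ((n : ℝ) * ((n : ℝ) - 1))) := by
  subst hdim
  exact ⟨Cz.extMul_comm _, Cz.extForm_symm, Cz.extForm_nondeg, Cz.extForm_invariant _,
    by simp, Cz.trace_extMul hspecial,
    Cz.trace_extMul_comp (by omega) hspecial heinstein, Cz.confAssocPred_ext_iff hn⟩
end

section
/- Let n ≥ 1 and suppose Q is a homogeneous cubic polynomial in n real variables satisfying ΔQ = 0 and Σ_{i,j=1}^{n}(∂ᵢ∂ⱼQ)² = n(n−1)·Σ_{i=1}^{n} xᵢ² identically. Define the homogeneous cubic polynomial Q' in n+1 real variables by Q'(x₁,…,x_{n+1}) := (n/6)·x_{n+1}³ − (1/2)·x_{n+1}·Σ_{i=1}^{n} xᵢ² + √((n+2)/n)·Q(x₁,…,xₙ). Then ΔQ' = 0 and Σ_{i,j=1}^{n+1}(∂ᵢ∂ⱼQ')² = n(n+1)·Σ_{i=1}^{n+1} xᵢ² identically. -/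
open MvPolynomial

/-- The extension `Q' := (n/6)·x_{n+1}³ − (1/2)·x_{n+1}·Σᵢxᵢ² + √((n+2)/n)·Q` of a cubic
polynomial `Q` in `n` variables to a cubic polynomial in `n+1` variables. -/
noncomputable def extendCubic (n : ℕ) (Q : MvPolynomial (Fin n) ℝ) :
    MvPolynomial (Fin (n + 1)) ℝ :=
  C ((n : ℝ) / 6) * X (Fin.last n) ^ 3
    - C (1 / 2 : ℝ) * (X (Fin.last n) * ∑ i : Fin n, X (Fin.castSucc i) ^ 2)
    + C (Real.sqrt (((n : ℝ) + 2) / (n : ℝ))) * rename Fin.castSucc Q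

theorem pderiv_rename_of_notMem_range {σ τ R : Type*} [CommSemiring R] {f : σ → τ} {t : τ}
    (ht : t ∉ Set.range f) (p : MvPolynomial σ R) : pderiv t (rename f p) = 0 := by
  classical
  refine pderiv_eq_zero_of_notMem_vars fun h => ht ?_
  obtain ⟨i, -, hi⟩ := Finset.mem_image.1 (vars_rename f p h)
  exact ⟨i, hi⟩

theorem pderiv_last_rename_castSucc {n : ℕ} (p : MvPolynomial (Fin n) ℝ) :
    pderiv (Fin.last n) (rename Fin.castSucc p) = 0 :=
  pderiv_rename_of_notMem_range (fun ⟨i, hi⟩ => Fin.castSucc_ne_last i hi) p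

theorem pderiv_sum_X_sq {n : ℕ} (i : Fin n) :
    pderiv i (∑ j : Fin n, X j ^ 2 : MvPolynomial (Fin n) ℝ) = 2 * X i := by
  simp [Derivation.leibniz_pow, pderiv_X, Pi.single_apply]

theorem extendCubic_eq (n : ℕ) (Q : MvPolynomial (Fin n) ℝ) :
    extendCubic n Q = C ((n : ℝ) / 6) * X (Fin.last n) ^ 3
      - C (1 / 2 : ℝ) * (X (Fin.last n) * rename Fin.castSucc (∑ i : Fin n, X i ^ 2))
      + C (Real.sqrt (((n : ℝ) + 2) / (n : ℝ))) * rename Fin.castSucc Q := by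
  simp [extendCubic]

theorem C_half_mul_two {σ : Type*} (p : MvPolynomial σ ℝ) : C (1 / 2 : ℝ) * (2 * p) = p := by
  rw [← mul_assoc, ← map_ofNat C 2, ← C_mul]
  norm_num

theorem pderiv_last_extendCubic (n : ℕ) (Q : MvPolynomial (Fin n) ℝ) :
    pderiv (Fin.last n) (extendCubic n Q) = C ((n : ℝ) / 2) * X (Fin.last n) ^ 2
      - C (1 / 2 : ℝ) * rename Fin.castSucc (∑ i : Fin n, X i ^ 2) := by
  have h : (C ((n : ℝ) / 2) : MvPolynomial (Fin (n + 1)) ℝ) = C ((n : ℝ) / 6) * 3 := by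
    rw [← map_ofNat C 3, ← C_mul]
    ring_nf
  rw [extendCubic_eq, h]
  simp only [map_add, map_sub, pderiv_C, Derivation.leibniz, Derivation.leibniz_pow,
    pderiv_X_self, pderiv_last_rename_castSucc, smul_eq_mul, nsmul_eq_mul]
  push_cast
  ring

theorem pderiv_castSucc_extendCubic (n : ℕ) (Q : MvPolynomial (Fin n) ℝ) (i : Fin n) :
    pderiv i.castSucc (extendCubic n Q) = -(X (Fin.last n) * X i.castSucc)
      + C (Real.sqrt (((n : ℝ) + 2) / (n : ℝ))) * rename Fin.castSucc (pderiv i Q) := by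
  rw [extendCubic_eq]
  simp only [map_add, map_sub, pderiv_C, Derivation.leibniz, Derivation.leibniz_pow,
    pderiv_X_of_ne (Fin.castSucc_ne_last i).symm, pderiv_rename (Fin.castSucc_injective n),
    pderiv_sum_X_sq, smul_eq_mul, nsmul_eq_mul, map_mul, map_ofNat, rename_X]
  linear_combination -C_half_mul_two (X (Fin.last n) * X i.castSucc)

theorem pderiv_last_last_extendCubic (n : ℕ) (Q : MvPolynomial (Fin n) ℝ) :
    pderiv (Fin.last n) (pderiv (Fin.last n) (extendCubic n Q)) =
      C (n : ℝ) * X (Fin.last n) := by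
  have h : (C (n : ℝ) : MvPolynomial (Fin (n + 1)) ℝ) = C ((n : ℝ) / 2) * 2 := by
    rw [← map_ofNat C 2, ← C_mul, div_mul_cancel₀ _ two_ne_zero]
  rw [pderiv_last_extendCubic, h]
  simp only [map_sub, pderiv_C, Derivation.leibniz, Derivation.leibniz_pow,
    pderiv_X_self, pderiv_last_rename_castSucc, smul_eq_mul, nsmul_eq_mul]
  push_cast
  ring

theorem pderiv_last_castSucc_extendCubic (n : ℕ) (Q : MvPolynomial (Fin n) ℝ) (i : Fin n) :
    pderiv (Fin.last n) (pderiv i.castSucc (extendCubic n Q)) = -X i.castSucc := by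
  rw [pderiv_castSucc_extendCubic]
  simp [Derivation.leibniz, pderiv_X_of_ne (Fin.castSucc_ne_last i),
    pderiv_last_rename_castSucc]

theorem pderiv_castSucc_last_extendCubic (n : ℕ) (Q : MvPolynomial (Fin n) ℝ) (i : Fin n) :
    pderiv i.castSucc (pderiv (Fin.last n) (extendCubic n Q)) = -X i.castSucc := by
  rw [pderiv_last_extendCubic]
  simp only [map_sub, pderiv_C, Derivation.leibniz, Derivation.leibniz_pow,
    pderiv_X_of_ne (Fin.castSucc_ne_last i).symm, pderiv_rename (Fin.castSucc_injective n),
    pderiv_sum_X_sq, smul_eq_mul, nsmul_eq_mul, map_mul, map_ofNat, rename_X]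
  linear_combination -C_half_mul_two (X i.castSucc)

theorem pderiv_castSucc_castSucc_extendCubic (n : ℕ) (Q : MvPolynomial (Fin n) ℝ)
    (i j : Fin n) :
    pderiv i.castSucc (pderiv j.castSucc (extendCubic n Q)) =
      rename Fin.castSucc (C (Real.sqrt (((n : ℝ) + 2) / (n : ℝ))) * pderiv i (pderiv j Q))
        - if i = j then X (Fin.last n) else 0 := by
  rw [pderiv_castSucc_extendCubic]
  simp only [map_add, map_neg, map_mul, rename_C, pderiv_C, Derivation.leibniz,
    pderiv_X_of_ne (Fin.castSucc_ne_last i).symm, pderiv_rename (Fin.castSucc_injective n),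
    smul_eq_mul]
  split_ifs with h
  · subst h
    simp only [pderiv_X_self]
    ring
  · rw [pderiv_X_of_ne fun e => h (Fin.castSucc_injective n e).symm]
    ring

/-- If the homogeneous cubic `Q` in `n ≥ 1` variables satisfies `ΔQ = 0` and
`|Hess Q|² = n(n−1)·|x|²`, then `Q' := extendCubic n Q` satisfies `ΔQ' = 0` and
`|Hess Q'|² = n(n+1)·|x|²`. -/
theorem extendCubic_einstein (n : ℕ) (hn : 1 ≤ n) (Q : MvPolynomial (Fin n) ℝ)
    (hhom : Q.IsHomogeneous 3)
    (hharm : ∑ i : Fin n, pderiv i (pderiv i Q) = 0)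
    (hhess : (∑ i : Fin n, ∑ j : Fin n, (pderiv i (pderiv j Q)) ^ 2) =
      C ((n : ℝ) * ((n : ℝ) - 1)) * ∑ i : Fin n, X i ^ 2) :
    (∑ i : Fin (n + 1), pderiv i (pderiv i (extendCubic n Q)) = 0) ∧
    (∑ i : Fin (n + 1), ∑ j : Fin (n + 1), (pderiv i (pderiv j (extendCubic n Q))) ^ 2) =
      C ((n : ℝ) * ((n : ℝ) + 1)) * ∑ i : Fin (n + 1), X i ^ 2 := by
  constructor
  · simp_rw [Fin.sum_univ_castSucc, pderiv_castSucc_castSucc_extendCubic,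
      pderiv_last_last_extendCubic, if_true, Finset.sum_sub_distrib, ← map_sum,
      ← Finset.mul_sum, hharm]
    simp
  · have hn0 : (n : ℝ) ≠ 0 := by positivity
    set c := Real.sqrt (((n : ℝ) + 2) / (n : ℝ)) with hc
    have hc2 : c ^ 2 * (n * (n - 1)) + 2 = (n : ℝ) * (n + 1) := by
      rw [hc, Real.sq_sqrt (by positivity)]
      field_simp
      ring
    have expand (i j : Fin n) :
        (rename Fin.castSucc (C c * pderiv i (pderiv j Q))
          - if i = j then X (Fin.last n) else 0 : MvPolynomial (Fin (n + 1)) ℝ) ^ 2 =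
        C (c ^ 2) * rename Fin.castSucc (pderiv i (pderiv j Q) ^ 2)
          + if i = j then X (Fin.last n) ^ 2
            - 2 * C c * X (Fin.last n) * rename Fin.castSucc (pderiv i (pderiv i Q)) else 0 := by
      split_ifs with h
      · subst h
        simp only [map_mul, map_pow, rename_C]
        ring
      · simp only [map_mul, map_pow, rename_C]
        ring
    simp_rw [Fin.sum_univ_castSucc, pderiv_castSucc_castSucc_extendCubic,
      pderiv_last_last_extendCubic, pderiv_last_castSucc_extendCubic,
      pderiv_castSucc_last_extendCubic, ← hc, expand, Finset.sum_add_distrib,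
      Finset.sum_ite_eq, Finset.mem_univ, if_true, Finset.sum_sub_distrib, ← Finset.mul_sum,
      ← map_sum, hhess, hharm, ← hc2]
    simp only [map_add, map_mul, map_sub, map_pow, map_sum, rename_X, map_zero,
      map_natCast, map_one, map_ofNat, neg_sq, Finset.sum_const, Finset.card_univ,
      Fintype.card_fin, nsmul_eq_mul]
    have hC : (C c : MvPolynomial (Fin (n + 1)) ℝ) ^ 2 * (↑n * (↑n - 1)) + 2 = ↑n * (↑n + 1) := by
      simpa only [map_add, map_mul, map_sub, map_pow, map_natCast, map_one, map_ofNat] using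
        congrArg (C (σ := Fin (n + 1))) hc2
    linear_combination -X (Fin.last n) ^ 2 * hC
end

section
/- Let n ≥ 2 and let Q be a homogeneous polynomial of degree n in n real variables satisfying det Hess Q = (−1)^{n−1}·(n−1)·Q^{n−2} identically. Define the homogeneous polynomial P of degree n+1 in n+1 real variables by P(x₁,…,x_{n+1}) := x_{n+1}·Q(x₁,…,xₙ). Then det Hess P = (−1)^{n}·n·P^{n−1} identically. -/
open MvPolynomial

open scoped Matrix in
/-- The determinant of `y • H` bordered by `g`, when `g` is related to `H` by identities
of Euler type. -/
theorem Matrix.det_bordered_mul_of_vecMul_eq {ι R : Type*} [Fintype ι] [DecidableEq ι] [CommRing R]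
    (H : Matrix ι ι R) (g x : ι → R) (y c q : R)
    (hH : x ᵥ* H = c • g) (hg : x ⬝ᵥ g = q) :
    (fromBlocks (y • H) (replicateCol (Fin 1) g) (replicateRow (Fin 1) g) 0).det * (c * y) =
      -(y ^ Fintype.card ι * H.det * q) := by
  have key : fromBlocks 1 0 (replicateRow (Fin 1) x) (of fun _ _ => -(c * y)) *
      fromBlocks (y • H) (replicateCol (Fin 1) g) (replicateRow (Fin 1) g) 0 =
      fromBlocks (y • H) (replicateCol (Fin 1) g) 0 (of fun _ _ => q) := by
    rw [fromBlocks_multiply]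
    congr 1
    · simp
    · simp
    · ext a j
      have h : ∑ i, x i * H i j = c * g j := congrFun hH j
      simp only [add_apply, mul_apply, replicateRow_apply, smul_apply, smul_eq_mul, of_apply,
        Fin.sum_univ_one, zero_apply, mul_left_comm _ y, ← Finset.mul_sum, h]
      ring
    · ext a b
      simpa [mul_apply, dotProduct] using hg
  have hdet := congrArg det key
  rw [det_mul, det_fromBlocks_zero₁₂, det_fromBlocks_zero₂₁, det_smul] at hdet
  simp only [det_one, det_unique, of_apply] at hdet
  linear_combination -hdet

/-- The Hessian of `x_{n+1} · Q` is the Hessian of `Q`, scaled by `x_{n+1}` and bordered by the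
gradient of `Q`. -/
theorem MvPolynomial.hessian_X_last_mul_rename {R : Type*} [CommRing R] {n : ℕ}
    (Q : MvPolynomial (Fin n) R) :
    (Matrix.of fun i j => pderiv i (pderiv j (X (Fin.last n) * rename Fin.castSucc Q))).submatrix
        finSumFinEquiv finSumFinEquiv =
      Matrix.fromBlocks
        ((X (Fin.last n) : MvPolynomial (Fin (n + 1)) R) •
          (rename Fin.castSucc).toRingHom.mapMatrix
            (Matrix.of fun i j => pderiv i (pderiv j Q)))
        (Matrix.replicateCol (Fin 1) fun i => rename Fin.castSucc (pderiv i Q))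
        (Matrix.replicateRow (Fin 1) fun i => rename Fin.castSucc (pderiv i Q)) 0 := by
  have hcast (P : MvPolynomial (Fin n) R) (i : Fin n) :
      pderiv i.castSucc (rename Fin.castSucc P) = rename Fin.castSucc (pderiv i P) :=
    pderiv_rename (Fin.castSucc_injective n) _ _
  have hlast (P : MvPolynomial (Fin n) R) :
      pderiv (Fin.last n) (rename Fin.castSucc P) = 0 := by
    refine pderiv_eq_zero_of_notMem_vars fun h => ?_
    classical
    obtain ⟨i, -, hi⟩ := Finset.mem_image.mp (vars_rename _ _ h)
    exact Fin.castSucc_ne_last i hi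
  have hinl (i : Fin n) : (finSumFinEquiv (Sum.inl i) : Fin (n + 1)) = i.castSucc := rfl
  have hinr (i : Fin 1) : (finSumFinEquiv (Sum.inr i) : Fin (n + 1)) = Fin.last n := by
    rw [Subsingleton.elim i 0]; rfl
  ext1 (i | i) (j | j) <;>
    simp [-finSumFinEquiv_apply_left, -finSumFinEquiv_apply_right, hinl, hinr, hcast, hlast]

/-- If the homogeneous degree-`n` polynomial `Q` in `n ≥ 2` variables satisfies
`det Hess Q = (−1)^{n−1}·(n−1)·Q^{n−2}`, then `P := x_{n+1}·Q` in `n+1` variables satisfies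
`det Hess P = (−1)^{n}·n·P^{n−1}`. -/
theorem totallyHessian_extension (n : ℕ) (hn : 2 ≤ n) (Q : MvPolynomial (Fin n) ℝ)
    (hhom : Q.IsHomogeneous n)
    (hQ : (Matrix.of fun i j => pderiv i (pderiv j Q)).det =
      (-1 : MvPolynomial (Fin n) ℝ) ^ (n - 1) * (C ((n : ℝ) - 1) * Q ^ (n - 2))) :
    (Matrix.of fun i j =>
        pderiv i (pderiv j (X (Fin.last n) * rename Fin.castSucc Q))).det =
      (-1 : MvPolynomial (Fin (n + 1)) ℝ) ^ n *
        (C (n : ℝ) * (X (Fin.last n) * rename Fin.castSucc Q) ^ (n - 1)) := by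
  obtain ⟨m, rfl⟩ := Nat.exists_eq_add_of_le' hn
  let φ : MvPolynomial (Fin (m + 2)) ℝ →+* MvPolynomial (Fin (m + 2 + 1)) ℝ :=
    (rename Fin.castSucc).toRingHom
  have hφ (P) : φ P = rename Fin.castSucc P := rfl
  have hφX (i) : φ (X i) = X i.castSucc := rename_X _ _
  have hφC (a) : φ (C a) = C a := rename_C _ _
  rw [← Matrix.det_submatrix_equiv_self (finSumFinEquiv (m := m + 2) (n := 1)),
    hessian_X_last_mul_rename]
  have hH := Matrix.det_bordered_mul_of_vecMul_eq
    (φ.mapMatrix (Matrix.of fun i j => pderiv i (pderiv j Q)))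
    (fun i => φ (pderiv i Q)) (fun i => X i.castSucc) (X (Fin.last _))
    (C ((m : ℝ) + 1)) (C ((m : ℝ) + 2) * φ Q)
    (by
      ext1 j
      have h := congrArg φ (hhom.pderiv (i := j)).sum_X_mul_pderiv
      simpa [hφX, Matrix.vecMul, dotProduct] using h)
    (by
      have h := congrArg φ hhom.sum_X_mul_pderiv
      simpa [hφX, dotProduct,
        map_ofNat φ 2,
        map_ofNat (C (σ := Fin (m + 2 + 1)) (R := ℝ)) 2] using h)
  rw [← RingHom.map_det, hQ] at hH
  have hne : (C ((m : ℝ) + 1) * X (Fin.last (m + 2)) : MvPolynomial (Fin (m + 2 + 1)) ℝ) ≠ 0 :=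
    mul_ne_zero (C_ne_zero.mpr (by positivity)) (X_ne_zero _)
  refine mul_right_cancel₀ hne (hH.trans ?_)
  have hc : (((m + 2 : ℕ) : ℝ) - 1) = m + 1 := by push_cast; ring
  have hc' : ((m + 2 : ℕ) : ℝ) = m + 2 := by push_cast; ring
  rw [hc, hc', ← hφ]
  simp only [map_mul, map_pow, map_neg, map_one, hφC, Fintype.card_fin,
    Nat.add_sub_cancel, show m + 2 - 1 = m + 1 by omega]
  ring
end
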